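/- arXiv:math/0701286 — 4 statements merged into one kernel-verified Lean document; each statement's English description precedes it below -/
import Mathlib

section
/- Let p be a prime, g₀ ≥ 0 and t ≥ 2 integers, and let F₀, φ, F = ker φ be as in the context, with the ℤ[ℤ/pℤ]-module structure on the abelianization F^{ab} induced by conjugation by x₁. Then F^{ab} is isomorphic as a ℤ[ℤ/pℤ]-module to (ℤ[ℤ/pℤ])^{2g₀} ⊕ (ℤ[ℤ/pℤ]/(σ))^{t−2}, where σ = 1 + s + s² + ⋯ + s^{p−1} is the norm element of ℤ[ℤ/pℤ] (s a generator of ℤ/pℤ). Equivalently, the surface S = U/F has a homology basis adapted to the automorphism h induced by conjugation by x₁: it has 2p·g₀ elements γ whose full orbit under h lies in the basis, and (p−1)(t−2) elements γ for which γ, h(γ), …, h^{p−2}(γ) lie in the basis and h^{p−1}(γ) is homologous to −(γ + h(γ) + ⋯ + h^{p−2}(γ)). -/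
/-- Generators of the Fuchsian group `F₀`: `a i`, `b i` (`i < g₀`) and `x j` (`j < t`). -/
inductive Gen (g₀ t : ℕ) : Type
  | a : Fin g₀ → Gen g₀ t
  | b : Fin g₀ → Gen g₀ t
  | x : Fin t → Gen g₀ t

/-- The long relation `x₁ ⋯ x_t [a₁,b₁] ⋯ [a_{g₀},b_{g₀}]`. -/
def longRel (g₀ t : ℕ) : FreeGroup (Gen g₀ t) :=
  ((List.finRange t).map fun j => FreeGroup.of (Gen.x j)).prod *
    ((List.finRange g₀).map fun i =>
      FreeGroup.of (Gen.a i) * FreeGroup.of (Gen.b i) *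
        (FreeGroup.of (Gen.a i))⁻¹ * (FreeGroup.of (Gen.b i))⁻¹).prod

/-- The relations of `F₀`: the long relation and `x_j ^ p` for each `j`. -/
def fuchsRels (p g₀ t : ℕ) : Set (FreeGroup (Gen g₀ t)) :=
  {longRel g₀ t} ∪ {w | ∃ j : Fin t, w = FreeGroup.of (Gen.x j) ^ p}

/-- The group `F₀` with presentation
`⟨a₁,…,a_{g₀}, b₁,…,b_{g₀}, x₁,…,x_t ∣ x₁⋯x_t·[a₁,b₁]⋯[a_{g₀},b_{g₀}] = 1, x_j^p = 1⟩`. -/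
abbrev Fzero (p g₀ t : ℕ) : Type := PresentedGroup (fuchsRels p g₀ t)

/-- The group ring `ℤ[ℤ/pℤ]`. -/
abbrev GrpRing (p : ℕ) : Type := AddMonoidAlgebra ℤ (ZMod p)

/-- The norm element `σ = 1 + s + s² + ⋯ + s^{p−1}` of `ℤ[ℤ/pℤ]`. -/
noncomputable def normElt (p : ℕ) : GrpRing p :=
  ∑ k ∈ Finset.range p, AddMonoidAlgebra.single ((k : ZMod p)) (1 : ℤ)

/-- The generator `s` of `ℤ/pℤ` inside `ℤ[ℤ/pℤ]`. -/
noncomputable def sElt (p : ℕ) : GrpRing p := AddMonoidAlgebra.single (1 : ZMod p) (1 : ℤ)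

section CrossedHom

variable {p : ℕ}

/-- The group of affine maps `m ↦ g • m + v` of a `ℤ[ℤ/pℤ]`-module `M` with linear part
`g ∈ ℤ/pℤ`. -/
@[ext]
structure AffineGrp (p : ℕ) (M : Type*) where
  /-- The linear part. -/
  lin : Multiplicative (ZMod p)
  /-- The translation part. -/
  vec : M

namespace AffineGrp

variable {M : Type*} [AddCommGroup M]

instance : One (AffineGrp p M) := ⟨⟨1, 0⟩⟩

theorem lin_one : (1 : AffineGrp p M).lin = 1 := rfl

theorem vec_one : (1 : AffineGrp p M).vec = 0 := rfl

variable [Module (GrpRing p) M]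

noncomputable instance : Mul (AffineGrp p M) :=
  ⟨fun z w => ⟨z.lin * w.lin, z.vec + AddMonoidAlgebra.of ℤ (ZMod p) z.lin • w.vec⟩⟩

noncomputable instance : Inv (AffineGrp p M) :=
  ⟨fun z => ⟨z.lin⁻¹, -(AddMonoidAlgebra.of ℤ (ZMod p) z.lin⁻¹ • z.vec)⟩⟩

theorem lin_mul (z w : AffineGrp p M) : (z * w).lin = z.lin * w.lin := rfl

theorem vec_mul (z w : AffineGrp p M) :
    (z * w).vec = z.vec + AddMonoidAlgebra.of ℤ (ZMod p) z.lin • w.vec := rfl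

theorem lin_inv (z : AffineGrp p M) : z⁻¹.lin = z.lin⁻¹ := rfl

theorem vec_inv (z : AffineGrp p M) :
    z⁻¹.vec = -(AddMonoidAlgebra.of ℤ (ZMod p) z.lin⁻¹ • z.vec) := rfl

noncomputable instance : Group (AffineGrp p M) :=
  Group.ofLeftAxioms
    (fun x y z => by
      ext1
      · simp only [lin_mul, mul_assoc]
      · simp only [lin_mul, vec_mul, map_mul, smul_add, mul_smul, add_assoc])
    (fun x => by
      ext1
      · simp only [lin_mul, lin_one, one_mul]
      · simp only [vec_mul, vec_one, lin_one, map_one, one_smul, zero_add])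
    (fun x => by
      ext1
      · simp only [lin_mul, lin_inv, lin_one, inv_mul_cancel]
      · simp only [vec_mul, vec_inv, lin_inv, vec_one, neg_add_cancel])

/-- The linear part, as a group homomorphism. -/
def linHom (p : ℕ) (M : Type*) [AddCommGroup M] [Module (GrpRing p) M] :
    AffineGrp p M →* Multiplicative (ZMod p) where
  toFun := lin
  map_one' := rfl
  map_mul' _ _ := rfl

theorem vec_pow (z : AffineGrp p M) (k : ℕ) :
    (z ^ k).vec = (∑ i ∈ Finset.range k, AddMonoidAlgebra.of ℤ (ZMod p) z.lin ^ i) • z.vec := by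
  induction k with
  | zero => simp [vec_one]
  | succ k ih =>
    have hlin : (z ^ k).lin = z.lin ^ k := map_pow (linHom p M) z k
    rw [pow_succ, vec_mul, ih, hlin, map_pow, Finset.sum_range_succ, add_smul]

/-- The affine maps whose translation part is killed by the norm element. -/
def normKilled (p : ℕ) (M : Type*) [AddCommGroup M] [Module (GrpRing p) M] :
    Subgroup (AffineGrp p M) where
  carrier := {z | normElt p • z.vec = 0}
  one_mem' := smul_zero _
  mul_mem' := by
    intro z w hz hw
    simp only [Set.mem_ofPred_eq] at *
    rw [vec_mul, smul_add, smul_comm, hz, hw, smul_zero, add_zero]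
  inv_mem' := by
    intro z hz
    simp only [Set.mem_ofPred_eq] at *
    rw [vec_inv, smul_neg, smul_comm, hz, smul_zero, neg_zero]

end AffineGrp

theorem sum_of_pow_eq_normElt [Fact p.Prime] {g : Multiplicative (ZMod p)} (hg : g ≠ 1) :
    ∑ i ∈ Finset.range p, AddMonoidAlgebra.of ℤ (ZMod p) g ^ i = normElt p := by
  have key : ∀ F : ZMod p → GrpRing p,
      ∑ k ∈ Finset.range p, F (k : ZMod p) = ∑ a : ZMod p, F a := by
    intro F
    refine Finset.sum_bij (fun k _ => (k : ZMod p)) (fun _ _ => Finset.mem_univ _) ?_ ?_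
      (fun _ _ => rfl)
    · intro a ha b hb hab
      have := congrArg ZMod.val hab
      rwa [ZMod.val_cast_of_lt (Finset.mem_range.1 ha),
        ZMod.val_cast_of_lt (Finset.mem_range.1 hb)] at this
    · intro b _
      exact ⟨b.val, Finset.mem_range.2 b.val_lt, ZMod.natCast_zmod_val b⟩
  have hg0 : g.toAdd ≠ 0 := fun h => hg (by simpa using h)
  rw [normElt, key fun a => AddMonoidAlgebra.single a 1,
    ← Equiv.sum_comp (Equiv.mulRight₀ g.toAdd hg0), ← key]
  refine Finset.sum_congr rfl fun i _ => ?_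
  rw [← map_pow, AddMonoidAlgebra.of_apply]
  simp

namespace AffineGrp

variable {M : Type*} [AddCommGroup M] [Module (GrpRing p) M]

theorem pow_eq_one_of_mem_normKilled [Fact p.Prime] {z : AffineGrp p M}
    (hz : z ∈ normKilled p M) (h : z.lin ≠ 1) : z ^ p = 1 := by
  ext1
  · have hlin : (z ^ p).lin = z.lin ^ p := map_pow (linHom p M) z p
    rw [hlin, lin_one, ← toAdd_eq_zero, toAdd_pow]
    simp
  · rw [vec_pow, sum_of_pow_eq_normElt h]
    exact hz

end AffineGrp

/-- A crossed homomorphism from `G` to a `ℤ[ℤ/pℤ]`-module, on which `G` acts through `ψ`. -/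
def IsCrossedHom {G M : Type*} [Group G] [AddCommGroup M] [Module (GrpRing p) M]
    (ψ : G →* Multiplicative (ZMod p)) (D : G → M) : Prop :=
  ∀ w w', D (w * w') = D w + AddMonoidAlgebra.of ℤ (ZMod p) (ψ w) • D w'

namespace IsCrossedHom

variable {G M : Type*} [Group G] [AddCommGroup M] [Module (GrpRing p) M]
  {ψ : G →* Multiplicative (ZMod p)} {D D' : G → M}

theorem map_one (hD : IsCrossedHom ψ D) : D 1 = 0 := by
  simpa [-AddMonoidAlgebra.of_apply] using hD 1 1

theorem map_inv (hD : IsCrossedHom ψ D) (w : G) :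
    D w⁻¹ = -(AddMonoidAlgebra.of ℤ (ZMod p) (ψ w⁻¹) • D w) := by
  have h := hD w⁻¹ w
  rw [inv_mul_cancel, hD.map_one] at h
  exact eq_neg_of_add_eq_zero_left h.symm

theorem map_pow (hD : IsCrossedHom ψ D) (w : G) (k : ℕ) :
    D (w ^ k) = (∑ i ∈ Finset.range k, AddMonoidAlgebra.of ℤ (ZMod p) (ψ w) ^ i) • D w := by
  induction k with
  | zero => simp [hD.map_one]
  | succ k ih => rw [pow_succ, hD, ih, _root_.map_pow, _root_.map_pow, Finset.sum_range_succ,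
      add_smul]

theorem normElt_smul_eq_zero [Fact p.Prime] (hD : IsCrossedHom ψ D) {w : G} (hw : w ^ p = 1)
    (hψ : ψ w ≠ 1) : normElt p • D w = 0 := by
  rw [← sum_of_pow_eq_normElt hψ, ← hD.map_pow, hw, hD.map_one]

/-- The subgroup on which two crossed homomorphisms agree. -/
def eqLocus (hD : IsCrossedHom ψ D) (hD' : IsCrossedHom ψ D') : Subgroup G where
  carrier := {w | D w = D' w}
  one_mem' := hD.map_one.trans hD'.map_one.symm
  mul_mem' := by
    intro z w hz hw
    simp only [Set.mem_ofPred_eq] at *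
    rw [hD, hD', hz, hw]
  inv_mem' := by
    intro z hz
    simp only [Set.mem_ofPred_eq] at *
    rw [hD.map_inv, hD'.map_inv, hz]

end IsCrossedHom

end CrossedHom

section Fuchsian

variable {p g₀ m : ℕ}

/-- The product of the commutators `[a_i, b_i]` in the group `F₀`. -/
def commProd (p g₀ t : ℕ) : Fzero p g₀ t :=
  ((List.finRange g₀).map fun i =>
    (PresentedGroup.of (Gen.a i) : Fzero p g₀ t) * PresentedGroup.of (Gen.b i) *
      (PresentedGroup.of (Gen.a i))⁻¹ * (PresentedGroup.of (Gen.b i))⁻¹).prod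

theorem of_x_pow {t : ℕ} (j : Fin t) :
    (PresentedGroup.of (Gen.x j) : Fzero p g₀ t) ^ p = 1 := by
  rw [PresentedGroup.of, ← map_pow]
  exact PresentedGroup.one_of_mem (Or.inr ⟨j, rfl⟩)

theorem of_x_last :
    (PresentedGroup.of (Gen.x (Fin.last m)) : Fzero p g₀ (m + 1)) =
      (((List.finRange m).map fun j =>
        (PresentedGroup.of (Gen.x j.castSucc) : Fzero p g₀ (m + 1))).prod)⁻¹ *
        (commProd p g₀ (m + 1))⁻¹ := by
  have h : PresentedGroup.mk (fuchsRels p g₀ (m + 1)) (longRel g₀ (m + 1)) = 1 :=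
    PresentedGroup.one_of_mem (Or.inl rfl)
  rw [longRel, List.finRange_succ_last] at h
  simp only [List.map_append, List.map_map, List.prod_append, List.map_cons, List.map_nil,
    List.prod_singleton, map_mul, map_list_prod, Function.comp_def, map_inv] at h
  rw [eq_mul_inv_iff_mul_eq]
  exact eq_inv_of_mul_eq_one_right ((mul_assoc _ _ _).symm.trans h)

theorem eq_top_of_generators_mem {K : Subgroup (Fzero p g₀ (m + 1))}
    (ha : ∀ i, PresentedGroup.of (Gen.a i) ∈ K) (hb : ∀ i, PresentedGroup.of (Gen.b i) ∈ K)
    (hx : ∀ j : Fin m, PresentedGroup.of (Gen.x j.castSucc) ∈ K) : K = ⊤ := by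
  rw [← top_le_iff, ← PresentedGroup.closure_range_of, Subgroup.closure_le]
  rintro _ ⟨i | i | j, rfl⟩
  · exact ha i
  · exact hb i
  · induction j using Fin.lastCases with
    | cast j => exact hx j
    | last =>
      rw [SetLike.mem_coe, of_x_last]
      refine K.mul_mem (K.inv_mem (K.list_prod_mem ?_)) (K.inv_mem (K.list_prod_mem ?_))
      · simp only [List.mem_map]
        rintro _ ⟨j, -, rfl⟩
        exact hx j
      · simp only [List.mem_map]
        rintro _ ⟨i, -, rfl⟩
        exact K.mul_mem (K.mul_mem (K.mul_mem (ha i) (hb i)) (K.inv_mem (ha i)))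
          (K.inv_mem (hb i))

theorem IsCrossedHom.eq_of_generators {M : Type*} [AddCommGroup M] [Module (GrpRing p) M]
    {ψ : Fzero p g₀ (m + 1) →* Multiplicative (ZMod p)} {D D' : Fzero p g₀ (m + 1) → M}
    (hD : IsCrossedHom ψ D) (hD' : IsCrossedHom ψ D')
    (ha : ∀ i, D (PresentedGroup.of (Gen.a i)) = D' (PresentedGroup.of (Gen.a i)))
    (hb : ∀ i, D (PresentedGroup.of (Gen.b i)) = D' (PresentedGroup.of (Gen.b i)))
    (hx : ∀ j : Fin m, D (PresentedGroup.of (Gen.x j.castSucc)) =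
      D' (PresentedGroup.of (Gen.x j.castSucc))) (w : Fzero p g₀ (m + 1)) : D w = D' w := by
  have h : hD.eqLocus hD' = ⊤ := eq_top_of_generators_mem ha hb hx
  exact (h ▸ Subgroup.mem_top w : w ∈ hD.eqLocus hD')

/-- A crossed homomorphism on `F₀` may be prescribed freely on the generators `a_i`, `b_i`, and,
subject to the norm condition, on all but the last of the generators `x_j`. -/
theorem exists_isCrossedHom [Fact p.Prime] {M : Type*} [AddCommGroup M] [Module (GrpRing p) M]
    {ψ : Fzero p g₀ (m + 1) →* Multiplicative (ZMod p)}
    (ha : ∀ i, ψ (PresentedGroup.of (Gen.a i)) = 1)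
    (hb : ∀ i, ψ (PresentedGroup.of (Gen.b i)) = 1)
    (hx : ∀ j, ψ (PresentedGroup.of (Gen.x j)) ≠ 1)
    (α β : Fin g₀ → M) (ξ : Fin m → M) (hξ : ∀ j, normElt p • ξ j = 0) :
    ∃ D : Fzero p g₀ (m + 1) → M, IsCrossedHom ψ D ∧
      (∀ i, D (PresentedGroup.of (Gen.a i)) = α i) ∧
      (∀ i, D (PresentedGroup.of (Gen.b i)) = β i) ∧
      (∀ j : Fin m, D (PresentedGroup.of (Gen.x j.castSucc)) = ξ j) := by
  let X : Fin m → AffineGrp p M := fun j => ⟨ψ (PresentedGroup.of (Gen.x j.castSucc)), ξ j⟩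
  let P : AffineGrp p M := ((List.finRange m).map X).prod
  let f : Gen g₀ (m + 1) → AffineGrp p M := fun
    | .a i => ⟨1, α i⟩
    | .b i => ⟨1, β i⟩
    | .x j => Fin.lastCases (motive := fun _ => AffineGrp p M) P⁻¹ X j
  have hfx : ∀ j : Fin m, f (.x j.castSucc) = X j := fun j => by simp [f]
  have hfl : f (.x (Fin.last m)) = P⁻¹ := by simp [f]
  have hlin : ∀ y, (f y).lin = ψ (PresentedGroup.of y) := by
    rintro (i | i | j)
    · exact (ha i).symm
    · exact (hb i).symm
    · induction j using Fin.lastCases with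
      | cast j => rw [hfx]
      | last =>
        have hC : ψ (commProd p g₀ (m + 1)) = 1 := by
          rw [commProd, map_list_prod]
          refine List.prod_eq_one ?_
          simp only [List.map_map, List.mem_map]
          rintro _ ⟨i, -, rfl⟩
          simp [ha]
        have hP : P.lin = (((List.finRange m).map X).map (AffineGrp.linHom p M)).prod :=
          map_list_prod (AffineGrp.linHom p M) _
        rw [hfl, AffineGrp.lin_inv, hP, of_x_last, map_mul, map_inv, map_inv, hC, map_list_prod,
          inv_one, mul_one, List.map_map, List.map_map]
        rfl
  have hmem : ∀ j, f (.x j) ∈ AffineGrp.normKilled p M := by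
    intro j
    induction j using Fin.lastCases with
    | cast j =>
      rw [hfx]
      exact hξ j
    | last =>
      rw [hfl]
      refine Subgroup.inv_mem _ (Subgroup.list_prod_mem _ ?_)
      simp only [List.mem_map]
      rintro _ ⟨j, -, rfl⟩
      exact hξ j
  have hrel : ∀ r ∈ fuchsRels p g₀ (m + 1), FreeGroup.lift f r = 1 := by
    rintro r (rfl | ⟨j, rfl⟩)
    · rw [longRel, List.finRange_succ_last]
      simp only [List.map_append, List.map_map, List.prod_append, List.map_cons, List.map_nil,
        List.prod_singleton, map_mul, map_list_prod, Function.comp_def, map_inv,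
        FreeGroup.lift_apply_of, hfx, hfl]
      rw [mul_inv_cancel, one_mul]
      refine List.prod_eq_one ?_
      simp only [List.mem_map]
      rintro _ ⟨i, -, rfl⟩
      rw [← commutatorElement_def, commutatorElement_eq_one_iff_mul_comm]
      ext1
      · rfl
      · simp only [AffineGrp.vec_mul, f, map_one, one_smul, add_comm]
    · rw [map_pow, FreeGroup.lift_apply_of]
      exact AffineGrp.pow_eq_one_of_mem_normKilled (hmem j) (hlin (.x j) ▸ hx j)
  let Φ : Fzero p g₀ (m + 1) →* AffineGrp p M := PresentedGroup.toGroup hrel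
  have hΦ : ∀ y, Φ (PresentedGroup.of y) = f y := fun y => PresentedGroup.toGroup.of hrel
  have hΦψ : (AffineGrp.linHom p M).comp Φ = ψ :=
    PresentedGroup.ext fun y => (congrArg AffineGrp.lin (hΦ y)).trans (hlin y)
  refine ⟨fun w => (Φ w).vec, fun w w' => ?_, fun i => ?_, fun i => ?_, fun j => ?_⟩ <;> beta_reduce
  · rw [map_mul, AffineGrp.vec_mul, ← hΦψ]
    rfl
  · rw [hΦ]
  · rw [hΦ]
  · rw [hΦ, hfx]

end Fuchsian

section CyclicAction

variable {p : ℕ} [Fact p.Prime]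

/-- The homomorphism from `ℤ/pℤ` sending the generator to an element of exponent `p`. -/
def zmodPowHom {G : Type*} [Monoid G] (c : G) (hc : c ^ p = 1) : Multiplicative (ZMod p) →* G where
  toFun g := c ^ g.toAdd.val
  map_one' := by simp
  map_mul' g h := by
    rw [toAdd_mul, ZMod.val_add, ← pow_add, ← pow_eq_pow_mod _ hc]

theorem ofAdd_one_pow_val (g : Multiplicative (ZMod p)) :
    (Multiplicative.ofAdd (1 : ZMod p)) ^ g.toAdd.val = g := by
  rw [← ofAdd_nsmul, nsmul_one, ZMod.natCast_zmod_val, ofAdd_toAdd]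

theorem of_eq_sElt_pow (g : Multiplicative (ZMod p)) :
    AddMonoidAlgebra.of ℤ (ZMod p) g = sElt p ^ g.toAdd.val := by
  conv_lhs => rw [← ofAdd_one_pow_val g, map_pow]
  rfl

/-- The `ℤ[ℤ/pℤ]`-module structure on an abelian group given by an endomorphism of exponent `p`. -/
noncomputable abbrev moduleOfPow {A : Type*} [AddCommGroup A] (T : AddMonoid.End A)
    (hT : T ^ p = 1) : Module (GrpRing p) A :=
  Module.compHom A
    (AddMonoidAlgebra.lift ℤ (AddMonoid.End A) (ZMod p) (zmodPowHom T hT)).toRingHom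

theorem sElt_smul_moduleOfPow {A : Type*} [AddCommGroup A] (T : AddMonoid.End A)
    (hT : T ^ p = 1) (y : A) :
    letI := moduleOfPow T hT
    sElt p • y = T y := by
  have hp1 : 1 < p := (Fact.out : p.Prime).one_lt
  change (AddMonoidAlgebra.lift ℤ (AddMonoid.End A) (ZMod p) (zmodPowHom T hT)) (sElt p) y = T y
  rw [sElt, AddMonoidAlgebra.lift_single, one_smul]
  change (T ^ (1 : ZMod p).val) y = T y
  rw [ZMod.val_one, pow_one]

/-- An additive map commuting with the action of the generator is `ℤ[ℤ/pℤ]`-linear. -/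
def linearMapOfGenerator {A M : Type*} [AddCommGroup A] [Module (GrpRing p) A] [AddCommGroup M]
    [Module (GrpRing p) M] (f : A →+ M) (hf : ∀ y, f (sElt p • y) = sElt p • f y) :
    A →ₗ[GrpRing p] M where
  toFun := f
  map_add' := f.map_add
  map_smul' r y := by
    have hpow : ∀ k : ℕ, ∀ y, f (sElt p ^ k • y) = sElt p ^ k • f y := by
      intro k
      induction k with
      | zero => simp
      | succ k ih => intro y; rw [pow_succ, mul_smul, ih, hf, ← mul_smul]
    induction r using AddMonoidAlgebra.induction_on with
    | of g => rw [of_eq_sElt_pow]; exact hpow _ _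
    | add r r' h h' => rw [add_smul, map_add, h, h', RingHom.id_apply, RingHom.id_apply,
        RingHom.id_apply, add_smul]
    | smul k r h => rw [smul_assoc, map_zsmul, h, RingHom.id_apply, RingHom.id_apply, smul_assoc]

theorem IsCrossedHom.eq_of_eq_on_ker {G M : Type*} [Group G] [AddCommGroup M]
    [Module (GrpRing p) M] {ψ : G →* Multiplicative (ZMod p)} {D D' : G → M}
    (hD : IsCrossedHom ψ D) (hD' : IsCrossedHom ψ D') {c : G}
    (hψc : ψ c = Multiplicative.ofAdd 1) (hc : D c = D' c) (h : ∀ w, ψ w = 1 → D w = D' w)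
    (w : G) : D w = D' w := by
  have hw : w = w * (c ^ (ψ w).toAdd.val)⁻¹ * c ^ (ψ w).toAdd.val := by simp
  rw [hw]
  refine (hD.eqLocus hD').mul_mem (h _ ?_) ((hD.eqLocus hD').pow_mem hc _)
  rw [map_mul, _root_.map_inv, _root_.map_pow, hψc, ofAdd_one_pow_val, mul_inv_cancel]

/-- An equivariant homomorphism on the kernel of `ψ` extends to a crossed homomorphism. -/
theorem exists_isCrossedHom_of_equivariant {G A : Type*} [Group G] [AddCommGroup A]
    [Module (GrpRing p) A] {ψ : G →* Multiplicative (ZMod p)} {H : Subgroup G} [H.Normal]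
    (hH : ∀ w, w ∈ H ↔ ψ w = 1) {c : G} (hc : c ^ p = 1) (hψc : ψ c = Multiplicative.ofAdd 1)
    (q : H →* Multiplicative A)
    (hq : ∀ h, (q (MulAut.conjNormal c h)).toAdd = sElt p • (q h).toAdd) :
    ∃ D : G → A, IsCrossedHom ψ D ∧ D c = 0 ∧ ∀ h : H, D h = (q h).toAdd := by
  let s : G →* G := (zmodPowHom c hc).comp ψ
  have hs : ∀ w, ψ (s w) = ψ w := fun w => by
    change ψ (c ^ (ψ w).toAdd.val) = _
    rw [map_pow, hψc, ofAdd_one_pow_val]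
  have hmem : ∀ w, w * (s w)⁻¹ ∈ H := fun w => by
    rw [hH, map_mul, map_inv, hs, mul_inv_cancel]
  have hpow : ∀ k : ℕ, ∀ h, (q (MulAut.conjNormal (c ^ k) h)).toAdd =
      sElt p ^ k • (q h).toAdd := by
    intro k
    induction k with
    | zero => simp
    | succ k ih =>
      intro h
      rw [pow_succ, map_mul, MulAut.mul_apply, ih, hq, pow_succ, mul_smul]
  have hqs : ∀ w h, (q (MulAut.conjNormal (s w) h)).toAdd =
      AddMonoidAlgebra.of ℤ (ZMod p) (ψ w) • (q h).toAdd := fun w h => by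
    rw [of_eq_sElt_pow]
    exact hpow _ _
  refine ⟨fun w => (q ⟨w * (s w)⁻¹, hmem w⟩).toAdd, fun w w' => ?_, ?_, fun h => ?_⟩ <;> beta_reduce
  · rw [← hqs, ← toAdd_mul, ← map_mul]
    congr 2
    ext
    simp [MulAut.conjNormal_apply, mul_assoc]
  · have hsc : s c = c := by
      have hp1 : 1 < p := (Fact.out : p.Prime).one_lt
      change c ^ (ψ c).toAdd.val = c
      rw [hψc, toAdd_ofAdd, ZMod.val_one, pow_one]
    have h1 : (⟨c * (s c)⁻¹, hmem c⟩ : H) = 1 := 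
      Subtype.ext ((congrArg (c * ·⁻¹) hsc).trans (mul_inv_cancel c))
    rw [h1, map_one, toAdd_one]
  · have hsh : s h = 1 := by
      change zmodPowHom c hc (ψ h) = 1
      rw [(hH h).1 h.2, map_one]
    congr 2
    ext
    simp [hsh]

end CyclicAction

section Quotient

variable {R A κ μ : Type*} [CommRing R] [AddCommGroup A] [Module R A] [DecidableEq μ]

theorem smul_single_one_eq_zero {I : Ideal R} {r : R} (hr : r ∈ I) (j : μ) :
    r • (Pi.single j 1 : μ → R ⧸ I) = 0 := by
  rw [← Pi.single_smul, Algebra.smul_def, mul_one, Ideal.Quotient.algebraMap_eq,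
    Ideal.Quotient.eq_zero_iff_mem.2 hr, Pi.single_zero]

theorem exists_linearMap_prod_quotient [Fintype κ] [DecidableEq κ] [Fintype μ] (r : R)
    (v : κ → A) (u : μ → A) (hu : ∀ j, r • u j = 0) :
    ∃ g : ((κ → R) × (μ → R ⧸ Ideal.span {r})) →ₗ[R] A,
      (∀ i, g (Pi.single i 1, 0) = v i) ∧ ∀ j, g (0, Pi.single j 1) = u j := by
  let gu : μ → (R ⧸ Ideal.span {r}) →ₗ[R] A := fun j =>
    Submodule.liftQ _ (LinearMap.toSpanSingleton R A (u j)) (by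
      rw [Ideal.span, Submodule.span_le, Set.singleton_subset_iff]
      exact hu j)
  refine ⟨(LinearMap.lsum R (fun _ => R) ℕ fun i => LinearMap.toSpanSingleton R A (v i)).coprod
    (LinearMap.lsum R (fun _ => R ⧸ Ideal.span {r}) ℕ gu), fun i => ?_, fun j => ?_⟩
  · rw [LinearMap.coprod_apply, map_zero, add_zero, LinearMap.lsum_piSingle,
      LinearMap.toSpanSingleton_apply, one_smul]
  · rw [LinearMap.coprod_apply, map_zero, zero_add, LinearMap.lsum_piSingle]
    exact one_smul R (u j)

end Quotient

section Main

variable {p g₀ m : ℕ} [Fact p.Prime]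

theorem exists_addEquiv_of_normalized {ψ : Fzero p g₀ (m + 2) →* Multiplicative (ZMod p)}
    {H : Subgroup (Fzero p g₀ (m + 2))} [H.Normal] (hH : ∀ w, w ∈ H ↔ ψ w = 1)
    (ha : ∀ i, ψ (PresentedGroup.of (Gen.a i)) = 1)
    (hb : ∀ i, ψ (PresentedGroup.of (Gen.b i)) = 1)
    (hx : ∀ j, ψ (PresentedGroup.of (Gen.x j)) ≠ 1)
    (hx0 : ψ (PresentedGroup.of (Gen.x 0)) = Multiplicative.ofAdd 1) :
    ∃ e : Additive (Abelianization H) ≃+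
        ((Fin (2 * g₀) → GrpRing p) × (Fin m → GrpRing p ⧸ Ideal.span {normElt p})),
      ∀ y : Abelianization H,
        e (Additive.ofMul
            (Abelianization.map
              ((MulAut.conjNormal (PresentedGroup.of (Gen.x 0) : Fzero p g₀ (m + 2)) :
                MulAut H)).toMonoidHom y)) = sElt p • e (Additive.ofMul y) := by
  classical
  let c : Fzero p g₀ (m + 2) := PresentedGroup.of (Gen.x 0)
  have hc : c ^ p = 1 := of_x_pow 0
  let A := Additive (Abelianization H)
  let M := (Fin (2 * g₀) → GrpRing p) × (Fin m → GrpRing p ⧸ Ideal.span {normElt p})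
  let T : AddMonoid.End A :=
    MonoidHom.toAdditive (Abelianization.map (MulAut.conjNormal (H := H) c).toMonoidHom)
  have hTpow : ∀ (k : ℕ) (h : H), (T ^ k) (Additive.ofMul (Abelianization.of h)) =
      Additive.ofMul (Abelianization.of (MulAut.conjNormal (c ^ k) h)) := by
    intro k
    induction k with
    | zero => intro h; simp
    | succ k ih =>
      intro h
      rw [pow_succ, pow_succ, map_mul, MulAut.mul_apply, ← ih]
      rfl
  have hsurj : ∀ y : A, ∃ h : H, Additive.ofMul (Abelianization.of h) = y :=
    fun y => QuotientGroup.mk_surjective y.toMul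
  have hT : T ^ p = 1 := by
    ext y
    obtain ⟨h, rfl⟩ := hsurj y
    rw [hTpow, hc]
    simp
  let _ : Module (GrpRing p) A := moduleOfPow T hT
  have hsmul : ∀ y : A, sElt p • y = T y := sElt_smul_moduleOfPow T hT
  let q : H →* Multiplicative A := (Abelianization.of : H →* Abelianization H)
  obtain ⟨D, hD, hDc, hDq⟩ := exists_isCrossedHom_of_equivariant (A := A) hH hc hx0 q
    (fun h => (hsmul (q h).toAdd).symm)
  let ι : Fin g₀ ⊕ Fin g₀ ≃ Fin (2 * g₀) := finSumFinEquiv.trans (finCongr (two_mul g₀).symm)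
  let α : Fin g₀ → M := fun i => (Pi.single (ι (.inl i)) 1, 0)
  let β : Fin g₀ → M := fun i => (Pi.single (ι (.inr i)) 1, 0)
  let ξ : Fin (m + 1) → M := Fin.cons 0 fun j => (0, Pi.single j 1)
  have hξ : ∀ j, normElt p • ξ j = 0 := by
    intro j
    cases j using Fin.cases with
    | zero => exact smul_zero _
    | succ j =>
      exact Prod.ext (smul_zero _) (smul_single_one_eq_zero (Ideal.mem_span_singleton_self _) j)
  obtain ⟨E, hE, hEa, hEb, hEx⟩ := exists_isCrossedHom ha hb hx α β ξ hξ
  have hEc : E c = 0 := hEx 0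
  let f₀ : A →+ M := MonoidHom.toAdditiveLeft (Abelianization.lift
    { toFun := fun h : H => Multiplicative.ofAdd (E h)
      map_one' := congrArg _ hE.map_one
      map_mul' := fun h h' => by
        rw [Subgroup.coe_mul, hE, (hH _).1 h.2, map_one, one_smul]
        rfl })
  have hf₀ : ∀ h : H, f₀ (Additive.ofMul (Abelianization.of h)) = E h := fun h => rfl
  have hf₀s : ∀ y, f₀ (sElt p • y) = sElt p • f₀ y := by
    intro y
    obtain ⟨h, rfl⟩ := hsurj y
    have h1 : sElt p • (Additive.ofMul (Abelianization.of h) : A) =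
      Additive.ofMul (Abelianization.of (MulAut.conjNormal c h)) := hsmul _
    rw [h1, hf₀, hf₀, MulAut.conjNormal_apply, hE, hE, map_mul, hE.map_inv c, hEc, smul_zero,
      neg_zero, smul_zero, add_zero, zero_add, hx0]
    rfl
  let f : A →ₗ[GrpRing p] M := linearMapOfGenerator f₀ hf₀s
  have hfD : ∀ w, f (D w) = E w := by
    refine IsCrossedHom.eq_of_eq_on_ker (ψ := ψ) (D := fun w => f (D w)) ?_ hE hx0
      (((congrArg f hDc).trans (map_zero f)).trans hEc.symm) fun w hw => ?_
    · intro w w'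
      beta_reduce
      rw [hD, map_add, map_smul]
    · exact (congrArg f (hDq ⟨w, (hH w).2 hw⟩)).trans (hf₀ ⟨w, (hH w).2 hw⟩)
  obtain ⟨g, hg₁, hg₂⟩ := exists_linearMap_prod_quotient (normElt p)
    (fun i => Sum.elim (fun i => D (PresentedGroup.of (Gen.a i)))
      (fun i => D (PresentedGroup.of (Gen.b i))) (ι.symm i))
    (fun j : Fin m => D (PresentedGroup.of (Gen.x j.succ.castSucc)))
    (fun j => hD.normElt_smul_eq_zero (of_x_pow _) (hx _))
  have hga : ∀ i, g (α i) = D (PresentedGroup.of (Gen.a i)) := fun i =>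
    (hg₁ _).trans (by rw [Equiv.symm_apply_apply, Sum.elim_inl])
  have hgb : ∀ i, g (β i) = D (PresentedGroup.of (Gen.b i)) := fun i =>
    (hg₁ _).trans (by rw [Equiv.symm_apply_apply, Sum.elim_inr])
  have hgx : ∀ j, g (ξ j) = D (PresentedGroup.of (Gen.x j.castSucc)) := fun j => by
    cases j using Fin.cases with
    | zero => exact (map_zero g).trans hDc.symm
    | succ j => exact hg₂ j
  have hgE : ∀ w, g (E w) = D w := by
    refine IsCrossedHom.eq_of_generators (ψ := ψ) (D := fun w => g (E w)) ?_ hD ?_ ?_ ?_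
    · intro w w'
      beta_reduce
      rw [hE, map_add, map_smul]
    · exact fun i => (congrArg g (hEa i)).trans (hga i)
    · exact fun i => (congrArg g (hEb i)).trans (hgb i)
    · exact fun j => (congrArg g (hEx j)).trans (hgx j)
  have hgf : g ∘ₗ f = LinearMap.id := by
    ext y
    obtain ⟨h, rfl⟩ := hsurj y
    exact (hgE h).trans (hDq h)
  have hfg : f ∘ₗ g = LinearMap.id := by
    refine LinearMap.prod_ext (LinearMap.pi_ext' fun i => LinearMap.ext_ring ?_)
      (LinearMap.pi_ext' fun j => ?_)
    · obtain ⟨i, rfl⟩ := ι.surjective i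
      obtain i | i := i
      · exact (congrArg f (hga i)).trans ((hfD _).trans (hEa i))
      · exact (congrArg f (hgb i)).trans ((hfD _).trans (hEb i))
    · refine Submodule.linearMap_qext _ (LinearMap.ext_ring ?_)
      exact (congrArg f (hgx j.succ)).trans ((hfD _).trans (hEx j.succ))
  let e : A ≃ₗ[GrpRing p] M := LinearEquiv.ofLinearMap f g hfg hgf
  refine ⟨e.toAddEquiv, fun y => ?_⟩
  exact (congrArg e (hsmul (Additive.ofMul y)).symm).trans (map_smul e _ _)

end Main

/-- with `F = ker φ` and the action of `ℤ/pℤ` on the abelianization `F^{ab}`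
induced by conjugation by `x₁`, the module `F^{ab}` is isomorphic as a `ℤ[ℤ/pℤ]`-module to
`(ℤ[ℤ/pℤ])^{2g₀} ⊕ (ℤ[ℤ/pℤ]/(σ))^{t−2}`: there is an isomorphism of abelian groups
intertwining the action of the generator `s` (multiplication by `single 1 1` on each factor). -/
theorem adapted_basis_module_iso (p g₀ t : ℕ) (hp : p.Prime) (ht : 2 ≤ t)
    (n : Fin t → ℕ) (hn : ∀ j, 0 < n j ∧ n j < p)
    (hsum : (∑ j, (n j : ZMod p)) = 0)
    (φ : Fzero p g₀ t →* Multiplicative (ZMod p))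
    (hφa : ∀ i : Fin g₀, φ (PresentedGroup.of (Gen.a i)) = 1)
    (hφb : ∀ i : Fin g₀, φ (PresentedGroup.of (Gen.b i)) = 1)
    (hφx : ∀ j : Fin t,
      φ (PresentedGroup.of (Gen.x j)) = Multiplicative.ofAdd ((n j : ZMod p))) :
    ∃ e : Additive (Abelianization φ.ker) ≃+
        ((Fin (2 * g₀) → GrpRing p) ×
          (Fin (t - 2) → GrpRing p ⧸ Ideal.span {normElt p})),
      ∀ y : Abelianization φ.ker,
        e (Additive.ofMul
            (Abelianization.map
              ((MulAut.conjNormal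
                  (PresentedGroup.of (Gen.x ⟨0, by omega⟩) : Fzero p g₀ t) :
                MulAut φ.ker)).toMonoidHom y)) =
          (fun i => sElt p * (e (Additive.ofMul y)).1 i,
           fun i => Ideal.Quotient.mk (Ideal.span {normElt p}) (sElt p) *
             (e (Additive.ofMul y)).2 i) := by
  have : Fact p.Prime := ⟨hp⟩
  obtain ⟨m, rfl⟩ : ∃ m, t = m + 2 := ⟨t - 2, by omega⟩
  have hn0 : ∀ j, (n j : ZMod p) ≠ 0 := fun j h =>
    Nat.not_dvd_of_pos_of_lt (hn j).1 (hn j).2 ((ZMod.natCast_eq_zero_iff _ _).1 h)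
  have hu : (n 0 : ZMod p)⁻¹ ≠ 0 := inv_ne_zero (hn0 0)
  let ψ : Fzero p g₀ (m + 2) →* Multiplicative (ZMod p) :=
    (AddMonoidHom.toMultiplicative (AddMonoidHom.mulLeft (n 0 : ZMod p)⁻¹)).comp φ
  have hψ : ∀ w, (ψ w).toAdd = (n 0 : ZMod p)⁻¹ * (φ w).toAdd := fun w => rfl
  have hker : ∀ w, ψ w = 1 ↔ φ w = 1 := fun w => by
    rw [← toAdd_eq_zero, hψ, mul_eq_zero_iff_left hu, toAdd_eq_zero]
  obtain ⟨e, he⟩ := exists_addEquiv_of_normalized (ψ := ψ) (H := φ.ker)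
    (fun w => MonoidHom.mem_ker.trans (hker w).symm)
    (fun i => (hker _).2 (hφa i)) (fun i => (hker _).2 (hφb i))
    (fun j h => hn0 j (by simpa [hφx] using (hker _).1 h))
    (Multiplicative.toAdd.injective <| by
      rw [hψ, hφx, toAdd_ofAdd, toAdd_ofAdd, inv_mul_cancel₀ (hn0 0)])
  refine ⟨e, fun y => (he y).trans (Prod.ext rfl (funext fun i => ?_))⟩
  exact Algebra.smul_def (sElt p) ((e (Additive.ofMul y)).2 i)
end

section
/- Let p be a prime, g₀ ≥ 0 and t ≥ 2 integers, and let F₀, φ, F = ker φ be as in the context. Then F admits a presentation with 2g₀p + (t−2)(p−1) generators and a single defining relation R̂̂, such that each generator and its inverse occur exactly once in the relator R̂̂ (the relator is evenly worded with each generator appearing exactly once with exponent +1 and exactly once with exponent −1). -/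
namespace FuchsianKernel

open FreeGroup (of)

/-- A group with a compatible pair of maps to and from a semidirect product over `Q` has kernel
isomorphic to the normal factor. -/
theorem nonempty_mulEquiv_ker {E Q H : Type*} [Group E] [Group Q] [Group H] (φ : E →* Q)
    (ρ : Q →* MulAut H) (Ψ : E →* H ⋊[ρ] Q) (Φ : H ⋊[ρ] Q →* E)
    (hΦΨ : ∀ e, Φ (Ψ e) = e) (hΨΦ : ∀ h, Ψ (Φ (SemidirectProduct.inl h)) = SemidirectProduct.inl h)
    (hφ : ∀ e, (Ψ e).right = φ e) : Nonempty (H ≃* φ.ker) := by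
  let f : H →* φ.ker := (Φ.comp SemidirectProduct.inl).codRestrict φ.ker fun h => by
    rw [MonoidHom.mem_ker, ← hφ, MonoidHom.comp_apply, hΨΦ, SemidirectProduct.right_inl]
  refine ⟨MulEquiv.ofBijective f ⟨fun x y hxy => ?_, fun e => ?_⟩⟩
  · have h : Φ (SemidirectProduct.inl x) = Φ (SemidirectProduct.inl y) := congrArg Subtype.val hxy
    rw [← SemidirectProduct.inl_inj (φ := ρ), ← hΨΦ x, ← hΨΦ y, h]
  · refine ⟨(Ψ e).left, Subtype.ext ?_⟩
    have h1 : (Ψ e).right = 1 := (hφ e).trans e.2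
    have h2 : SemidirectProduct.inl (Ψ e).left = Ψ e := by
      ext <;> simp [h1]
    change Φ (SemidirectProduct.inl (Ψ e).left) = e
    rw [h2, hΦΨ]

section Words

variable {ι A G G' : Type*} [AddCommGroup A] [Group G] [Group G']

/-- The lift of the word `l` starting at level `k`: the letter `j` moves the level by `c j`. -/
def liftWord (c : ι → A) (y : ι → A → G) : A → List ι → G
  | _, [] => 1
  | k, j :: l => y j k * liftWord c y (k + c j) l

/-- The product of the commutators `[a i, b i]` at level `k`. -/
def commWord {n : ℕ} (a b : Fin n → A → G) (k : A) : G :=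
  ((List.finRange n).map fun i => a i k * b i k * (a i k)⁻¹ * (b i k)⁻¹).prod

@[simp]
theorem liftWord_nil (c : ι → A) (y : ι → A → G) (k : A) : liftWord c y k [] = 1 := rfl

@[simp]
theorem liftWord_cons (c : ι → A) (y : ι → A → G) (k : A) (j : ι) (l : List ι) :
    liftWord c y k (j :: l) = y j k * liftWord c y (k + c j) l := rfl

theorem map_liftWord (f : G →* G') (c : ι → A) (y : ι → A → G) (k : A) (l : List ι) :
    f (liftWord c y k l) = liftWord c (fun j k => f (y j k)) k l := by
  induction l generalizing k with
  | nil => simp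
  | cons j l ih => simp [ih]

omit [AddCommGroup A] in
theorem map_commWord {n : ℕ} (f : G →* G') (a b : Fin n → A → G) (k : A) :
    f (commWord a b k) = commWord (fun i k => f (a i k)) (fun i k => f (b i k)) k := by
  simp [commWord, map_list_prod, Function.comp_def]

theorem liftWord_shift (c : ι → A) (y : ι → A → G) (d k : A) (l : List ι) :
    liftWord c (fun j k => y j (d + k)) k l = liftWord c y (d + k) l := by
  induction l generalizing k with
  | nil => rfl
  | cons j l ih => simp [ih, add_assoc]

theorem liftWord_map {κ : Type*} (f : κ → ι) (c : ι → A) (y : ι → A → G) (k : A) (l : List κ) :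
    liftWord c y k (l.map f) = liftWord (fun j => c (f j)) (fun j => y (f j)) k l := by
  induction l generalizing k with
  | nil => rfl
  | cons j l ih => simp [ih]

theorem liftWord_conj (c : ι → A) (X : ι → G) (σ : Multiplicative A →* G) (k : A) (l : List ι) :
    liftWord c (fun j k => σ (.ofAdd k) * X j * (σ (.ofAdd (k + c j)))⁻¹) k l =
      σ (.ofAdd k) * (l.map X).prod * (σ (.ofAdd (k + (l.map c).sum)))⁻¹ := by
  induction l generalizing k with
  | nil => simp
  | cons j l ih =>
    rw [liftWord_cons, ih, List.map_cons, List.map_cons, List.prod_cons, List.sum_cons, add_assoc]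
    simp only [mul_assoc, inv_mul_cancel_left]

omit [AddCommGroup A] in
theorem commWord_conj {n : ℕ} (a b : Fin n → G) (σ : A → G) (k : A) :
    commWord (fun i k => σ k * a i * (σ k)⁻¹) (fun i k => σ k * b i * (σ k)⁻¹) k =
      σ k * ((List.finRange n).map fun i => a i * b i * (a i)⁻¹ * (b i)⁻¹).prod * (σ k)⁻¹ := by
  rw [← MulAut.conj_apply, map_list_prod, List.map_map]
  simp [commWord, Function.comp_def, mul_assoc]

theorem prod_mk_eq_liftWord (ρ : Multiplicative A →* MulAut G) (c : ι → A) (y : ι → A → G)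
    (hy : ∀ d j k, ρ (.ofAdd d) (y j k) = y j (d + k)) (l : List ι) :
    (l.map fun j => (⟨y j 0, .ofAdd (c j)⟩ : G ⋊[ρ] Multiplicative A)).prod =
      ⟨liftWord c y 0 l, .ofAdd (l.map c).sum⟩ := by
  induction l with
  | nil => rfl
  | cons j l ih =>
    have h := map_liftWord (ρ (.ofAdd (c j)) : MulAut G).toMonoidHom c y 0 l
    simp only [MulEquiv.coe_toMonoidHom, hy, liftWord_shift] at h
    rw [List.map_cons, List.prod_cons, ih]
    ext <;> simp [h]

end Words

section Cover

variable (p g₀ t : ℕ) (c : Fin t → ZMod p) (j₀ : Fin t)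

/-- The relator of the cover lifting `longRel` at level `k`. -/
def liftLong (k : ZMod p) : FreeGroup (Gen g₀ t × ZMod p) :=
  liftWord c (fun j k => of (Gen.x j, k)) k (List.finRange t) *
    commWord (fun i k => of (Gen.a i, k)) (fun i k => of (Gen.b i, k)) k

/-- The relator of the cover lifting `x_j ^ p` at level `k`. -/
def liftPow (j : Fin t) (k : ZMod p) : FreeGroup (Gen g₀ t × ZMod p) :=
  liftWord c (fun j k => of (Gen.x j, k)) k (List.replicate p j)

/-- The Reidemeister–Schreier relators for the kernel, with transversal the powers of `x_{j₀}`. -/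
inductive CoverRels : FreeGroup (Gen g₀ t × ZMod p) → Prop
  | long (k : ZMod p) : CoverRels (liftLong p g₀ t c k)
  | pow (j : Fin t) (k : ZMod p) : CoverRels (liftPow p g₀ t c j k)
  | base (k : ZMod p) : CoverRels (of (Gen.x j₀, k))

/-- The group presented by the Reidemeister–Schreier presentation of the kernel. -/
abbrev Cover : Type := PresentedGroup {r | CoverRels p g₀ t c j₀ r}

variable {p g₀ t c j₀}

theorem Cover.long_eq_one (k : ZMod p) :
    (liftWord c (fun j k => PresentedGroup.of (Gen.x j, k)) k (List.finRange t) *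
      commWord (fun i k => PresentedGroup.of (Gen.a i, k))
        (fun i k => PresentedGroup.of (Gen.b i, k)) k : Cover p g₀ t c j₀) = 1 := by
  have h := PresentedGroup.one_of_mem (rels := {r | CoverRels p g₀ t c j₀ r}) (CoverRels.long k)
  simp only [liftLong, map_mul, map_liftWord, map_commWord] at h
  exact h

theorem Cover.pow_eq_one (j : Fin t) (k : ZMod p) :
    (liftWord c (fun j k => PresentedGroup.of (Gen.x j, k)) k (List.replicate p j) :
      Cover p g₀ t c j₀) = 1 := by
  have h := PresentedGroup.one_of_mem (rels := {r | CoverRels p g₀ t c j₀ r}) (CoverRels.pow j k)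
  simp only [liftPow, map_liftWord] at h
  exact h

theorem Cover.base_eq_one (k : ZMod p) :
    (PresentedGroup.of (Gen.x j₀, k) : Cover p g₀ t c j₀) = 1 :=
  PresentedGroup.one_of_mem (rels := {r | CoverRels p g₀ t c j₀ r}) (CoverRels.base k)

/-- A homomorphism from the cover, given on generators. -/
def Cover.lift {G : Type*} [Group G] (f : Gen g₀ t → ZMod p → G)
    (hlong : ∀ k, liftWord c (fun j => f (Gen.x j)) k (List.finRange t) *
      commWord (fun i => f (Gen.a i)) (fun i => f (Gen.b i)) k = 1)
    (hpow : ∀ j k, liftWord c (fun j => f (Gen.x j)) k (List.replicate p j) = 1)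
    (hbase : ∀ k, f (Gen.x j₀) k = 1) : Cover p g₀ t c j₀ →* G :=
  PresentedGroup.toGroup (f := fun x => f x.1 x.2) <| by
    rintro _ (k | ⟨j, k⟩ | k)
    · simpa only [liftLong, map_mul, map_liftWord, map_commWord, FreeGroup.lift_apply_of]
        using hlong k
    · simpa only [liftPow, map_liftWord, FreeGroup.lift_apply_of] using hpow j k
    · simpa using hbase k

@[simp]
theorem Cover.lift_of {G : Type*} [Group G] (f : Gen g₀ t → ZMod p → G) (hlong) (hpow) (hbase)
    (x : Gen g₀ t) (k : ZMod p) :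
    Cover.lift (c := c) (j₀ := j₀) f hlong hpow hbase (PresentedGroup.of (x, k)) = f x k :=
  PresentedGroup.toGroup.of _

/-- The translation of all levels by `d`. -/
def Cover.shift (d : ZMod p) : Cover p g₀ t c j₀ →* Cover p g₀ t c j₀ :=
  Cover.lift (fun x k => PresentedGroup.of (x, d + k))
    (fun k => by
      rw [liftWord_shift c (fun j k => (PresentedGroup.of (Gen.x j, k) : Cover p g₀ t c j₀))]
      exact Cover.long_eq_one (d + k))
    (fun j k => by
      rw [liftWord_shift c (fun j k => (PresentedGroup.of (Gen.x j, k) : Cover p g₀ t c j₀))]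
      exact Cover.pow_eq_one j (d + k))
    (fun k => Cover.base_eq_one (d + k))

@[simp]
theorem Cover.shift_of (d : ZMod p) (x : Gen g₀ t) (k : ZMod p) :
    (Cover.shift d (PresentedGroup.of (x, k)) : Cover p g₀ t c j₀) =
      PresentedGroup.of (x, d + k) :=
  Cover.lift_of ..

/-- The deck group acting on the cover. -/
def Cover.deck : Multiplicative (ZMod p) →* MulAut (Cover p g₀ t c j₀) where
  toFun d := MonoidHom.toMulEquiv (Cover.shift d.toAdd) (Cover.shift (-d.toAdd))
    (by ext ⟨x, k⟩; simp) (by ext ⟨x, k⟩; simp)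
  map_one' := by
    apply MulEquiv.toMonoidHom_injective
    ext ⟨x, k⟩
    simp [MonoidHom.toMulEquiv]
  map_mul' d e := by
    apply MulEquiv.toMonoidHom_injective
    ext ⟨x, k⟩
    simp [MonoidHom.toMulEquiv, add_assoc]

@[simp]
theorem Cover.deck_of (d : ZMod p) (x : Gen g₀ t) (k : ZMod p) :
    (Cover.deck (.ofAdd d) (PresentedGroup.of (x, k)) : Cover p g₀ t c j₀) =
      PresentedGroup.of (x, d + k) :=
  Cover.shift_of d x k

theorem exists_section {E : Type*} [Group E] {p : ℕ} [Fact p.Prime] (u : ZMod p) (hu : u ≠ 0)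
    (x : E) (hx : x ^ p = 1) : ∃ σ : Multiplicative (ZMod p) →* E, σ (.ofAdd u) = x := by
  let f : ℤ →+ Additive E := zmultiplesHom _ (Additive.ofMul (x ^ (u⁻¹).val))
  have hf : f p = 0 := by
    change (x ^ (u⁻¹).val) ^ (p : ℤ) = 1
    rw [zpow_natCast, ← pow_mul, mul_comm, pow_mul, hx, one_pow]
  refine ⟨AddMonoidHom.toMultiplicativeLeft (ZMod.lift p ⟨f, hf⟩), ?_⟩
  have h := ZMod.lift_coe p ⟨f, hf⟩ (u.val : ℤ)
  rw [Int.cast_natCast, ZMod.natCast_zmod_val] at h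
  change (ZMod.lift p ⟨f, hf⟩ u).toMul = x
  rw [h]
  change (x ^ (u⁻¹).val) ^ (u.val : ℤ) = x
  have h1 : (u⁻¹).val * u.val ≡ 1 [MOD p] := by
    rw [← ZMod.natCast_eq_natCast_iff]
    simp [hu]
  rw [zpow_natCast, ← pow_mul]
  have h2 := pow_eq_pow_mod ((u⁻¹).val * u.val) hx
  rw [h2, h1, ← pow_eq_pow_mod 1 hx, pow_one]

theorem eq_of_apply_eq {E : Type*} [Group E] {p : ℕ} [Fact p.Prime] {u : ZMod p} (hu : u ≠ 0)
    {f g : Multiplicative (ZMod p) →* E} (h : f (.ofAdd u) = g (.ofAdd u)) : f = g := by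
  refine MonoidHom.ext fun d => ?_
  have hd : d = Multiplicative.ofAdd u ^ (d.toAdd * u⁻¹).val := by
    rw [← ofAdd_nsmul, nsmul_eq_mul, ZMod.natCast_zmod_val, mul_assoc, inv_mul_cancel₀ hu, mul_one,
      ofAdd_toAdd]
  rw [hd, map_pow, map_pow, h]

/-- The displacement of the level caused by each generator. -/
def Gen.degree (c : Fin t → ZMod p) : Gen g₀ t → ZMod p
  | .a _ => 0
  | .b _ => 0
  | .x j => c j

theorem map_longRel {G : Type*} [Group G] (f : FreeGroup (Gen g₀ t) →* G) : f (longRel g₀ t) =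
    ((List.finRange t).map fun j => f (of (Gen.x j))).prod *
      ((List.finRange g₀).map fun i => f (of (Gen.a i)) * f (of (Gen.b i)) *
        (f (of (Gen.a i)))⁻¹ * (f (of (Gen.b i)))⁻¹).prod := by
  simp [longRel, map_list_prod, Function.comp_def]

theorem sum_replicate_eq_zero (j : Fin t) : ((List.replicate p j).map c).sum = 0 := by
  simp

theorem nonempty_cover_mulEquiv_ker [Fact p.Prime] (hc : c j₀ ≠ 0) (hsum : ∑ j, c j = 0)
    (φ : Fzero p g₀ t →* Multiplicative (ZMod p))
    (hφa : ∀ i : Fin g₀, φ (PresentedGroup.of (Gen.a i)) = 1)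
    (hφb : ∀ i : Fin g₀, φ (PresentedGroup.of (Gen.b i)) = 1)
    (hφx : ∀ j : Fin t, φ (PresentedGroup.of (Gen.x j)) = .ofAdd (c j)) :
    Nonempty (Cover p g₀ t c j₀ ≃* φ.ker) := by
  have hsum' : ((List.finRange t).map c).sum = 0 := by
    rw [← hsum, ← List.ofFn_eq_map, List.sum_ofFn]
  have hpow (j : Fin t) : (PresentedGroup.of (Gen.x j) : Fzero p g₀ t) ^ p = 1 :=
    PresentedGroup.one_of_mem (rels := fuchsRels p g₀ t) (Or.inr ⟨j, rfl⟩)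
  have hlong := PresentedGroup.one_of_mem (rels := fuchsRels p g₀ t) (x := longRel g₀ t)
    (Or.inl rfl)
  rw [map_longRel] at hlong
  obtain ⟨σ, hσ⟩ := exists_section (c j₀) hc _ (hpow j₀)
  let α : Cover p g₀ t c j₀ →* Fzero p g₀ t := Cover.lift
    (fun x k => σ (.ofAdd k) * PresentedGroup.of x * (σ (.ofAdd (k + Gen.degree c x)))⁻¹)
    (fun k => by
      simp only [Gen.degree, add_zero]
      rw [liftWord_conj c (fun j => (PresentedGroup.of (Gen.x j) : Fzero p g₀ t)),
        commWord_conj (fun j => (PresentedGroup.of (Gen.a j) : Fzero p g₀ t))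
          (fun j => (PresentedGroup.of (Gen.b j) : Fzero p g₀ t)) (fun k => σ (.ofAdd k)),
        hsum', add_zero]
      simp only [PresentedGroup.of, mul_assoc, inv_mul_cancel_left] at hlong ⊢
      rw [← mul_assoc (List.prod _), hlong]
      simp)
    (fun j k => by
      simp only [Gen.degree]
      rw [liftWord_conj c (fun j => (PresentedGroup.of (Gen.x j) : Fzero p g₀ t)),
        sum_replicate_eq_zero, List.map_replicate, List.prod_replicate, hpow]
      simp)
    (fun k => by
      simp [Gen.degree, ← hσ])
  let Φ : Cover p g₀ t c j₀ ⋊[Cover.deck] Multiplicative (ZMod p) →* Fzero p g₀ t :=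
    SemidirectProduct.lift α σ fun d => by
      ext ⟨x, k⟩
      induction d with | ofAdd d => simp [α, mul_assoc]
  let y (x : Gen g₀ t) : Cover p g₀ t c j₀ ⋊[Cover.deck] Multiplicative (ZMod p) :=
    ⟨PresentedGroup.of (x, 0), .ofAdd (Gen.degree c x)⟩
  let Ψ : Fzero p g₀ t →* Cover p g₀ t c j₀ ⋊[Cover.deck] Multiplicative (ZMod p) :=
    PresentedGroup.toGroup (f := y) <| by
      have hprod := prod_mk_eq_liftWord (Cover.deck) c
        (fun j k => (PresentedGroup.of (Gen.x j, k) : Cover p g₀ t c j₀)) (fun d j k => by simp)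
      rintro _ (rfl | ⟨j, rfl⟩)
      · have ha (i : Fin g₀) : y (Gen.a i) = SemidirectProduct.inl (.of (Gen.a i, 0)) := rfl
        have hb (i : Fin g₀) : y (Gen.b i) = SemidirectProduct.inl (.of (Gen.b i, 0)) := rfl
        simp only [map_longRel, FreeGroup.lift_apply_of, ha, hb]
        have h := hprod (List.finRange t)
        have h' := map_commWord (SemidirectProduct.inl (φ := Cover.deck))
          (fun i k => (PresentedGroup.of (Gen.a i, k) : Cover p g₀ t c j₀))
          (fun i k => PresentedGroup.of (Gen.b i, k)) 0
        change List.prod (List.map (fun j => y (Gen.x j)) _) = _ at h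
        rw [h, hsum']
        refine (congrArg (_ * ·) h'.symm).trans ?_
        ext
        · simpa using Cover.long_eq_one 0
        · simp
      · have h := hprod (List.replicate p j)
        rw [List.map_replicate, List.prod_replicate, Cover.pow_eq_one, sum_replicate_eq_zero] at h
        rw [map_pow, FreeGroup.lift_apply_of]
        exact h
  have hΨσ : Ψ.comp σ = SemidirectProduct.inr := by
    refine eq_of_apply_eq hc ?_
    rw [MonoidHom.comp_apply, hσ, PresentedGroup.toGroup.of]
    ext
    · exact Cover.base_eq_one 0
    · rfl
  replace hΨσ (d) : Ψ (σ d) = SemidirectProduct.inr d := DFunLike.congr_fun hΨσ d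
  refine nonempty_mulEquiv_ker φ Cover.deck Ψ Φ (fun e => ?_) (fun h => ?_) (fun e => ?_)
  · have : Φ.comp Ψ = MonoidHom.id _ := by
      ext x
      simp [Φ, Ψ, SemidirectProduct.lift, y, α]
    exact DFunLike.congr_fun this e
  · have : Ψ.comp (Φ.comp SemidirectProduct.inl) = SemidirectProduct.inl := by
      refine PresentedGroup.ext fun ⟨x, k⟩ => ?_
      have hx : Ψ (PresentedGroup.of x) = y x := PresentedGroup.toGroup.of _
      simp only [MonoidHom.comp_apply, Φ, SemidirectProduct.lift_inl, α, Cover.lift_of, map_mul,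
        map_inv, hΨσ, hx, y]
      ext <;> simp
    exact DFunLike.congr_fun this h
  · have : SemidirectProduct.rightHom.comp Ψ = φ := by
      ext (i | i | j)
      · simp [Ψ, y, hφa, Gen.degree]
      · simp [Ψ, y, hφb, Gen.degree]
      · simp [Ψ, y, hφx, Gen.degree]
    exact DFunLike.congr_fun this e

end Cover

section Lists

theorem length_eq_one_of_nodup {α : Type*} {l : List α} (hl : l.Nodup) {x : α}
    (hlast : x ∈ l.getLast?) (hhead : x ∈ l.head?) : l.length = 1 := by
  rcases l with - | ⟨y, l⟩
  · simp at hhead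
  · obtain rfl : y = x := by simpa using hhead
    rcases l.eq_nil_or_concat with rfl | ⟨l, z, rfl⟩
    · rfl
    · rw [List.concat_eq_append, ← List.cons_append, List.getLast?_concat] at hlast
      obtain rfl : z = y := by simpa using hlast
      simp at hl

theorem isChain_flatMap_map {α β : Type*} {S : α → α → Prop} {L : List α} (hL : L.IsChain S)
    {l : List β} (hl : l.Nodup) :
    (L.flatMap fun a => l.map (Prod.mk a)).IsChain
      fun x y => x.2 = y.2 → S x.1 y.1 ∧ l.length = 1 := by
  rcases eq_or_ne l [] with rfl | hne
  · simp only [List.map_nil]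
    rw [List.flatMap_eq_nil_iff.2 fun _ _ => rfl]
    exact .nil
  · rw [List.flatMap_def, List.isChain_flatten (by simpa using fun _ _ => hne), List.isChain_map]
    refine ⟨?_, hL.imp ?_⟩
    · simp only [List.mem_map]
      rintro _ ⟨a, -, rfl⟩
      rw [List.isChain_map]
      exact hl.isChain.imp fun x y hxy h => absurd h hxy
    · intro a b hab x hx y hy hxy
      simp only [List.getLast?_map, List.head?_map, Option.mem_def, Option.map_eq_some_iff] at hx hy
      obtain ⟨u, hu, rfl⟩ := hx
      obtain ⟨v, hv, rfl⟩ := hy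
      obtain rfl : u = v := hxy
      exact ⟨hab, length_eq_one_of_nodup hl hu hv⟩

theorem prod_map_mk {α β : Type*} (f : α → List (β × Bool)) (l : List α) :
    (l.map fun x => FreeGroup.mk (f x)).prod = FreeGroup.mk (l.flatMap f) := by
  induction l with
  | nil => rfl
  | cons x l ih => rw [List.map_cons, List.prod_cons, ih, FreeGroup.mul_mk, List.flatMap_cons]

theorem exists_of_mem_head?_finRange {α : Type*} {n : ℕ} {f : Fin n → α} {x : α}
    (hx : x ∈ ((List.finRange n).map f).head?) : ∃ i : Fin n, (i : ℕ) = 0 ∧ f i = x := by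
  cases n with
  | zero => simp at hx
  | succ n => exact ⟨0, rfl, by simpa [List.finRange_succ] using hx⟩

theorem exists_of_mem_getLast?_finRange {α : Type*} {n : ℕ} {f : Fin n → α} {x : α}
    (hx : x ∈ ((List.finRange n).map f).getLast?) : ∃ i : Fin n, (i : ℕ) + 1 = n ∧ f i = x := by
  cases n with
  | zero => simp at hx
  | succ n => exact ⟨Fin.last n, rfl, by simpa [List.finRange_succ_last] using hx⟩

/-- A word in distinct letters lifts to a product of generators at constant offsets. -/
theorem exists_offset {ι A : Type*} [AddCommGroup A] (c : ι → A) (l : List ι) (hl : l.Nodup) :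
    ∃ s : ι → A, ∀ {G : Type} [Group G] (y : ι → A → G) (k : A),
      liftWord c y k l = (l.map fun j => y j (k + s j)).prod := by
  classical
  induction l with
  | nil => exact ⟨0, fun y k => rfl⟩
  | cons i l ih =>
    obtain ⟨s, hs⟩ := ih hl.of_cons
    refine ⟨fun j => if j = i then 0 else c i + s j, fun y k => ?_⟩
    rw [liftWord_cons, hs, List.map_cons, List.prod_cons]
    simp only [↓reduceIte, add_zero]
    congr 2
    refine List.map_congr_left fun j hj => ?_
    rw [if_neg (ne_of_mem_of_not_mem hj (List.nodup_cons.1 hl).1), add_assoc]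

theorem liftWord_replicate {ι A G : Type*} [Ring A] [Group G] (c : ι → A) (y : ι → A → G)
    (j : ι) (n : ℕ) (k : A) : liftWord c y k (List.replicate n j) =
      ((List.finRange n).map fun i : Fin n => y j (k + (i : ℕ) * c j)).prod := by
  induction n generalizing k with
  | zero => simp
  | succ n ih =>
    rw [List.replicate_succ, liftWord_cons, ih, List.finRange_succ]
    simp [Function.comp_def, add_mul, add_assoc, add_comm]

theorem liftWord_append {ι A G : Type*} [AddCommGroup A] [Group G] (c : ι → A) (y : ι → A → G)
    (k : A) (l l' : List ι) :
    liftWord c y k (l ++ l') = liftWord c y k l * liftWord c y (k + (l.map c).sum) l' := by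
  induction l generalizing k with
  | nil => simp
  | cons j l ih => simp [ih, mul_assoc, add_assoc]

/-- If a cyclic lift starting at level `0` is trivial, so are all its rotations. -/
theorem liftWord_replicate_eq_one {ι G : Type*} {p : ℕ} [Fact p.Prime] [Group G]
    (c : ι → ZMod p) (y : ι → ZMod p → G) (j : ι) (hj : c j ≠ 0)
    (h0 : liftWord c y 0 (List.replicate p j) = 1) (k : ZMod p) :
    liftWord c y k (List.replicate p j) = 1 := by
  have hp := (Fact.out : p.Prime).one_lt
  have hstep (k : ZMod p) (hk : liftWord c y k (List.replicate p j) = 1) :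
      liftWord c y (k + c j) (List.replicate p j) = 1 := by
    obtain ⟨n, rfl⟩ : ∃ n, p = n + 1 := ⟨p - 1, by omega⟩
    have hsum : ((n : ℕ) : ZMod (n + 1)) * c j = - c j := by
      have : ((n + 1 : ℕ) : ZMod (n + 1)) = 0 := CharP.cast_eq_zero _ _
      push_cast at this
      linear_combination (c j) * this
    rw [List.replicate_succ, liftWord_cons] at hk
    rw [List.replicate_succ', liftWord_append, List.map_replicate, List.sum_replicate,
      nsmul_eq_mul, hsum, add_neg_cancel_right, liftWord_cons, liftWord_nil, mul_one,
      eq_inv_of_mul_eq_one_right hk, inv_mul_cancel]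
  have hall (n : ℕ) : liftWord c y (n * c j) (List.replicate p j) = 1 := by
    induction n with
    | zero => simpa using h0
    | succ n ih => simpa [add_mul] using hstep _ ih
  simpa [hj] using hall (k * (c j)⁻¹).val

end Lists

section Relator

variable {p : ℕ} [Fact p.Prime]

/-- The multiples of the unit `u`, with `none` for zero. -/
noncomputable def levelEquiv (u : (ZMod p)ˣ) : Option (Fin (p - 1)) ≃ ZMod p :=
  (Equiv.ofBijective (fun o : Option (Fin (p - 1)) =>
      o.elim (0 : ZMod p) fun i => ((i : ℕ) : ZMod p) + 1) <| by
    have hp := (Fact.out : p.Prime).pos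
    rw [Fintype.bijective_iff_injective_and_card]
    refine ⟨?_, by simp [ZMod.card]; omega⟩
    have hcast (a b : ℕ) (ha : a < p) (hb : b < p) (h : (a : ZMod p) = b) : a = b := by
      rwa [ZMod.natCast_eq_natCast_iff', Nat.mod_eq_of_lt ha, Nat.mod_eq_of_lt hb] at h
    rintro (- | i) (- | j) h
    · rfl
    · have := hcast 0 (j + 1) hp (by omega) (by simpa using h)
      omega
    · have := hcast (i + 1) 0 (by omega) hp (by simpa using h)
      omega
    · have := hcast (i + 1) (j + 1) (by omega) (by omega) (by simpa using h)
      exact congrArg some (Fin.ext (by omega))).trans (Units.mulRight u)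

@[simp]
theorem levelEquiv_none (u : (ZMod p)ˣ) : levelEquiv u none = 0 := by simp [levelEquiv]

@[simp]
theorem levelEquiv_some (u : (ZMod p)ˣ) (i : Fin (p - 1)) :
    levelEquiv u (some i) = u + (i : ℕ) * u := by simp [levelEquiv, add_mul, add_comm]

variable (p) in
/-- The generators of the one-relator presentation: lifts of the `a i`, of the `b i`, and the lifts
of all but two of the `x j` at nonzero levels. -/
abbrev SurfaceGen (g₀ s : ℕ) : Type :=
  ((Fin g₀ × ZMod p) ⊕ (Fin g₀ × ZMod p)) ⊕ (Fin s × Fin (p - 1))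

variable {g₀ s : ℕ}

/-- The word expressing the lift of `x_{j+2}` at a given level. -/
def branchWord (j : Fin s) : Option (Fin (p - 1)) → List (SurfaceGen p g₀ s × Bool)
  | none => ((List.finRange (p - 1)).map fun i => (Sum.inr (j, i), false)).reverse
  | some i => [(Sum.inr (j, i), true)]

variable (c : Fin (s + 2) → (ZMod p)ˣ) (σ : Fin s → ZMod p)

/-- The letters of `longRel` after `x₀ x₁`: each commutator counts as a single letter. -/
def tailLetters (s g₀ : ℕ) : List (Fin s ⊕ Fin g₀) :=
  (List.finRange s).map Sum.inl ++ (List.finRange g₀).map Sum.inr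

/-- The word expressing a letter of `tailLetters` at level `k`. -/
noncomputable def letterWord (k : ZMod p) : Fin s ⊕ Fin g₀ → List (SurfaceGen p g₀ s × Bool)
  | .inl j => branchWord j ((levelEquiv (c j.succ.succ)).symm (k + σ j))
  | .inr i => [(.inl (.inl (i, k - c 0)), true), (.inl (.inr (i, k - c 0)), true),
      (.inl (.inl (i, k - c 0)), false), (.inl (.inr (i, k - c 0)), false)]

/-- The levels in the order in which they occur in the relator. -/
def levels : List (ZMod p) := (List.range p).reverse.map fun i : ℕ => (i : ZMod p) * (c 1 : ZMod p)

/-- The relator of the one-relator presentation, as a word. -/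
noncomputable def relatorWord (g₀ : ℕ) : List (SurfaceGen p g₀ s × Bool) :=
  (levels c).flatMap fun k => (tailLetters s g₀).flatMap (letterWord c σ k)

theorem sum_map_levels (f : ZMod p → ℕ) : ((levels c).map f).sum = ∑ k, f k := by
  have hnodup : (levels c).Nodup := by
    refine (List.nodup_reverse.2 List.nodup_range).map_on fun a ha b hb h => ?_
    simp only [Units.mul_left_inj, List.mem_reverse, List.mem_range] at h ha hb
    rwa [ZMod.natCast_eq_natCast_iff', Nat.mod_eq_of_lt ha, Nat.mod_eq_of_lt hb] at h
  rw [← List.sum_toFinset f hnodup]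
  refine Finset.sum_congr (Finset.eq_univ_of_card _ ?_) fun _ _ => rfl
  rw [List.toFinset_card_of_nodup hnodup]
  simp [levels, ZMod.card]

theorem count_relatorWord [BEq (SurfaceGen p g₀ s × Bool)] [LawfulBEq (SurfaceGen p g₀ s × Bool)]
    (x : SurfaceGen p g₀ s × Bool) : (relatorWord c σ g₀).count x = 1 := by
  have hcount : (relatorWord c σ g₀).count x =
      (∑ j : Fin s, ∑ o, (branchWord j o).count x) +
        ∑ i : Fin g₀, ∑ k, (letterWord c σ (k + c 0) (.inr i)).count x := by
    have h1 (i : Fin g₀) : ∑ k, (letterWord c σ (k + c 0) (.inr i)).count x =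
        ∑ k, (letterWord c σ k (.inr i)).count x :=
      Equiv.sum_comp (Equiv.addRight (c 0 : ZMod p)) fun k => (letterWord c σ k (.inr i)).count x
    have h2 (j : Fin s) : ∑ o, (branchWord j o).count x =
        ∑ k, (letterWord c σ k (.inl j)).count x := by
      rw [← ((Equiv.addRight (σ j)).trans (levelEquiv (c j.succ.succ)).symm).sum_comp]
      rfl
    have h3 (k : ZMod p) : ((tailLetters s g₀).flatMap (letterWord c σ k)).count x =
        (∑ j : Fin s, (letterWord c σ k (.inl j)).count x) +
          ∑ i : Fin g₀, (letterWord c σ k (.inr i)).count x := by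
      simp [List.count_flatMap, tailLetters, Function.comp_def, ← List.ofFn_eq_map, List.sum_ofFn]
    simp only [h1, h2]
    rw [relatorWord, List.count_flatMap, Function.comp_def, sum_map_levels]
    simp only [h3, Finset.sum_add_distrib]
    congr 1 <;> exact Finset.sum_comm
  rw [hcount]
  have hzero (j : Fin s) (hx : ∀ i, x ≠ (Sum.inr (j, i), false)) :
      ((List.finRange (p - 1)).map fun i => (Sum.inr (j, i), false)).count x = 0 :=
    List.count_eq_zero.2 fun h => by
      obtain ⟨i, -, rfl⟩ := List.mem_map.1 h
      exact hx i rfl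
  obtain ⟨((⟨i, k⟩ | ⟨i, k⟩) | ⟨j, i⟩), (_ | _)⟩ := x
  case inr.false =>
    simp only [branchWord, List.count_reverse, Fintype.sum_option]
    rw [Finset.sum_eq_single j (fun j' _ hj => by
      rw [hzero j' fun i => by simp [hj.symm]]; simp) (by simp),
      List.count_eq_one_of_mem ((List.nodup_finRange _).map fun _ _ => by simp) (by simp)]
    simp [letterWord]
  all_goals simp [letterWord, branchWord, List.count_cons, Fintype.sum_option, ite_and, hzero]

omit [Fact p.Prime] in
theorem fst_of_mem_branchWord {j : Fin s} {o : Option (Fin (p - 1))}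
    {x : SurfaceGen p g₀ s × Bool} (hx : x ∈ branchWord j o) : ∃ i, x.1 = Sum.inr (j, i) := by
  rcases o with - | i
  · simp only [branchWord, List.mem_reverse, List.mem_map] at hx
    obtain ⟨i, -, rfl⟩ := hx
    exact ⟨i, rfl⟩
  · obtain rfl := by simpa [branchWord] using hx
    exact ⟨i, rfl⟩

theorem isReduced_relatorWord (h : s = 1 → g₀ = 0 → ∀ j : Fin s,
    (c 1 : ZMod p) + c j.succ.succ ≠ 0) : FreeGroup.IsReduced (relatorWord c σ g₀) := by
  have hp := (Fact.out : p.Prime).two_le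
  have hlev : (levels c).IsChain fun k k' => k = k' + (c 1 : ZMod p) := by
    rw [levels, List.isChain_map, List.isChain_reverse]
    rw [List.isChain_range]
    intro m _
    simp [add_mul]
  have hnodup : (tailLetters s g₀).Nodup := by
    refine List.Nodup.append ((List.nodup_finRange s).map Sum.inl_injective)
      ((List.nodup_finRange g₀).map Sum.inr_injective) ?_
    simp [List.Disjoint]
  have hchain := isChain_flatMap_map hlev hnodup
  have hword : relatorWord c σ g₀ = (((levels c).flatMap fun k =>
      (tailLetters s g₀).map (Prod.mk k)).map fun x => letterWord c σ x.1 x.2).flatten := by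
    simp [relatorWord, List.flatMap_def, List.map_flatten, List.flatten_flatten, Function.comp_def]
  have hempty (k : ZMod p) (x : Fin s ⊕ Fin g₀) : letterWord c σ k x ≠ [] := by
    rcases x with j | i
    · rw [letterWord]
      rcases (levelEquiv (c j.succ.succ)).symm (k + σ j) with - | i
      · simp [branchWord]; omega
      · simp [branchWord]
    · simp [letterWord]
  rw [FreeGroup.IsReduced, hword, List.isChain_flatten (by simp [hempty]), List.isChain_map]
  constructor
  · simp only [List.mem_map]
    rintro _ ⟨⟨k, j | i⟩, -, rfl⟩
    · rw [letterWord]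
      rcases (levelEquiv (c j.succ.succ)).symm (k + σ j) with - | i
      · rw [branchWord, List.isChain_reverse, List.isChain_map]
        exact (List.nodup_finRange _).isChain.imp fun _ _ _ _ => rfl
      · simp [branchWord]
    · simp [letterWord]
  · refine hchain.imp ?_
    rintro ⟨k, j | i⟩ ⟨k', j' | i'⟩ hk x hx y hy hxy
    · by_cases hjj : j = j'
      · subst hjj
        obtain ⟨hk, hl⟩ := hk rfl
        have hs : s = 1 ∧ g₀ = 0 := by
          simp [tailLetters] at hl
          have := j.pos
          omega
        have hc := h hs.1 hs.2 j
        simp only [letterWord] at hx hy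
        rcases ho : (levelEquiv (c j.succ.succ)).symm (k + σ j) with - | i <;>
          rcases ho' : (levelEquiv (c j.succ.succ)).symm (k' + σ j) with - | i' <;>
          rw [ho] at hx <;> rw [ho'] at hy <;>
          rw [Equiv.symm_apply_eq] at ho ho'
        · simp only [branchWord, ← List.map_reverse] at hx hy
          obtain ⟨_, -, rfl⟩ := List.mem_map.1 (List.mem_of_getLast? hx)
          obtain ⟨_, -, rfl⟩ := List.mem_map.1 (List.mem_of_mem_head? hy)
          rfl
        · exfalso
          rw [branchWord, List.getLast?_reverse] at hx
          obtain ⟨i, hi, rfl⟩ := exists_of_mem_head?_finRange hx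
          obtain rfl : (Sum.inr (j, i'), true) = y := by simpa [branchWord] using hy
          obtain rfl : i = i' := by simpa using hxy
          rw [levelEquiv_some, hi] at ho'
          rw [levelEquiv_none] at ho
          apply hc
          push_cast at ho'
          linear_combination ho - ho' - hk
        · exfalso
          rw [branchWord, List.head?_reverse] at hy
          obtain ⟨i', hi', rfl⟩ := exists_of_mem_getLast?_finRange hy
          obtain rfl : (Sum.inr (j, i), true) = x := by simpa [branchWord] using hx
          obtain rfl : i = i' := by simpa using hxy
          have hp : ((i : ℕ) : ZMod p) + 2 = 0 := by
            have : (((i : ℕ) + 2 : ℕ) : ZMod p) = (p : ℕ) := congrArg _ (by omega)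
            simpa using this
          rw [levelEquiv_some] at ho
          rw [levelEquiv_none] at ho'
          apply hc
          linear_combination (c j.succ.succ : ZMod p) * hp + ho - hk - ho'
        · obtain rfl : (Sum.inr (j, i), true) = x := by simpa [branchWord] using hx
          obtain rfl : (Sum.inr (j, i'), true) = y := by simpa [branchWord] using hy
          rfl
      · exfalso
        obtain ⟨i, hi⟩ := fst_of_mem_branchWord (List.mem_of_getLast? hx)
        obtain ⟨i', hi'⟩ := fst_of_mem_branchWord (List.mem_of_mem_head? hy)
        rw [hi, hi'] at hxy
        simp [hjj] at hxy
    · exfalso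
      obtain ⟨i, hi⟩ := fst_of_mem_branchWord (List.mem_of_getLast? hx)
      obtain rfl := by simpa [letterWord] using hy
      simp [hi] at hxy
    · exfalso
      obtain ⟨i, hi⟩ := fst_of_mem_branchWord (List.mem_of_mem_head? hy)
      obtain rfl := by simpa [letterWord] using hx
      simp [hi] at hxy
    · exfalso
      obtain rfl := by simpa [letterWord] using hx
      obtain rfl := by simpa [letterWord] using hy
      simp at hxy

end Relator

section Tietze

variable {p : ℕ} [Fact p.Prime] {g₀ s : ℕ} (c : Fin (s + 2) → (ZMod p)ˣ) (σ : Fin s → ZMod p)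

theorem liftWord_replicate_zero {ι G : Type*} [Group G] (c : ι → ZMod p) (y : ι → ZMod p → G)
    (j : ι) (u : (ZMod p)ˣ) (hu : c j = u) : liftWord c y 0 (List.replicate p j) =
      y j 0 * ((List.finRange (p - 1)).map fun i => y j (levelEquiv u (some i))).prod := by
  have hp : List.replicate p j = j :: List.replicate (p - 1) j := by
    rw [← List.replicate_succ, Nat.sub_add_cancel (Fact.out : p.Prime).pos]
  rw [hp, liftWord_cons, liftWord_replicate, hu]
  simp

omit [Fact p.Prime] in
theorem mk_branchWord_none (j : Fin s) :
    FreeGroup.mk (branchWord (p := p) (g₀ := g₀) j none) =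
      (((List.finRange (p - 1)).map fun i => of (Sum.inr (j, i))).prod)⁻¹ := by
  simp only [FreeGroup.of, prod_map_mk, FreeGroup.inv_mk, FreeGroup.invRev, branchWord,
    ← List.map_eq_flatMap, List.map_map]
  rfl

/-- The product of the letters of `tailLetters` at level `k`. -/
noncomputable def discElt (g₀ : ℕ) (k : ZMod p) : FreeGroup (SurfaceGen p g₀ s) :=
  .mk ((tailLetters s g₀).flatMap (letterWord c σ k))

/-- The generators of the cover, expressed by those of the one-relator presentation. -/
noncomputable def surfaceWord : Gen g₀ (s + 2) → ZMod p → FreeGroup (SurfaceGen p g₀ s)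
  | .a i, k => of (.inl (.inl (i, k)))
  | .b i, k => of (.inl (.inr (i, k)))
  | .x j, k => Fin.cases 1 (fun j => Fin.cases (discElt c σ g₀ k)⁻¹
      (fun j => .mk (branchWord j ((levelEquiv (c j.succ.succ)).symm k))) j) j

theorem surfaceWord_zero (k : ZMod p) : surfaceWord (g₀ := g₀) c σ (Gen.x 0) k = 1 := rfl

/-- The offsets at which the letters of `longRel` occur in its lift. -/
def IsOffset : Prop := ∀ {G : Type} [Group G] (y : Fin s → ZMod p → G) (k : ZMod p),
  liftWord (fun j : Fin s => (c j.succ.succ : ZMod p)) y (k + c 1) (List.finRange s) =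
    ((List.finRange s).map fun j => y j (k + σ j)).prod

theorem exists_isOffset : ∃ σ, IsOffset c σ := by
  obtain ⟨τ, hτ⟩ := exists_offset (fun j : Fin s => (c j.succ.succ : ZMod p)) _
    (List.nodup_finRange s)
  exact ⟨fun j => c 1 + τ j, fun y k => by simp only [hτ, add_assoc]⟩

theorem liftWord_finRange {G : Type*} [Group G] (y : Fin (s + 2) → ZMod p → G) (hy : ∀ k, y 0 k = 1)
    (k : ZMod p) : liftWord (fun j => (c j : ZMod p)) y k (List.finRange (s + 2)) =
      y 1 (k + c 0) * liftWord (fun j : Fin s => (c j.succ.succ : ZMod p)) (fun j => y j.succ.succ)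
        (k + c 0 + c 1) (List.finRange s) := by
  rw [List.finRange_succ, List.finRange_succ, liftWord_cons, hy, one_mul, liftWord_map,
    liftWord_cons, liftWord_map]
  rfl

variable {c σ}

theorem discElt_eq (hσ : IsOffset c σ) (k : ZMod p) : discElt c σ g₀ k =
    liftWord (fun j : Fin s => (c j.succ.succ : ZMod p))
      (fun j => surfaceWord c σ (Gen.x j.succ.succ)) (k + c 1) (List.finRange s) *
    commWord (fun i => surfaceWord c σ (Gen.a i)) (fun i => surfaceWord c σ (Gen.b i))
      (k - c 0) := by
  rw [hσ, discElt, tailLetters, List.flatMap_append, ← FreeGroup.mul_mk, List.flatMap_map,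
    List.flatMap_map, ← prod_map_mk, ← prod_map_mk]
  rfl

theorem liftWord_surfaceWord (hσ : IsOffset c σ) (k : ZMod p) :
    liftWord (fun j => (c j : ZMod p)) (fun j => surfaceWord c σ (Gen.x j)) k
      (List.finRange (s + 2)) *
    commWord (fun i : Fin g₀ => surfaceWord c σ (Gen.a i)) (fun i => surfaceWord c σ (Gen.b i)) k =
      1 := by
  have h := discElt_eq (g₀ := g₀) hσ (k + c 0)
  rw [add_sub_cancel_right] at h
  rw [liftWord_finRange c _ (fun k => rfl), mul_assoc, ← h]
  exact inv_mul_cancel _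

theorem liftWord_replicate_one :
    liftWord (fun j => (c j : ZMod p)) (fun j => surfaceWord c σ (Gen.x j)) 0
      (List.replicate p 1) = (FreeGroup.mk (relatorWord c σ g₀))⁻¹ := by
  have h (k : ZMod p) : surfaceWord c σ (Gen.x 1) k = (discElt c σ g₀ k)⁻¹ := rfl
  rw [liftWord_replicate, relatorWord, ← prod_map_mk, List.prod_inv_reverse, levels]
  simp only [List.map_map, List.map_reverse, List.reverse_reverse, h,
    ← List.map_coe_finRange_eq_range]
  simp [Function.comp_def, discElt]

variable (c σ g₀) in
/-- The group with the one-relator presentation. -/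
abbrev SurfaceGroup : Type :=
  PresentedGroup ({.mk (relatorWord c σ g₀)} : Set (FreeGroup (SurfaceGen p g₀ s)))

variable (g₀ c) in
/-- The cover of `F₀` based at its first generator `x 0`. -/
abbrev BasedCover : Type := Cover p g₀ (s + 2) (fun j => (c j : ZMod p)) 0

/-- The map from the cover to the one-relator group. -/
noncomputable def toSurface (hσ : IsOffset c σ) : BasedCover g₀ c →* SurfaceGroup g₀ c σ :=
  Cover.lift (fun x k => PresentedGroup.mk _ (surfaceWord c σ x k))
    (fun k => by
      rw [← map_liftWord (PresentedGroup.mk _) _ fun j => surfaceWord c σ (Gen.x j),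
        ← map_commWord (PresentedGroup.mk _), ← map_mul, liftWord_surfaceWord hσ, map_one])
    (fun j k => by
      refine liftWord_replicate_eq_one (fun j => (c j : ZMod p)) _ j (c j).ne_zero ?_ k
      refine (map_liftWord (PresentedGroup.mk _) _ (fun j => surfaceWord c σ (Gen.x j)) 0
        (List.replicate p j)).symm.trans ?_
      refine j.cases ?_ fun j => j.cases ?_ fun j => ?_
      · rw [liftWord_replicate, List.prod_eq_one, map_one]
        simp [surfaceWord]
      · rw [Fin.succ_zero_eq_one, liftWord_replicate_one, map_inv, inv_eq_one]
        exact PresentedGroup.one_of_mem rfl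
      · have h (k : ZMod p) : surfaceWord (g₀ := g₀) c σ (Gen.x j.succ.succ) k =
          .mk (branchWord j ((levelEquiv (c j.succ.succ)).symm k)) := rfl
        rw [liftWord_replicate_zero (fun j => (c j : ZMod p)) _ _ _ rfl, h,
          ← levelEquiv_none (c j.succ.succ), Equiv.symm_apply_apply, mk_branchWord_none]
        have hof (i : Fin (p - 1)) : .mk (branchWord j (some i)) =
          of (Sum.inr (j, i) : SurfaceGen p g₀ s) := rfl
        simp only [h, Equiv.symm_apply_apply, hof, inv_mul_cancel, map_one])
    (fun k => by rw [surfaceWord_zero, map_one])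

variable (c) in
/-- The generators of the one-relator presentation, as elements of the cover. -/
noncomputable def surfaceGenElt : SurfaceGen p g₀ s → BasedCover g₀ c :=
  Sum.elim (Sum.elim (fun x => .of (Gen.a x.1, x.2)) fun x => .of (Gen.b x.1, x.2))
    fun x => .of (Gen.x x.1.succ.succ, levelEquiv (c x.1.succ.succ) (some x.2))

theorem lift_surfaceWord (hσ : IsOffset c σ) (x : Gen g₀ (s + 2)) (k : ZMod p) :
    FreeGroup.lift (surfaceGenElt c) (surfaceWord c σ x k) = .of (x, k) := by
  have ha (i : Fin g₀) (k : ZMod p) :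
      FreeGroup.lift (surfaceGenElt c) (surfaceWord c σ (Gen.a i) k) = .of (Gen.a i, k) := by simp [surfaceGenElt, surfaceWord]
  have hb (i : Fin g₀) (k : ZMod p) :
      FreeGroup.lift (surfaceGenElt c) (surfaceWord c σ (Gen.b i) k) = .of (Gen.b i, k) := by simp [surfaceGenElt, surfaceWord]
  have hx (j : Fin s) (k : ZMod p) :
      FreeGroup.lift (surfaceGenElt c) (surfaceWord (g₀ := g₀) c σ (Gen.x j.succ.succ) k) =
        .of (Gen.x j.succ.succ, k) := by
    obtain ⟨o, rfl⟩ := (levelEquiv (c j.succ.succ)).surjective k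
    change FreeGroup.lift (surfaceGenElt c)
      (.mk (branchWord j ((levelEquiv (c j.succ.succ)).symm _))) = _
    rw [Equiv.symm_apply_apply]
    rcases o with - | i
    · have h := Cover.pow_eq_one (p := p) (g₀ := g₀) (c := fun j => (c j : ZMod p)) (j₀ := 0)
        j.succ.succ 0
      rw [liftWord_replicate_zero (fun j => (c j : ZMod p)) _ _ _ rfl, mul_eq_one_iff_eq_inv] at h
      rw [mk_branchWord_none, levelEquiv_none, h, map_inv, map_list_prod, List.map_map]
      simp [surfaceGenElt, Function.comp_def]
    · change FreeGroup.lift (surfaceGenElt c) (of _) = _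
      simp [surfaceGenElt]
  rcases x with i | i | j
  · exact ha i k
  · exact hb i k
  · refine j.cases ?_ fun j => j.cases ?_ fun j => hx j k
    · exact (map_one _).trans (Cover.base_eq_one k).symm
    · change FreeGroup.lift (surfaceGenElt c) (discElt c σ g₀ k)⁻¹ = _
      have h := Cover.long_eq_one (p := p) (g₀ := g₀) (c := fun j => (c j : ZMod p)) (j₀ := 0)
        (k - c 0)
      rw [liftWord_finRange c _ Cover.base_eq_one, sub_add_cancel, mul_assoc,
        mul_eq_one_iff_eq_inv] at h
      rw [discElt_eq hσ, map_inv, map_mul, map_liftWord, map_commWord]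
      simp only [ha, hb, hx]
      exact h.symm

/-- The map from the one-relator group to the cover. -/
noncomputable def ofSurface (hσ : IsOffset c σ) : SurfaceGroup g₀ c σ →* BasedCover g₀ c :=
  PresentedGroup.toGroup (f := surfaceGenElt c) <| by
    rintro _ rfl
    rw [← inv_eq_one, ← map_inv, ← liftWord_replicate_one, map_liftWord]
    simp only [lift_surfaceWord hσ]
    exact Cover.pow_eq_one 1 0

/-- Tietze elimination in the Reidemeister–Schreier presentation. -/
theorem nonempty_cover_mulEquiv_surfaceGroup (hσ : IsOffset c σ) :
    Nonempty (BasedCover g₀ c ≃* SurfaceGroup g₀ c σ) := by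
  have hmk (w : FreeGroup (SurfaceGen p g₀ s)) :
    ofSurface hσ (PresentedGroup.mk _ w) = FreeGroup.lift (surfaceGenElt c) w := rfl
  have hto (x : Gen g₀ (s + 2)) (k : ZMod p) :
      toSurface hσ (.of (x, k)) = PresentedGroup.mk _ (surfaceWord c σ x k) := Cover.lift_of ..
  refine ⟨MonoidHom.toMulEquiv (toSurface hσ) (ofSurface hσ) ?_ ?_⟩
  · ext ⟨x, k⟩
    rw [MonoidHom.comp_apply, hto, hmk, lift_surfaceWord hσ, MonoidHom.id_apply]
  · ext x
    change toSurface hσ (ofSurface hσ (PresentedGroup.mk _ (of x))) = _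
    rw [hmk, FreeGroup.lift_apply_of]
    rcases x with (x | x) | ⟨j, i⟩
    · exact hto ..
    · exact hto ..
    · refine (hto ..).trans ?_
      change PresentedGroup.mk _ (.mk (branchWord j ((levelEquiv (c j.succ.succ)).symm _))) = _
      rw [Equiv.symm_apply_apply]
      rfl

end Tietze

section Presentation

variable {p : ℕ} [Fact p.Prime] {g₀ s : ℕ} {c : Fin (s + 2) → (ZMod p)ˣ}

theorem card_surfaceGen : Fintype.card (SurfaceGen p g₀ s) = 2 * g₀ * p + s * (p - 1) := by
  simp only [Fintype.card_sum, Fintype.card_prod, Fintype.card_fin, ZMod.card]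
  ring

theorem add_ne_zero_of_sum_eq_zero (hsum : ∑ j, (c j : ZMod p) = 0) (hs : s = 1) (j : Fin s) :
    (c 1 : ZMod p) + c j.succ.succ ≠ 0 := by
  subst hs
  obtain rfl := Subsingleton.elim j 0
  intro h
  rw [Fin.sum_univ_three] at hsum
  refine (c 0).ne_zero ?_
  have h' : (c 1 : ZMod p) + c 2 = 0 := h
  linear_combination hsum - h'

theorem exists_relator (hsum : ∑ j, (c j : ZMod p) = 0) {N : ℕ}
    (hN : N = 2 * g₀ * p + s * (p - 1)) :
    ∃ r : FreeGroup (Fin N),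
      (∀ a, (FreeGroup.toWord r).count (a, true) = 1 ∧ (FreeGroup.toWord r).count (a, false) = 1) ∧
      Nonempty (BasedCover g₀ c ≃* PresentedGroup ({r} : Set (FreeGroup _))) := by
  classical
  let _ : BEq (SurfaceGen p g₀ s × Bool) := instBEqOfDecidableEq
  obtain ⟨σ, hσ⟩ := exists_isOffset c
  obtain ⟨E⟩ := nonempty_cover_mulEquiv_surfaceGroup (g₀ := g₀) hσ
  let e : SurfaceGen p g₀ s ≃ Fin N := Fintype.equivFinOfCardEq (card_surfaceGen.trans hN.symm)
  have hr : FreeGroup.freeGroupCongr e (.mk (relatorWord c σ g₀)) =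
      .mk ((relatorWord c σ g₀).map (Prod.map e id)) := rfl
  have hinj : Function.Injective (Prod.map e (id : Bool → Bool)) :=
    e.injective.prodMap Function.injective_id
  have hred : FreeGroup.IsReduced ((relatorWord c σ g₀).map (Prod.map e id)) := by
    rw [FreeGroup.IsReduced, List.isChain_map]
    refine (isReduced_relatorWord c σ fun hs _ => add_ne_zero_of_sum_eq_zero hsum hs).imp ?_
    intro x y h hxy
    exact h (e.injective hxy)
  have hcount (a : Fin N) (b : Bool) :
      (FreeGroup.toWord (FreeGroup.freeGroupCongr e (.mk (relatorWord c σ g₀)))).count (a, b) =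
        1 := by
    rw [hr, FreeGroup.toWord_mk, hred.reduce_eq, ← count_relatorWord c σ (g₀ := g₀) (e.symm a, b),
      ← List.count_map_of_injective _ _ hinj]
    simp
  refine ⟨_, fun a => ⟨hcount a true, hcount a false⟩, ⟨E.trans ?_⟩⟩
  have E' := PresentedGroup.equivPresentedGroup {.mk (relatorWord c σ g₀)} e
  rwa [Set.image_singleton] at E'

end Presentation

end FuchsianKernel

/-- `F = ker φ` admits a presentation with `2g₀p + (t−2)(p−1)` generators and a
single defining relator `R̂̂` in which each generator occurs exactly once with exponent `+1`
and exactly once with exponent `−1` (so each generator and its inverse occur exactly once,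
and the relator is evenly worded). -/
theorem one_relator_presentation (p g₀ t : ℕ) (hp : p.Prime) (ht : 2 ≤ t)
    (n : Fin t → ℕ) (hn : ∀ j, 0 < n j ∧ n j < p)
    (hsum : (∑ j, (n j : ZMod p)) = 0)
    (φ : Fzero p g₀ t →* Multiplicative (ZMod p))
    (hφa : ∀ i : Fin g₀, φ (PresentedGroup.of (Gen.a i)) = 1)
    (hφb : ∀ i : Fin g₀, φ (PresentedGroup.of (Gen.b i)) = 1)
    (hφx : ∀ j : Fin t,
      φ (PresentedGroup.of (Gen.x j)) = Multiplicative.ofAdd ((n j : ZMod p))) :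
    ∃ r : FreeGroup (Fin (2 * g₀ * p + (t - 2) * (p - 1))),
      (∀ a : Fin (2 * g₀ * p + (t - 2) * (p - 1)),
        (FreeGroup.toWord r).count (a, true) = 1 ∧
          (FreeGroup.toWord r).count (a, false) = 1) ∧
      Nonempty (PresentedGroup ({r} : Set (FreeGroup _)) ≃* φ.ker) := by
  obtain ⟨s, rfl⟩ : ∃ s, t = s + 2 := ⟨t - 2, by omega⟩
  have : Fact p.Prime := ⟨hp⟩
  have hc (j : Fin (s + 2)) : (n j : ZMod p) ≠ 0 := fun h =>
    Nat.not_dvd_of_pos_of_lt (hn j).1 (hn j).2 ((ZMod.natCast_eq_zero_iff _ _).1 h)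
  obtain ⟨r, hr, ⟨E⟩⟩ := FuchsianKernel.exists_relator (g₀ := g₀)
    (c := fun j => Units.mk0 (n j : ZMod p) (hc j)) hsum
    (N := 2 * g₀ * p + (s + 2 - 2) * (p - 1)) rfl
  obtain ⟨E'⟩ := FuchsianKernel.nonempty_cover_mulEquiv_ker (j₀ := 0) (hc 0) hsum φ hφa hφb hφx
  exact ⟨r, hr, ⟨E.symm.trans E'⟩⟩
end

section
/- Let p be a prime, g₀ ≥ 0 and t ≥ 2 integers, and let F₀, φ, F = ker φ be as in the context. Then F is isomorphic to the surface group of genus g, where 2g = 2pg₀ + (p−1)(t−2); that is, F is isomorphic to the group with presentation ⟨c₁,…,c_g, d₁,…,d_g ∣ [c₁,d₁][c₂,d₂]⋯[c_g,d_g] = 1⟩. -/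
/-- Generators `c i`, `d i` of the genus-`g` surface group. -/
inductive SGen (g : ℕ) : Type
  | c : Fin g → SGen g
  | d : Fin g → SGen g

/-- The surface relation `∏_{i=1}^{g} [c_i, d_i]`. -/
def surfaceRel (g : ℕ) : FreeGroup (SGen g) :=
  ((List.finRange g).map fun i =>
    FreeGroup.of (SGen.c i) * FreeGroup.of (SGen.d i) *
      (FreeGroup.of (SGen.c i))⁻¹ * (FreeGroup.of (SGen.d i))⁻¹).prod

/-- The surface group of genus `g`:
`⟨c₁,…,c_g, d₁,…,d_g ∣ ∏_{i=1}^{g}[c_i,d_i] = 1⟩`. -/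
abbrev SurfaceGroup (g : ℕ) : Type :=
  PresentedGroup ({surfaceRel g} : Set (FreeGroup (SGen g)))

section QuadraticWords

variable {X : Type} {G : Type} [Group G]

/-- The opposite of a signed letter. -/
def opp (d : X × Bool) : X × Bool := (d.1, !d.2)

@[simp] theorem opp_opp (d : X × Bool) : opp (opp d) = d := by simp [opp]

theorem opp_ne (d : X × Bool) : opp d ≠ d := by
  intro h
  simpa [opp] using congrArg Prod.snd h

theorem opp_inj {d e : X × Bool} (h : opp d = opp e) : d = e := by
  rw [← opp_opp d, h, opp_opp]

theorem fst_eq_iff {d e : X × Bool} : d.1 = e.1 ↔ d = e ∨ d = opp e := by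
  obtain ⟨x, b⟩ := d
  obtain ⟨y, c⟩ := e
  cases b <;> cases c <;> simp [opp]

/-- The value of a signed letter under an assignment of the letters. -/
def letterVal (f : X → G) (d : X × Bool) : G := cond d.2 (f d.1) (f d.1)⁻¹

/-- The value of a word under an assignment of the letters. -/
def wordVal (f : X → G) (w : List (X × Bool)) : G := (w.map (letterVal f)).prod

@[simp] theorem wordVal_nil (f : X → G) : wordVal f [] = 1 := rfl

@[simp] theorem wordVal_cons (f : X → G) (d : X × Bool) (w : List (X × Bool)) :
    wordVal f (d :: w) = letterVal f d * wordVal f w := by simp [wordVal]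

@[simp] theorem wordVal_append (f : X → G) (v w : List (X × Bool)) :
    wordVal f (v ++ w) = wordVal f v * wordVal f w := by simp [wordVal]

@[simp] theorem letterVal_opp (f : X → G) (d : X × Bool) :
    letterVal f (opp d) = (letterVal f d)⁻¹ := by
  obtain ⟨x, b⟩ := d
  cases b <;> simp [letterVal, opp]

theorem map_letterVal {H : Type} [Group H] (θ : G →* H) (f : X → G) (d : X × Bool) :
    θ (letterVal f d) = letterVal (θ ∘ f) d := by
  obtain ⟨x, b⟩ := d
  cases b <;> simp [letterVal]

theorem map_wordVal {H : Type} [Group H] (θ : G →* H) (f : X → G) (w : List (X × Bool)) :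
    θ (wordVal f w) = wordVal (θ ∘ f) w := by
  induction w with
  | nil => simp
  | cons d w ih => simp [map_letterVal, ih]

theorem wordVal_congr {f f' : X → G} {w : List (X × Bool)} (h : ∀ d ∈ w, f d.1 = f' d.1) :
    wordVal f w = wordVal f' w := by
  unfold wordVal
  congr 1
  refine List.map_congr_left fun d hd => ?_
  simp [letterVal, h d hd]

theorem letterVal_update_self [DecidableEq X] (f : X → G) (d : X × Bool) (g : G) :
    letterVal (Function.update f d.1 (cond d.2 g g⁻¹)) d = g := by
  obtain ⟨x, b⟩ := d
  cases b <;> simp [letterVal]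

theorem cond_letterVal (f : X → G) (d : X × Bool) :
    cond d.2 (letterVal f d) (letterVal f d)⁻¹ = f d.1 := by
  obtain ⟨x, b⟩ := d
  cases b <;> simp [letterVal]

/-- `s` labels the source of each signed letter, and the word `w` is a path from `u` to `v`. -/
def IsPath (s : X × Bool → Bool) : List (X × Bool) → Bool → Bool → Prop
  | [], u, v => u = v
  | d :: w, u, v => s d = u ∧ IsPath s w (s (opp d)) v

@[simp] theorem isPath_nil (s : X × Bool → Bool) (u v : Bool) : IsPath s [] u v ↔ u = v := Iff.rfl

@[simp] theorem isPath_cons (s : X × Bool → Bool) (d : X × Bool) (w : List (X × Bool))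
    (u v : Bool) : IsPath s (d :: w) u v ↔ s d = u ∧ IsPath s w (s (opp d)) v := Iff.rfl

theorem isPath_append {s : X × Bool → Bool} {w w' : List (X × Bool)} {u v : Bool} :
    IsPath s (w ++ w') u v ↔ ∃ c, IsPath s w u c ∧ IsPath s w' c v := by
  induction w generalizing u with
  | nil => simp
  | cons d w ih => simp [ih, and_assoc]

theorem IsPath.congr {s s' : X × Bool → Bool} {w : List (X × Bool)} {u v : Bool}
    (h : IsPath s w u v) (hs : ∀ d ∈ w, s' d = s d ∧ s' (opp d) = s (opp d)) :
    IsPath s' w u v := by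
  induction w generalizing u with
  | nil => exact h
  | cons d w ih =>
    have hd := hs d (by simp)
    refine ⟨hd.1.trans h.1, ?_⟩
    rw [hd.2]
    exact ih h.2 fun e he => hs e (by simp [he])

theorem isPath_of_const {s : X × Bool → Bool} {w : List (X × Bool)} {u : Bool}
    (h : ∀ d ∈ w, s d = u ∧ s (opp d) = u) : IsPath s w u u := by
  induction w with
  | nil => rfl
  | cons d w ih =>
    have hd := h d (by simp)
    refine ⟨hd.1, ?_⟩
    rw [hd.2]
    exact ih fun e he => h e (by simp [he])

/-- The words `w` and `Fs` are the faces of an oriented polygonal surface with a single vertex. -/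
structure IsSurface (w : List (X × Bool)) (Fs : List (List (X × Bool))) : Prop where
  nodup : (w ++ Fs.flatten).Nodup
  opp_mem : ∀ d ∈ w ++ Fs.flatten, opp d ∈ w ++ Fs.flatten
  ne_nil : [] ∉ Fs
  const : ∀ (s : X × Bool → Bool) (u : Bool), IsPath s w u u →
    (∀ F ∈ Fs, ∃ v, IsPath s F v v) → ∀ d ∈ w ++ Fs.flatten, s d = u

/-- `f : X → G` is a universal assignment with the property `Sat`. -/
structure Presents (f : X → G) (Sat : ∀ (H : Type) [Group H], (X → H) → Prop) : Prop where
  sat : Sat G f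
  closure_eq : Subgroup.closure (Set.range f) = ⊤
  lift : ∀ (H : Type) [Group H] (h : X → H), Sat H h → ∃ θ : G →* H, ∀ x, θ (f x) = h x

/-- A natural, reversible change of generators turns presentations into presentations. -/
theorem Presents.change {f : X → G} {Sat Sat' : ∀ (H : Type) [Group H], (X → H) → Prop}
    (hf : Presents f Sat) (T T' : ∀ (H : Type) [Group H], (X → H) → X → H)
    (hT : ∀ (H K : Type) [Group H] [Group K] (θ : H →* K) (h : X → H), θ ∘ T H h = T K (θ ∘ h))
    (hT' : ∀ (H K : Type) [Group H] [Group K] (θ : H →* K) (h : X → H),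
      θ ∘ T' H h = T' K (θ ∘ h))
    (hs : ∀ (H : Type) [Group H] (h : X → H), Sat H h → Sat' H (T H h) ∧ T' H (T H h) = h)
    (hs' : ∀ (H : Type) [Group H] (h : X → H), Sat' H h → Sat H (T' H h) ∧ T H (T' H h) = h) :
    Presents (T G f) Sat' where
  sat := (hs G f hf.sat).1
  closure_eq := by
    rw [eq_top_iff, ← hf.closure_eq, Subgroup.closure_le]
    rintro _ ⟨x, rfl⟩
    have h := hT' _ _ (Subgroup.closure (Set.range (T G f))).subtype
      fun x => ⟨T G f x, Subgroup.subset_closure ⟨x, rfl⟩⟩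
    have h2 := congrFun (h.trans (hs G f hf.sat).2) x
    rw [← h2]
    exact SetLike.coe_mem _
  lift H _ h hh := by
    obtain ⟨h1, h2⟩ := hs' H h hh
    obtain ⟨θ, hθ⟩ := hf.lift H _ h1
    refine ⟨θ, fun x => ?_⟩
    have : θ ∘ f = T' H h := funext hθ
    have h3 := hT G H θ f
    rw [this, h2] at h3
    exact congrFun h3 x

/-- The relations of a polygonal surface; letters which do not occur are trivial. -/
def FaceSat (w : List (X × Bool)) (Fs : List (List (X × Bool)))
    (H : Type) [Group H] (h : X → H) : Prop :=
  wordVal h w = 1 ∧ (∀ F ∈ Fs, wordVal h F = 1) ∧ ∀ x, (x, true) ∉ w ++ Fs.flatten → h x = 1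

theorem exists_shared_edge {w : List (X × Bool)} {Fs : List (List (X × Bool))}
    (h : IsSurface w Fs) (hF : Fs ≠ []) : ∃ d ∈ w, opp d ∈ Fs.flatten := by
  classical
  by_contra! hw
  have hc : ∀ d ∈ w, opp d ∈ w := fun d hd => by
    have := h.opp_mem d (by simp [hd])
    rw [List.mem_append] at this
    exact this.resolve_right (hw d hd)
  have hdis : ∀ d ∈ Fs.flatten, d ∉ w := fun d hd hd' =>
    (List.nodup_append.1 h.nodup).2.2 d hd' d hd rfl
  have hl := h.const (fun d => decide (d ∈ w)) true
    (isPath_of_const fun d hd => by simp [hd, hc d hd])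
    (fun F hFm => ⟨false, isPath_of_const fun d hd => by
      have h1 := hdis d (List.mem_flatten.2 ⟨F, hFm, hd⟩)
      have h2 : opp d ∉ w := fun h3 => h1 (by simpa using hc _ h3)
      simp [h1, h2]⟩)
  obtain ⟨F, Fs', rfl⟩ := List.exists_cons_of_ne_nil hF
  have hFn : F ≠ [] := fun h0 => h.ne_nil (by simp [h0])
  obtain ⟨d, F', rfl⟩ := List.exists_cons_of_ne_nil hFn
  have := hl d (by simp)
  exact hdis d (by simp) (by simpa using this)

theorem merge_perm (d e : X × Bool) (U₁ U₂ V₁ V₂ : List (X × Bool))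
    (F₁ F₂ : List (List (X × Bool))) :
    ((U₁ ++ d :: U₂) ++ (F₁ ++ (V₁ ++ e :: V₂) :: F₂).flatten).Perm
      (d :: e :: ((U₁ ++ V₂ ++ V₁ ++ U₂) ++ (F₁ ++ F₂).flatten)) := by
  classical
  rw [List.perm_iff_count]
  intro x
  simp only [List.count_append, List.count_cons, List.flatten_append, List.flatten_cons]
  omega

theorem IsSurface.merge {d : X × Bool} {U₁ U₂ V₁ V₂ : List (X × Bool)}
    {F₁ F₂ : List (List (X × Bool))}
    (h : IsSurface (U₁ ++ d :: U₂) (F₁ ++ (V₁ ++ opp d :: V₂) :: F₂)) :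
    IsSurface (U₁ ++ V₂ ++ V₁ ++ U₂) (F₁ ++ F₂) := by
  classical
  have hp := merge_perm d (opp d) U₁ U₂ V₁ V₂ F₁ F₂
  have hn := hp.nodup_iff.1 h.nodup
  have hm := fun e => hp.mem_iff (a := e)
  have hc := h.const
  have hopp := h.opp_mem
  simp only [hm] at hc hopp
  generalize hA : (U₁ ++ V₂ ++ V₁ ++ U₂) ++ (F₁ ++ F₂).flatten = A at hn hm hc hopp
  have hdA : d ∉ A := fun h' => by simp_all
  have heA : opp d ∉ A := fun h' => by simp_all
  have hoA : ∀ e ∈ A, opp e ∈ A := fun e he => by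
    have h1 := hopp e (by simp [he])
    simp only [List.mem_cons] at h1
    rcases h1 with h1 | h1 | h1
    · exact absurd (by rw [← h1, opp_opp]; exact he) heA
    · exact absurd (opp_inj h1 ▸ he) hdA
    · exact h1
  refine ⟨by rw [hA]; simp_all, by rw [hA]; exact hoA, ?_, ?_⟩
  · have := h.ne_nil
    simp_all
  rw [hA]
  intro s u hw hF e he
  simp only [isPath_append] at hw
  obtain ⟨p₃, ⟨p₂, ⟨p₁, hU₁, hV₂⟩, hV₁⟩, hU₂⟩ := hw
  let s' : X × Bool → Bool := fun e => if e = d then p₁ else if e = opp d then p₃ else s e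
  have hs'd : s' d = p₁ := by simp [s']
  have hs'e : s' (opp d) = p₃ := by simp [s', opp_ne]
  have hs' : ∀ e ∈ A, s' e = s e := fun e he => by
    have h1 : e ≠ d := fun h => hdA (h ▸ he)
    have h2 : e ≠ opp d := fun h => heA (h ▸ he)
    simp [s', h1, h2]
  have hcongr : ∀ {W u v}, IsPath s W u v → (∀ e ∈ W, e ∈ A) → IsPath s' W u v :=
    fun h1 h2 => h1.congr fun e he => ⟨hs' e (h2 e he), hs' _ (hoA e (h2 e he))⟩
  have key := hc s' u ?_ ?_ e (by simp [he])
  · rw [← hs' e he, key]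
  · rw [isPath_append]
    refine ⟨p₁, hcongr hU₁ (by simp +contextual [← hA]), hs'd, ?_⟩
    rw [hs'e]
    exact hcongr hU₂ (by simp +contextual [← hA])
  · intro F hFm
    simp only [List.mem_append, List.mem_cons] at hFm
    rcases hFm with hFm | rfl | hFm
    · obtain ⟨v, hv⟩ := hF F (by simp [hFm])
      exact ⟨v, hcongr hv fun e he => by
        rw [← hA]; simp only [List.mem_append, List.mem_flatten]; exact Or.inr ⟨F, Or.inl hFm, he⟩⟩
    · refine ⟨p₂, ?_⟩
      rw [isPath_append]
      refine ⟨p₃, hcongr hV₁ (by simp +contextual [← hA]), hs'e, ?_⟩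
      rw [opp_opp, hs'd]
      exact hcongr hV₂ (by simp +contextual [← hA])
    · obtain ⟨v, hv⟩ := hF F (by simp [hFm])
      exact ⟨v, hcongr hv fun e he => by
        rw [← hA]; simp only [List.mem_append, List.mem_flatten]; exact Or.inr ⟨F, Or.inr hFm, he⟩⟩

theorem Presents.merge [DecidableEq X] {f : X → G} {d : X × Bool} {U₁ U₂ V₁ V₂ : List (X × Bool)}
    {F₁ F₂ : List (List (X × Bool))}
    (h : IsSurface (U₁ ++ d :: U₂) (F₁ ++ (V₁ ++ opp d :: V₂) :: F₂))
    (hf : Presents f (FaceSat (U₁ ++ d :: U₂) (F₁ ++ (V₁ ++ opp d :: V₂) :: F₂))) :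
    ∃ f' : X → G, Presents f' (FaceSat (U₁ ++ V₂ ++ V₁ ++ U₂) (F₁ ++ F₂)) := by
  have hp := merge_perm d (opp d) U₁ U₂ V₁ V₂ F₁ F₂
  have hn := hp.nodup_iff.1 h.nodup
  have hm := fun e => hp.mem_iff (a := e)
  have hA' := h.merge.opp_mem
  set A := (U₁ ++ V₂ ++ V₁ ++ U₂) ++ (F₁ ++ F₂).flatten with hA
  have hdA : d ∉ A := fun h' => (List.nodup_cons.1 hn).1 (List.mem_cons_of_mem _ h')
  have heA : opp d ∉ A := (List.nodup_cons.1 (List.nodup_cons.1 hn).2).1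
  have hne : ∀ e ∈ A, e.1 ≠ d.1 := fun e he h1 => by
    rcases fst_eq_iff.1 h1 with rfl | rfl
    · exact hdA he
    · exact heA he
  have hval : ∀ (H : Type) [Group H] (h : X → H) (c : H) (W : List (X × Bool)),
      (∀ e ∈ W, e ∈ A) → wordVal (Function.update h d.1 c) W = wordVal h W :=
    fun H _ h c W hW => wordVal_congr fun e he => by
      rw [Function.update_of_ne (hne e (hW e he))]
  have hU₁ : ∀ e ∈ U₁, e ∈ A := by simp +contextual [hA]
  have hU₂ : ∀ e ∈ U₂, e ∈ A := by simp +contextual [hA]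
  have hV₁ : ∀ e ∈ V₁, e ∈ A := by simp +contextual [hA]
  have hV₂ : ∀ e ∈ V₂, e ∈ A := by simp +contextual [hA]
  have hW : ∀ e ∈ U₁ ++ V₂ ++ V₁ ++ U₂, e ∈ A := fun e he => List.mem_append_left _ he
  have hV : ∀ e ∈ V₂ ++ V₁, e ∈ A := fun e he =>
    (List.mem_append.1 he).elim (hV₂ e) (hV₁ e)
  have hF : ∀ F ∈ F₁ ++ F₂, ∀ e ∈ F, e ∈ A := fun F hF e he => by
    rw [hA]; exact List.mem_append_right _ (List.mem_flatten.2 ⟨F, hF, he⟩)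
  refine ⟨_, hf.change (fun H _ h => Function.update h d.1 1)
    (fun H _ h => Function.update h d.1
      (cond d.2 (wordVal h (V₂ ++ V₁)) (wordVal h (V₂ ++ V₁))⁻¹)) ?_ ?_ ?_ ?_⟩
  · intro H K _ _ θ h
    simp [Function.comp_update]
  · intro H K _ _ θ h
    simp only [Function.comp_update, Bool.apply_cond θ, map_inv, map_wordVal]
  · rintro H _ h ⟨hw, hFs, hx⟩
    have hd : letterVal h d = wordVal h (V₂ ++ V₁) := by
      have := hFs (V₁ ++ opp d :: V₂) (by simp)
      simp only [wordVal_append, wordVal_cons, letterVal_opp] at this ⊢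
      rw [← mul_assoc, mul_eq_one_iff_eq_inv, mul_inv_eq_iff_eq_mul] at this
      rw [this]
      group
    refine ⟨⟨?_, ?_, ?_⟩, ?_⟩
    · rw [hval _ _ _ _ hW]
      simp only [wordVal_append, wordVal_cons, hd] at hw ⊢
      rw [← hw]
      group
    · intro F hFm
      rw [hval _ _ _ _ (hF F hFm)]
      exact hFs F (by simp at hFm ⊢; tauto)
    · intro x hxA
      by_cases hxd : x = d.1
      · subst hxd; simp
      · rw [Function.update_of_ne hxd]
        refine hx x fun h1 => ?_
        rw [hm] at h1
        simp only [List.mem_cons] at h1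
        rcases h1 with h1 | h1 | h1
        · exact hxd (congrArg Prod.fst h1)
        · exact hxd (congrArg Prod.fst h1)
        · exact hxA h1
    · rw [hval _ _ _ _ hV, ← hd, cond_letterVal]
      simp
  · rintro H _ h ⟨hw, hFs, hx⟩
    have hd := letterVal_update_self h d (wordVal h (V₂ ++ V₁))
    refine ⟨⟨?_, ?_, ?_⟩, ?_⟩
    · rw [wordVal_append, wordVal_cons, hd, hval _ _ _ _ hU₁, hval _ _ _ _ hU₂]
      simp only [wordVal_append] at hw ⊢
      rw [← hw]
      group
    · intro F hFm
      by_cases hF0 : F ∈ F₁ ++ F₂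
      · rw [hval _ _ _ _ (hF F hF0)]
        exact hFs F hF0
      · have : F = V₁ ++ opp d :: V₂ := by simp at hFm hF0; tauto
        rw [this, wordVal_append, wordVal_cons, letterVal_opp, hd, hval _ _ _ _ hV₁,
          hval _ _ _ _ hV₂]
        simp only [wordVal_append]
        group
    · intro x hxA
      rw [hm] at hxA
      simp only [List.mem_cons, not_or] at hxA
      have hxd : x ≠ d.1 := by
        rintro rfl
        rcases fst_eq_iff (d := (d.1, true)) (e := d) |>.1 rfl with h1 | h1
        · exact hxA.1 h1
        · exact hxA.2.1 h1
      rw [Function.update_of_ne hxd]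
      exact hx x hxA.2.2
    · have : h d.1 = 1 := hx _ fun h1 => hne _ h1 rfl
      simp [← this]

/-- Every one-vertex polygonal surface can be cut open along a single polygon. -/
theorem Presents.exists_single_face [DecidableEq X] (N : ℕ) :
    ∀ {f : X → G} {w : List (X × Bool)} {Fs : List (List (X × Bool))}, Fs.length = N →
    IsSurface w Fs → Presents f (FaceSat w Fs) →
    ∃ (f' : X → G) (w' : List (X × Bool)), IsSurface w' [] ∧ Presents f' (FaceSat w' []) ∧
      w'.length + 2 * N = (w ++ Fs.flatten).length := by
  induction N with
  | zero =>
    intro f w Fs hN hs hf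
    obtain rfl := List.length_eq_zero_iff.1 hN
    exact ⟨f, w, hs, hf, by simp⟩
  | succ N ih =>
    intro f w Fs hN hs hf
    obtain ⟨d, hd, hd'⟩ := exists_shared_edge hs (by rintro rfl; simp at hN)
    obtain ⟨F, hF, hdF⟩ := List.mem_flatten.1 hd'
    obtain ⟨U₁, U₂, rfl⟩ := List.append_of_mem hd
    obtain ⟨F₁, F₂, rfl⟩ := List.append_of_mem hF
    obtain ⟨V₁, V₂, rfl⟩ := List.append_of_mem hdF
    obtain ⟨f', hf'⟩ := hf.merge hs
    obtain ⟨f'', w', h1, h2, h3⟩ := ih (by simp at hN ⊢; omega) hs.merge hf'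
    refine ⟨f'', w', h1, h2, ?_⟩
    rw [(merge_perm d (opp d) U₁ U₂ V₁ V₂ F₁ F₂).length_eq, List.length_cons, List.length_cons]
    omega

end QuadraticWords

section Handles

variable {X : Type} {G : Type} [Group G]

/-- The letters occurring in a list of handles. -/
def handleLetters (hs : List (X × X)) : List X := hs.flatMap fun q => [q.1, q.2]

/-- The product of the commutators of a list of handles. -/
def handleVal (f : X → G) (hs : List (X × X)) : G :=
  (hs.map fun q => f q.1 * f q.2 * (f q.1)⁻¹ * (f q.2)⁻¹).prod

theorem handleVal_congr {f f' : X → G} {hs : List (X × X)}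
    (h : ∀ x ∈ handleLetters hs, f x = f' x) : handleVal f hs = handleVal f' hs := by
  unfold handleVal
  congr 1
  refine List.map_congr_left fun q hq => ?_
  rw [h q.1 (List.mem_flatMap.2 ⟨q, hq, by simp⟩), h q.2 (List.mem_flatMap.2 ⟨q, hq, by simp⟩)]

/-- The relation of a polygon with boundary word `w` and the handles `hs`; letters which do not
occur are trivial. -/
def HandleSat (w : List (X × Bool)) (hs : List (X × X))
    (H : Type) [Group H] (h : X → H) : Prop :=
  wordVal h w * handleVal h hs = 1 ∧
    ∀ x, (x, true) ∉ w → x ∉ handleLetters hs → h x = 1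

theorem exists_linked_pair {a : X × Bool} {w : List (X × Bool)} (h : IsSurface (a :: w) []) :
    ∃ (b : X × Bool) (P Q R S : List (X × Bool)),
      w = P ++ b :: (Q ++ opp a :: (R ++ opp b :: S)) := by
  classical
  have hopp : ∀ d ∈ a :: w, opp d ∈ a :: w := by simpa using h.opp_mem
  have hn : (a :: w).Nodup := by simpa using h.nodup
  have haw : opp a ∈ w := (List.mem_cons.1 (hopp a (by simp))).resolve_left (opp_ne a)
  obtain ⟨Q', R', rfl⟩ := List.append_of_mem haw
  simp only [List.nodup_cons, List.nodup_append, List.mem_append, List.mem_cons, not_or] at hn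
  obtain ⟨⟨haQ, haA, haR⟩, hnQ, ⟨hAR, hnR⟩, hdis⟩ := hn
  have hAQ : opp a ∉ Q' := fun h' => hdis _ h' _ (Or.inl rfl) rfl
  have hQR : ∀ d ∈ Q', d ∉ R' := fun d h1 h2 => hdis d h1 d (Or.inr h2) rfl
  have hb : ∃ b ∈ Q', opp b ∉ Q' := by
    by_contra! hc
    have hl := h.const (fun d => decide (d ∈ Q' ∨ d = opp a)) false ?_ (by simp) (opp a) (by simp)
    · simp at hl
    refine ⟨by simp [haQ, haA], ?_⟩
    rw [isPath_append]
    refine ⟨true, ?_, ?_⟩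
    · simp only [or_true, decide_true]
      exact isPath_of_const fun d hd => by simp [hd, hc d hd]
    · have h0 : decide (opp (opp a) ∈ Q' ∨ opp (opp a) = opp a) = false := by simp [haQ, haA]
      refine ⟨by simp, ?_⟩
      change IsPath _ R' (decide (_ ∨ _)) false
      rw [h0]
      refine isPath_of_const fun d hd => ?_
      have h1 : d ∉ Q' := fun h1 => hQR d h1 hd
      have h2 : d ≠ opp a := fun h2 => hAR (h2 ▸ hd)
      have h3 : opp d ∉ Q' := fun h3 => h1 (by simpa using hc _ h3)
      have h4 : opp d ≠ opp a := fun h4 => haR (opp_inj h4 ▸ hd)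
      simp [h1, h2, h3, h4]
  obtain ⟨b, hbQ, hbQ'⟩ := hb
  have hbR : opp b ∈ R' := by
    have := hopp b (by simp [hbQ])
    simp only [List.mem_cons, List.mem_append] at this
    rcases this with h1 | h1 | h1 | h1
    · exact absurd (by rw [← h1, opp_opp]; exact hbQ) hAQ
    · exact absurd h1 hbQ'
    · exact absurd (opp_inj h1 ▸ hbQ) haQ
    · exact h1
  obtain ⟨P, Q, rfl⟩ := List.append_of_mem hbQ
  obtain ⟨R, S, rfl⟩ := List.append_of_mem hbR
  exact ⟨b, P, Q, R, S, by simp⟩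

theorem handle_perm (a b c d : X × Bool) (P Q R S : List (X × Bool)) :
    (a :: (P ++ b :: (Q ++ c :: (R ++ d :: S)))).Perm (a :: b :: c :: d :: (R ++ Q ++ P ++ S)) := by
  classical
  rw [List.perm_iff_count]
  intro x
  simp only [List.count_append, List.count_cons]
  omega

/-- The facts on letters that are used in splitting off a handle. -/
structure IsHandleSplit (a b : X × Bool) (A : List (X × Bool)) : Prop where
  nodup : A.Nodup
  opp_mem : ∀ d ∈ A, opp d ∈ A
  ne : a.1 ≠ b.1
  fst_ne_left : ∀ d ∈ A, d.1 ≠ a.1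
  fst_ne_right : ∀ d ∈ A, d.1 ≠ b.1

theorem IsSurface.isHandleSplit {a b : X × Bool} {P Q R S : List (X × Bool)}
    (h : IsSurface (a :: (P ++ b :: (Q ++ opp a :: (R ++ opp b :: S)))) []) :
    IsHandleSplit a b (R ++ Q ++ P ++ S) := by
  have hp := handle_perm a b (opp a) (opp b) P Q R S
  have hn := h.nodup
  have hopp := h.opp_mem
  simp only [List.flatten_nil, List.append_nil] at hn hopp
  replace hn := hp.nodup_iff.1 hn
  simp only [hp.mem_iff] at hopp
  generalize R ++ Q ++ P ++ S = A at hn hopp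
  simp only [List.nodup_cons, List.mem_cons, not_or] at hn
  obtain ⟨⟨hab, -, haB, haA⟩, ⟨-, -, hbA⟩, ⟨-, haA'⟩, hbA', hnA⟩ := hn
  refine ⟨hnA, fun d hd => ?_, fun h1 => ?_, fun d hd h1 => ?_, fun d hd h1 => ?_⟩
  · have := hopp d (by simp [hd])
    simp only [List.mem_cons] at this
    rcases this with h1 | h1 | h1 | h1 | h1
    · exact absurd (by rw [← h1, opp_opp]; exact hd) haA'
    · exact absurd (by rw [← h1, opp_opp]; exact hd) hbA'
    · exact absurd (opp_inj h1 ▸ hd) haA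
    · exact absurd (opp_inj h1 ▸ hd) hbA
    · exact h1
  · rcases fst_eq_iff.1 h1 with h2 | h2
    · exact hab h2
    · exact haB h2
  · rcases fst_eq_iff.1 h1 with rfl | rfl
    · exact haA hd
    · exact haA' hd
  · rcases fst_eq_iff.1 h1 with rfl | rfl
    · exact hbA hd
    · exact hbA' hd

theorem IsSurface.splitHandle {a b : X × Bool} {P Q R S : List (X × Bool)}
    (h : IsSurface (a :: (P ++ b :: (Q ++ opp a :: (R ++ opp b :: S)))) []) :
    IsSurface (R ++ Q ++ P ++ S) [] := by
  classical
  have hp := handle_perm a b (opp a) (opp b) P Q R S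
  have hA := h.isHandleSplit
  refine ⟨by simpa using hA.nodup, by simpa using hA.opp_mem, by simp, ?_⟩
  intro s p₀ hw _ e he
  rw [List.flatten_nil, List.append_nil] at he
  simp only [isPath_append] at hw
  obtain ⟨p₃, ⟨p₂, ⟨p₁, hR, hQ⟩, hP⟩, hS⟩ := hw
  let s' : X × Bool → Bool := fun e => if e = a then p₀ else if e = opp a then p₂ else
    if e = b then p₃ else if e = opp b then p₁ else s e
  have hab : ∀ {d e : X × Bool}, d.1 ≠ e.1 → d ≠ e := fun h1 h2 => h1 (congrArg Prod.fst h2)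
  have hs'a : s' a = p₀ := by simp [s']
  have hsa' : s' (opp a) = p₂ := by simp [s', opp_ne]
  have hs'b : s' b = p₃ := by
    simp [s', hab (d := b) (e := a) hA.ne.symm, hab (d := b) (e := opp a) hA.ne.symm]
  have hsb' : s' (opp b) = p₁ := by
    simp [s', hab (d := opp b) (e := a) hA.ne.symm, hab (d := opp b) (e := opp a) hA.ne.symm,
      opp_ne]
  have hs' : ∀ e ∈ R ++ Q ++ P ++ S, s' e = s e := fun e he => by
    simp [s', hab (hA.fst_ne_left e he), hab (hA.fst_ne_right e he),
      hab (d := e) (e := opp a) (hA.fst_ne_left e he),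
      hab (d := e) (e := opp b) (hA.fst_ne_right e he)]
  have hcongr : ∀ {W u v}, IsPath s W u v → (∀ e ∈ W, e ∈ R ++ Q ++ P ++ S) → IsPath s' W u v :=
    fun h1 h2 => h1.congr fun e he => ⟨hs' e (h2 e he), hs' _ (hA.opp_mem e (h2 e he))⟩
  have key := h.const s' p₀ ?_ (by simp) e ?_
  · rw [← hs' e he, key]
  · refine ⟨hs'a, ?_⟩
    rw [hsa', isPath_append]
    refine ⟨p₃, hcongr hP (by simp +contextual), hs'b, ?_⟩
    rw [hsb', isPath_append]
    refine ⟨p₂, hcongr hQ (by simp +contextual), hsa', ?_⟩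
    rw [opp_opp, hs'a, isPath_append]
    refine ⟨p₁, hcongr hR (by simp +contextual), hsb', ?_⟩
    rw [opp_opp, hs'b]
    exact hcongr hS (by simp +contextual)
  · rw [List.flatten_nil, List.append_nil, hp.mem_iff]
    simp only [List.mem_cons]
    tauto

theorem Presents.splitHandle [DecidableEq X] {f : X → G} {a b : X × Bool}
    {P Q R S : List (X × Bool)} {hs : List (X × X)}
    (h : IsSurface (a :: (P ++ b :: (Q ++ opp a :: (R ++ opp b :: S)))) [])
    (hdis : ∀ d ∈ a :: (P ++ b :: (Q ++ opp a :: (R ++ opp b :: S))), d.1 ∉ handleLetters hs)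
    (hf : Presents f (HandleSat (a :: (P ++ b :: (Q ++ opp a :: (R ++ opp b :: S)))) hs)) :
    ∃ f' : X → G, Presents f' (HandleSat (R ++ Q ++ P ++ S) ((a.1, b.1) :: hs)) := by
  have hp := handle_perm a b (opp a) (opp b) P Q R S
  have hA := h.isHandleSplit
  have hval : ∀ (H : Type) [Group H] (h : X → H) (c c' : H) (W : List (X × Bool)),
      (∀ e ∈ W, e ∈ R ++ Q ++ P ++ S) →
      wordVal (Function.update (Function.update h a.1 c) b.1 c') W = wordVal h W :=
    fun H _ h c c' W hW => wordVal_congr fun e he => by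
      rw [Function.update_of_ne (hA.fst_ne_right e (hW e he)),
        Function.update_of_ne (hA.fst_ne_left e (hW e he))]
  have haL : a.1 ∉ handleLetters hs := hdis a (by simp)
  have hbL : b.1 ∉ handleLetters hs := hdis b (by simp)
  have hhval : ∀ (H : Type) [Group H] (h : X → H) (c c' : H),
      handleVal (Function.update (Function.update h a.1 c) b.1 c') hs = handleVal h hs :=
    fun H _ h c c' => handleVal_congr fun x hx => by
      rw [Function.update_of_ne (by rintro rfl; exact hbL hx),
        Function.update_of_ne (by rintro rfl; exact haL hx)]
  have hP : ∀ e ∈ P, e ∈ R ++ Q ++ P ++ S := by simp +contextual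
  have hQ : ∀ e ∈ Q, e ∈ R ++ Q ++ P ++ S := by simp +contextual
  have hR : ∀ e ∈ R, e ∈ R ++ Q ++ P ++ S := by simp +contextual
  have hS : ∀ e ∈ S, e ∈ R ++ Q ++ P ++ S := by simp +contextual
  let α : ∀ (H : Type) [Group H], (X → H) → H := fun H _ h =>
    wordVal h (R ++ Q ++ P ++ S) * h a.1 * (wordVal h (P ++ S))⁻¹
  let β : ∀ (H : Type) [Group H], (X → H) → H := fun H _ h =>
    wordVal h S * h b.1 * (wordVal h (Q ++ P ++ S))⁻¹
  let α' : ∀ (H : Type) [Group H], (X → H) → H := fun H _ h =>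
    (wordVal h (R ++ Q ++ P ++ S))⁻¹ * letterVal h a * wordVal h (P ++ S)
  let β' : ∀ (H : Type) [Group H], (X → H) → H := fun H _ h =>
    (wordVal h S)⁻¹ * letterVal h b * wordVal h (Q ++ P ++ S)
  have hla : ∀ (H : Type) [Group H] (h : X → H) (c c' : H),
      letterVal (Function.update (Function.update h a.1 (cond a.2 c c⁻¹)) b.1 c') a = c :=
    fun H _ h c c' => by
      rw [Function.update_comm hA.ne, letterVal_update_self]
  refine ⟨_, hf.change
    (fun H _ h => Function.update (Function.update h a.1 (α' H h)) b.1 (β' H h))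
    (fun H _ h => Function.update (Function.update h a.1 (cond a.2 (α H h) (α H h)⁻¹)) b.1
      (cond b.2 (β H h) (β H h)⁻¹)) ?_ ?_ ?_ ?_⟩
  · intro H K _ _ θ h
    simp only [α', β', Function.comp_update, map_mul, map_inv, map_wordVal, map_letterVal]
  · intro H K _ _ θ h
    simp only [α, β, Function.comp_update, Bool.apply_cond θ, map_inv, map_mul, map_wordVal,
      Function.comp_apply]
  · rintro H _ h ⟨hw, hx⟩
    refine ⟨⟨?_, ?_⟩, ?_⟩
    · rw [hval _ _ _ _ _ fun _ h => h]
      simp only [handleVal, List.map_cons, List.prod_cons, Function.update_self,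
        Function.update_of_ne hA.ne] at hw ⊢
      have h1 := hhval H h (α' H h) (β' H h)
      simp only [handleVal] at h1
      rw [h1]
      simp only [α', β', wordVal_append, wordVal_cons, letterVal_opp] at hw ⊢
      rw [← hw]
      group
    · intro x hxA hxL
      simp only [handleLetters, List.flatMap_cons, List.mem_append, List.mem_cons,
        List.not_mem_nil, or_false, not_or] at hxL
      rw [Function.update_of_ne hxL.1.2, Function.update_of_ne hxL.1.1]
      refine hx x (fun h1 => ?_) hxL.2
      rw [hp.mem_iff] at h1
      simp only [List.mem_cons] at h1
      rcases h1 with h1 | h1 | h1 | h1 | h1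
      · exact hxL.1.1 (congrArg Prod.fst h1)
      · exact hxL.1.2 (congrArg Prod.fst h1)
      · exact hxL.1.1 (congrArg Prod.fst h1)
      · exact hxL.1.2 (congrArg Prod.fst h1)
      · exact hxA h1
    · have h1 : ∀ c c', α H (Function.update (Function.update h a.1 c) b.1 c') =
          wordVal h (R ++ Q ++ P ++ S) * c * (wordVal h (P ++ S))⁻¹ := fun c c' => by
        simp only [α]
        rw [hval _ _ _ _ _ fun _ h => h, hval _ _ _ _ (P ++ S) (by simp +contextual),
          Function.update_of_ne hA.ne, Function.update_self]
      have h2 : ∀ c c', β H (Function.update (Function.update h a.1 c) b.1 c') =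
          wordVal h S * c' * (wordVal h (Q ++ P ++ S))⁻¹ := fun c c' => by
        simp only [β]
        rw [hval _ _ _ _ _ hS, hval _ _ _ _ (Q ++ P ++ S) (by simp +contextual),
          Function.update_self]
      have h3 : wordVal h (R ++ Q ++ P ++ S) * α' H h * (wordVal h (P ++ S))⁻¹ = letterVal h a := by
        simp only [α']; group
      have h4 : wordVal h S * β' H h * (wordVal h (Q ++ P ++ S))⁻¹ = letterVal h b := by
        simp only [β']; group
      simp only [h1, h2, h3, h4, cond_letterVal]
      rw [Function.update_comm hA.ne, Function.update_idem, Function.update_comm hA.ne,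
        Function.update_idem, Function.update_eq_self, Function.update_eq_self]
  · rintro H _ h ⟨hw, hx⟩
    refine ⟨⟨?_, ?_⟩, ?_⟩
    · rw [hhval]
      have hw' : wordVal h (R ++ Q ++ P ++ S) *
        (h a.1 * h b.1 * (h a.1)⁻¹ * (h b.1)⁻¹ * handleVal h hs) = 1 := hw
      simp only [wordVal_cons, wordVal_append, letterVal_opp, hla, letterVal_update_self,
        hval _ _ _ _ _ hP, hval _ _ _ _ _ hQ, hval _ _ _ _ _ hR, hval _ _ _ _ _ hS] at hw' ⊢
      rw [← hw']
      simp only [α, β, wordVal_append]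
      group
    · intro x hxA hxL
      rw [hp.mem_iff] at hxA
      simp only [List.mem_cons, not_or] at hxA
      have hxa : x ≠ a.1 := by
        rintro rfl
        rcases fst_eq_iff (d := (a.1, true)) (e := a) |>.1 rfl with h1 | h1
        · exact hxA.1 h1
        · exact hxA.2.2.1 h1
      have hxb : x ≠ b.1 := by
        rintro rfl
        rcases fst_eq_iff (d := (b.1, true)) (e := b) |>.1 rfl with h1 | h1
        · exact hxA.2.1 h1
        · exact hxA.2.2.2.1 h1
      rw [Function.update_of_ne hxb, Function.update_of_ne hxa]
      refine hx x hxA.2.2.2.2 ?_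
      simp only [handleLetters, List.flatMap_cons, List.mem_append, List.mem_cons,
        List.not_mem_nil, or_false, not_or]
      exact ⟨⟨hxa, hxb⟩, hxL⟩
    · have h1 : α' H (Function.update (Function.update h a.1 (cond a.2 (α H h) (α H h)⁻¹)) b.1
          (cond b.2 (β H h) (β H h)⁻¹)) = h a.1 := by
        simp only [α', hla]
        rw [hval _ _ _ _ _ fun _ h => h, hval _ _ _ _ (P ++ S) (by simp +contextual)]
        simp only [α]
        group
      have h2 : β' H (Function.update (Function.update h a.1 (cond a.2 (α H h) (α H h)⁻¹)) b.1
          (cond b.2 (β H h) (β H h)⁻¹)) = h b.1 := by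
        simp only [β', letterVal_update_self]
        rw [hval _ _ _ _ _ hS, hval _ _ _ _ (Q ++ P ++ S) (by simp +contextual)]
        simp only [β]
        group
      simp only [h1, h2]
      rw [Function.update_comm hA.ne, Function.update_idem, Function.update_comm hA.ne,
        Function.update_idem, Function.update_eq_self, Function.update_eq_self]

/-- A one-vertex polygon with handles can be brought into the standard form. -/
theorem Presents.exists_handles [DecidableEq X] (N : ℕ) :
    ∀ {f : X → G} {w : List (X × Bool)} {hs : List (X × X)}, w.length = N →
    IsSurface w [] → (handleLetters hs).Nodup → (∀ d ∈ w, d.1 ∉ handleLetters hs) →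
    Presents f (HandleSat w hs) →
    ∃ (f' : X → G) (hs' : List (X × X)), (handleLetters hs').Nodup ∧
      Presents f' (HandleSat [] hs') ∧ 4 * hs'.length = N + 4 * hs.length := by
  induction N using Nat.strong_induction_on with
  | _ N ih =>
    intro f w hs hN hw hhs hdis hf
    cases w with
    | nil => exact ⟨f, hs, hhs, hf, by simp [← hN]⟩
    | cons a w =>
      obtain ⟨b, P, Q, R, S, rfl⟩ := exists_linked_pair hw
      obtain ⟨f', hf'⟩ := hf.splitHandle hw hdis
      have hA := hw.isHandleSplit
      have hlen := (handle_perm a b (opp a) (opp b) P Q R S).length_eq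
      simp only [List.length_cons] at hlen hN
      have h1 : (handleLetters ((a.1, b.1) :: hs)).Nodup := by
        have ha := hdis a (by simp)
        have hb := hdis b (by simp)
        simp only [handleLetters, List.flatMap_cons] at ha hb hhs ⊢
        simp [hA.ne, hhs, -List.mem_flatMap, ha, hb]
      have h2 : ∀ d ∈ R ++ Q ++ P ++ S, d.1 ∉ handleLetters ((a.1, b.1) :: hs) := by
        intro d hd
        have hd' := hdis d ((handle_perm a b (opp a) (opp b) P Q R S).mem_iff.2
          (by simp only [List.mem_cons]; tauto))
        simp only [handleLetters, List.flatMap_cons, List.mem_append, List.mem_cons,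
          List.not_mem_nil, or_false, not_or] at hd' ⊢
        exact ⟨⟨hA.fst_ne_left d hd, hA.fst_ne_right d hd⟩, hd'⟩
      obtain ⟨f'', hs', h3, h4, h5⟩ := ih _ (by omega) rfl hw.splitHandle h1 h2 hf'
      refine ⟨f'', hs', h3, h4, ?_⟩
      simp only [List.length_cons] at h5
      omega

end Handles

section SurfacePresentation

variable {X : Type} {G : Type} [Group G]

/-- The letters of a list of handles, indexed by the generators of a surface group. -/
def handleLetter (hs : List (X × X)) : SGen hs.length → X
  | .c i => (hs.get i).1
  | .d i => (hs.get i).2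

theorem handleLetter_injective {hs : List (X × X)} (h : (handleLetters hs).Nodup) :
    Function.Injective (handleLetter hs) := by
  rw [handleLetters, List.nodup_flatMap, List.pairwise_iff_get] at h
  obtain ⟨h1, h2⟩ := h
  have key : ∀ i j : Fin hs.length, i ≠ j →
      List.Disjoint [(hs.get i).1, (hs.get i).2] [(hs.get j).1, (hs.get j).2] := by
    intro i j hij
    rcases lt_or_gt_of_ne hij with h | h
    · exact h2 i j h
    · exact (h2 j i h).symm
  have key' : ∀ i j : Fin hs.length, (hs.get i).1 ≠ (hs.get j).2 := by
    intro i j hij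
    by_cases h : i = j
    · subst h
      have := h1 _ (List.get_mem hs i)
      simp at this
      exact this hij
    · have := key i j h
      simp only [List.disjoint_cons_left] at this
      exact this.1 (by rw [hij]; simp)
  rintro (i | i) (j | j) hij
  · congr 1
    by_contra h
    exact (key i j h) (a := (hs.get i).1) (by simp) (by
      change (hs.get i).1 = (hs.get j).1 at hij
      rw [hij]; simp)
  · exact absurd hij (key' i j)
  · exact absurd hij.symm (key' j i)
  · congr 1
    by_contra h
    exact (key i j h) (a := (hs.get i).2) (by simp) (by
      change (hs.get i).2 = (hs.get j).2 at hij
      rw [hij]; simp)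

theorem mem_handleLetters {hs : List (X × X)} {x : X} :
    x ∈ handleLetters hs ↔ ∃ s, handleLetter hs s = x := by
  simp only [handleLetters, List.mem_flatMap, List.mem_cons, List.not_mem_nil, or_false]
  constructor
  · rintro ⟨q, hq, rfl | rfl⟩ <;> obtain ⟨i, rfl⟩ := List.mem_iff_get.1 hq
    · exact ⟨.c i, rfl⟩
    · exact ⟨.d i, rfl⟩
  · rintro ⟨i | i, rfl⟩
    · exact ⟨_, List.get_mem hs i, Or.inl rfl⟩
    · exact ⟨_, List.get_mem hs i, Or.inr rfl⟩

theorem lift_surfaceRel (f : X → G) (hs : List (X × X)) :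
    FreeGroup.lift (f ∘ handleLetter hs) (surfaceRel hs.length) = handleVal f hs := by
  rw [surfaceRel, map_list_prod, List.map_map, handleVal]
  conv_rhs => rw [← List.map_get_finRange hs]
  rw [List.map_map]
  congr 1
  refine List.map_congr_left fun i _ => ?_
  simp [handleLetter]

theorem Presents.equivSurfaceGroup {f : X → G} {hs : List (X × X)}
    (hn : (handleLetters hs).Nodup) (hf : Presents f (HandleSat [] hs)) :
    Nonempty (G ≃* SurfaceGroup hs.length) := by
  have hinj := handleLetter_injective hn
  let h : X → SurfaceGroup hs.length :=
    Function.extend (handleLetter hs) PresentedGroup.of 1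
  have hh : h ∘ handleLetter hs = PresentedGroup.of := Function.extend_comp hinj _ _
  obtain ⟨θ, hθ⟩ := hf.lift _ h ⟨by
      rw [← lift_surfaceRel, hh]
      have h1 : FreeGroup.lift PresentedGroup.of = PresentedGroup.mk {surfaceRel hs.length} := by
        ext; simp [PresentedGroup.of]
      rw [h1, wordVal_nil, one_mul]
      exact PresentedGroup.one_of_mem rfl,
    fun x _ hx => by
      rw [mem_handleLetters] at hx
      exact Function.extend_apply' _ _ _ hx⟩
  have hrel : ∀ r ∈ ({surfaceRel hs.length} : Set (FreeGroup (SGen hs.length))),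
      FreeGroup.lift (f ∘ handleLetter hs) r = 1 := by
    rintro _ rfl
    rw [lift_surfaceRel]
    simpa using hf.sat.1
  refine ⟨MonoidHom.toMulEquiv θ (PresentedGroup.toGroup hrel) ?_ ?_⟩
  · refine MonoidHom.eq_of_eqOn_dense hf.closure_eq ?_
    rintro _ ⟨x, rfl⟩
    simp only [MonoidHom.comp_apply, hθ, MonoidHom.id_apply]
    by_cases hx : x ∈ handleLetters hs
    · obtain ⟨s, rfl⟩ := mem_handleLetters.1 hx
      rw [show h (handleLetter hs s) = PresentedGroup.of s from congrFun hh s]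
      simp
    · rw [hf.sat.2 x (by simp) hx]
      rw [mem_handleLetters] at hx
      rw [show h x = 1 from Function.extend_apply' _ _ _ hx, map_one]
  · ext s
    simp only [MonoidHom.comp_apply, MonoidHom.id_apply, PresentedGroup.toGroup.of, hθ,
      Function.comp_apply]
    exact congrFun hh s

theorem Presents.nonempty_equiv_surfaceGroup {f : X → G} {w : List (X × Bool)}
    {Fs : List (List (X × Bool))} (hs : IsSurface w Fs) (hf : Presents f (FaceSat w Fs)) (g : ℕ)
    (hg : (w ++ Fs.flatten).length = 4 * g + 2 * Fs.length) : Nonempty (G ≃* SurfaceGroup g) := by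
  classical
  obtain ⟨f₁, w₁, h1, h2, h3⟩ := hf.exists_single_face _ rfl hs
  have h4 : Presents f₁ (HandleSat w₁ []) := by
    have : FaceSat w₁ [] = HandleSat w₁ [] := by
      funext H _ h
      simp [FaceSat, HandleSat, handleVal, handleLetters]
    rwa [← this]
  obtain ⟨f₂, hs₂, h5, h6, h7⟩ := h4.exists_handles _ rfl h1 (by simp [handleLetters])
    (by simp [handleLetters])
  have : g = hs₂.length := by
    simp only [List.length_nil] at h7
    omega
  rw [this]
  exact h6.equivSurfaceGroup h5

end SurfacePresentation

section Covering

variable {Q : Type} [CommGroup Q] {g₀ m : ℕ}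

/-- The lift of the word `∏ x j`, `j ∈ l`, to the covering with group `Q`, starting at `k`. -/
def pathWord (g₀ : ℕ) (μ : Fin m → Q) : List (Fin m) → Q → List ((Gen g₀ m × Q) × Bool)
  | [], _ => []
  | j :: l, k => ((.x j, k), true) :: pathWord g₀ μ l ((μ j)⁻¹ * k)

/-- The lift of the word `∏ [a i, b i]`, `i ∈ l`, to the covering with group `Q`. -/
def commWord (m : ℕ) (l : List (Fin g₀)) (e : Q) : List ((Gen g₀ m × Q) × Bool) :=
  l.flatMap fun i => [((.a i, e), true), ((.b i, e), true), ((.a i, e), false), ((.b i, e), false)]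

/-- The lifts of the long relation, with the letter `x 0` removed. -/
def longFace (g₀ : ℕ) (ν : Fin (m + 1) → Q) (k : Q) : List ((Gen g₀ m × Q) × Bool) :=
  pathWord g₀ (fun j => ν j.succ) (List.finRange m) k ++ commWord m (List.finRange g₀) (ν 0 * k)

/-- The lift of the inverse of the relation `x j ^ p`. -/
def coneFace (g₀ p : ℕ) (ν : Fin (m + 1) → Q) (j : Fin m) : List ((Gen g₀ m × Q) × Bool) :=
  (List.range p).map fun i => ((.x j, ν j.succ ^ i), false)

theorem length_pathWord (μ : Fin m → Q) (l : List (Fin m)) (k : Q) :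
    (pathWord g₀ μ l k).length = l.length := by
  induction l generalizing k with
  | nil => rfl
  | cons j l ih => simp [pathWord, ih]

omit [CommGroup Q] in
theorem length_commWord (l : List (Fin g₀)) (e : Q) :
    (commWord m l e).length = 4 * l.length := by
  simp [commWord, List.length_flatMap, mul_comm]

theorem length_longFace (ν : Fin (m + 1) → Q) (k : Q) :
    (longFace g₀ ν k).length = m + 4 * g₀ := by
  simp [longFace, length_pathWord, length_commWord]

theorem length_coneFace (p : ℕ) (ν : Fin (m + 1) → Q) (j : Fin m) :
    (coneFace g₀ p ν j).length = p := by
  simp [coneFace]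

theorem exists_mem_pathWord (μ : Fin m → Q) {l : List (Fin m)} {j : Fin m} (hj : j ∈ l) (k : Q) :
    ∃ k', ((Gen.x j, k), true) ∈ pathWord g₀ μ l k' := by
  induction l with
  | nil => simp at hj
  | cons i l ih =>
    by_cases h : j = i
    · exact ⟨k, by simp [pathWord, h]⟩
    · obtain ⟨k', hk'⟩ := ih ((List.mem_cons.1 hj).resolve_left h)
      exact ⟨μ i * k', by simp [pathWord, hk']⟩

section Paths

variable {s : (Gen g₀ m × Q) × Bool → Bool}

omit [CommGroup Q] in
theorem IsPath.of_commWord {l : List (Fin g₀)} {e : Q} {u v : Bool}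
    (h : IsPath s (commWord m l e) u v) :
    u = v ∧ ∀ i ∈ l, ∀ b, s ((.a i, e), b) = u ∧ s ((.b i, e), b) = u := by
  induction l generalizing u with
  | nil => exact ⟨h, by simp⟩
  | cons i l ih =>
    simp only [commWord, List.flatMap_cons, List.cons_append, List.nil_append, isPath_cons, opp,
      Bool.not_true, Bool.not_false] at h
    obtain ⟨h1, h2, h3, h4, h5⟩ := h
    have ha : s ((.a i, e), false) = u := h3.trans (h4.trans h1)
    have hb : s ((.b i, e), true) = u := h2.trans ha
    obtain ⟨rfl, h7⟩ := ih (u := u) (hb ▸ h5)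
    refine ⟨rfl, fun i' hi' => ?_⟩
    rcases List.mem_cons.1 hi' with rfl | hi'
    · rintro (_ | _)
      · exact ⟨ha, h4.trans h1⟩
      · exact ⟨h1, hb⟩
    · exact h7 i' hi'

theorem IsPath.of_range {X : Type} {s : X × Bool → Bool} {d : ℕ → X × Bool} {n : ℕ} {u v : Bool}
    (h : IsPath s ((List.range (n + 1)).map d) u v) :
    s (d 0) = u ∧ (∀ i < n, s (d (i + 1)) = s (opp (d i))) ∧ s (opp (d n)) = v := by
  induction n generalizing v with
  | zero => simpa using h
  | succ n ih =>
    rw [List.range_succ, List.map_append, isPath_append] at h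
    obtain ⟨c, h1, h2⟩ := h
    obtain ⟨h3, h4, h5⟩ := ih h1
    simp only [List.map_cons, List.map_nil, isPath_cons, isPath_nil] at h2
    refine ⟨h3, fun i hi => ?_, h2.2⟩
    rcases Nat.lt_succ_iff_lt_or_eq.1 hi with hi | rfl
    · exact h4 i hi
    · rw [h2.1, h5]

theorem IsPath.of_coneFace {p : ℕ} (hp : 0 < p) {ν : Fin (m + 1) → Q} {j : Fin m}
    (hν : ∀ q, ∃ i < p, ν j.succ ^ i = q) (hνp : ν j.succ ^ p = 1) {v : Bool}
    (h : IsPath s (coneFace g₀ p ν j) v v) (k : Q) :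
    s ((.x j, ν j.succ * k), false) = s ((.x j, k), true) := by
  obtain ⟨n, rfl⟩ := Nat.exists_eq_succ_of_ne_zero hp.ne'
  obtain ⟨h1, h2, h3⟩ := h.of_range
  obtain ⟨i, hi, rfl⟩ := hν k
  rw [← pow_succ']
  rcases Nat.lt_succ_iff_lt_or_eq.1 hi with hi | rfl
  · exact h2 i hi
  · simp only [opp, Bool.not_false, pow_zero] at h1 h3
    rw [hνp, h1, h3]

theorem eq_of_isPath_pathWord {μ : Fin m → Q} {l : List (Fin m)} {τ : Q → Bool}
    (hs : ∀ j k, s ((.x j, μ j * k), false) = s ((.x j, k), true))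
    (h : ∀ k, ∃ v, IsPath s (pathWord g₀ μ l k) (τ k) v) :
    ∀ j ∈ l, ∀ k, s ((.x j, k), true) = τ k := by
  induction l with
  | nil => simp
  | cons i l ih =>
    have hi : ∀ k, s ((.x i, k), true) = τ k := fun k => (h k).choose_spec.1
    have hl := ih fun k => by
      obtain ⟨v, h1, h2⟩ := h (μ i * k)
      refine ⟨v, ?_⟩
      rw [inv_mul_cancel_left] at h2
      simpa only [opp, Bool.not_true, hs, hi] using h2
    intro j hj
    rcases List.mem_cons.1 hj with rfl | hj
    · exact hi
    · exact hl j hj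

theorem IsPath.target_pathWord {μ : Fin m → Q} {l : List (Fin m)} {τ : Q → Bool}
    (hs : ∀ j k, s ((.x j, μ j * k), false) = s ((.x j, k), true))
    (hτ : ∀ j ∈ l, ∀ k, s ((.x j, k), true) = τ k) {k : Q} {v : Bool}
    (h : IsPath s (pathWord g₀ μ l k) (τ k) v) : τ ((l.map μ).prod⁻¹ * k) = v := by
  induction l generalizing k with
  | nil => simpa [pathWord] using h
  | cons i l ih =>
    have h2 := h.2
    have h3 := hs i ((μ i)⁻¹ * k)
    rw [mul_inv_cancel_left, hτ i (by simp)] at h3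
    simp only [opp, Bool.not_true, h3] at h2
    rw [← ih (fun j hj => hτ j (by simp [hj])) h2]
    simp [mul_assoc, mul_comm]

end Paths

theorem const_of_isPath {ν : Fin (m + 1) → Q} {p : ℕ} (hp : 0 < p)
    (hν : ∀ j q, ∃ i < p, ν j ^ i = q) (hνp : ∀ j, ν j ^ p = 1)
    (hprod : ((List.finRange (m + 1)).map ν).prod = 1)
    {s : (Gen g₀ m × Q) × Bool → Bool} {u : Bool} {k₀ : Q}
    (h₀ : IsPath s (longFace g₀ ν k₀) u u) (hl : ∀ k, ∃ v, IsPath s (longFace g₀ ν k) v v)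
    (hc : ∀ j, ∃ v, IsPath s (coneFace g₀ p ν j) v v) (d : (Gen g₀ m × Q) × Bool) : s d = u := by
  have hs : ∀ j k, s ((.x j, ν j.succ * k), false) = s ((.x j, k), true) := fun j k =>
    (hc j).choose_spec.of_coneFace hp (hν j.succ) (hνp j.succ) k
  have hl' : ∀ k, ∃ v, IsPath s (longFace g₀ ν k) v v ∧ (k = k₀ → v = u) := fun k => by
    by_cases hk : k = k₀
    · exact ⟨u, hk ▸ h₀, fun _ => rfl⟩
    · obtain ⟨v, hv⟩ := hl k
      exact ⟨v, hv, fun h => absurd h hk⟩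
  choose τ hτ hτu using hl'
  simp only [longFace, isPath_append] at hτ
  choose c hc₁ hc₂ using hτ
  have hx := eq_of_isPath_pathWord hs fun k => ⟨_, hc₁ k⟩
  have hcτ : ∀ k, c k = τ k := fun k => (hc₂ k).of_commWord.1
  have hν0 : ∀ k, τ (ν 0 * k) = τ k := fun k => by
    rw [← hcτ k, ← (hc₁ k).target_pathWord hs hx]
    rw [List.finRange_succ, List.map_cons, List.prod_cons, List.map_map,
      mul_eq_one_iff_eq_inv] at hprod
    rw [hprod]
    rfl
  have hτ' : ∀ k, τ k = u := fun k => by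
    obtain ⟨i, -, hi⟩ := hν 0 (k * k₀⁻¹)
    rw [← hτu k₀ rfl, ← inv_mul_cancel_right k k₀, ← hi]
    clear hi
    induction i with
    | zero => simp
    | succ i ih => rw [pow_succ', mul_assoc, hν0, ih]
  obtain ⟨⟨i | i | j, k⟩, b⟩ := d
  · have := ((hc₂ ((ν 0)⁻¹ * k)).of_commWord.2 i (by simp) b).1
    rwa [mul_inv_cancel_left, hcτ, hτ'] at this
  · have := ((hc₂ ((ν 0)⁻¹ * k)).of_commWord.2 i (by simp) b).2
    rwa [mul_inv_cancel_left, hcτ, hτ'] at this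
  · cases b
    · rw [← mul_inv_cancel_left (ν j.succ) k, hs, hx j (by simp), hτ']
    · rw [hx j (by simp), hτ']

theorem nodup_of_card_eq_length {α : Type} [Fintype α] {l : List α} (h : ∀ a, a ∈ l)
    (hl : l.length = Fintype.card α) : l.Nodup := by
  classical
  have h1 : (l : Multiset α).toFinset = Finset.univ := by ext; simp [h]
  rw [← Multiset.coe_nodup, ← Multiset.toFinset_card_eq_card_iff_nodup, h1]
  simp [hl]

/-- The generators `a i`, `b i`, `x j` as a disjoint union. -/
def genEquiv (g₀ m : ℕ) : Gen g₀ m ≃ Fin g₀ ⊕ Fin g₀ ⊕ Fin m where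
  toFun
    | .a i => .inl i
    | .b i => .inr (.inl i)
    | .x j => .inr (.inr j)
  invFun
    | .inl i => .a i
    | .inr (.inl i) => .b i
    | .inr (.inr j) => .x j
  left_inv x := by cases x <;> rfl
  right_inv x := by rcases x with _ | _ | _ <;> rfl

theorem mem_faces {ν : Fin (m + 1) → Q} {p : ℕ} (hν : ∀ j q, ∃ i < p, ν j ^ i = q)
    {k₀ : Q} {ks : List Q} (hk : ∀ k, k ∈ k₀ :: ks) (d : (Gen g₀ m × Q) × Bool) :
    d ∈ longFace g₀ ν k₀ ++
      (ks.map (longFace g₀ ν) ++ (List.finRange m).map (coneFace g₀ p ν)).flatten := by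
  have hlong : ∀ k, d ∈ longFace g₀ ν k → d ∈ longFace g₀ ν k₀ ++
      (ks.map (longFace g₀ ν) ++ (List.finRange m).map (coneFace g₀ p ν)).flatten := by
    intro k hd
    rw [List.mem_append, List.mem_flatten]
    rcases List.mem_cons.1 (hk k) with rfl | h
    · exact Or.inl hd
    · exact Or.inr ⟨_, List.mem_append_left _ (List.mem_map_of_mem h), hd⟩
  obtain ⟨⟨i | i | j, k⟩, b⟩ := d
  · refine hlong ((ν 0)⁻¹ * k) (List.mem_append_right _ ?_)
    exact List.mem_flatMap.2 ⟨i, by simp, by cases b <;> simp⟩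
  · refine hlong ((ν 0)⁻¹ * k) (List.mem_append_right _ ?_)
    exact List.mem_flatMap.2 ⟨i, by simp, by cases b <;> simp⟩
  · cases b
    · obtain ⟨i, hi, rfl⟩ := hν j.succ k
      rw [List.mem_append, List.mem_flatten]
      refine Or.inr ⟨coneFace g₀ p ν j, List.mem_append_right _ (List.mem_map_of_mem (by simp)), ?_⟩
      exact List.mem_map.2 ⟨i, by simpa using hi, rfl⟩
    · obtain ⟨k', hk'⟩ := exists_mem_pathWord (fun j => ν j.succ) (List.mem_finRange j) k
      exact hlong k' (List.mem_append_left _ hk')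

theorem length_faces (ν : Fin (m + 1) → Q) (p : ℕ) (k₀ : Q) (ks : List Q) :
    (longFace g₀ ν k₀ ++
      (ks.map (longFace g₀ ν) ++ (List.finRange m).map (coneFace g₀ p ν)).flatten).length =
      (ks.length + 1) * (m + 4 * g₀) + m * p := by
  have h1 : List.length ∘ longFace g₀ ν = fun _ => m + 4 * g₀ := funext (length_longFace ν)
  have h2 : List.length ∘ coneFace g₀ p ν = fun _ => p := funext (length_coneFace p ν)
  simp only [List.length_append, List.length_flatten, List.map_append, List.map_map, h1, h2,
    length_longFace, List.sum_append, List.map_const', List.sum_replicate, List.length_finRange,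
    smul_eq_mul]
  ring

theorem isSurface_faces [Fintype Q] {ν : Fin (m + 1) → Q} (hm : 0 < m)
    (hν : ∀ j q, ∃ i < Fintype.card Q, ν j ^ i = q)
    (hprod : ((List.finRange (m + 1)).map ν).prod = 1) {k₀ : Q} {ks : List Q}
    (hk : ∀ k, k ∈ k₀ :: ks) (hks : ks.length + 1 = Fintype.card Q) :
    IsSurface (longFace g₀ ν k₀)
      (ks.map (longFace g₀ ν) ++ (List.finRange m).map (coneFace g₀ (Fintype.card Q) ν)) where
  nodup := by
    let _ : Fintype (Gen g₀ m) := Fintype.ofEquiv _ (genEquiv g₀ m).symm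
    refine nodup_of_card_eq_length (mem_faces hν hk) ?_
    rw [length_faces, hks, Fintype.card_prod, Fintype.card_prod,
      Fintype.card_congr (genEquiv g₀ m)]
    simp only [Fintype.card_sum, Fintype.card_fin, Fintype.card_bool]
    ring
  opp_mem _ _ := mem_faces hν hk _
  ne_nil h := by
    simp only [List.mem_append, List.mem_map] at h
    rcases h with ⟨k, -, h⟩ | ⟨j, -, h⟩
    · have := length_longFace (g₀ := g₀) ν k
      rw [h, List.length_nil] at this
      omega
    · have := length_coneFace (g₀ := g₀) (Fintype.card Q) ν j
      rw [h, List.length_nil] at this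
      omega
  const s u h₀ hF d _ := by
    refine const_of_isPath Fintype.card_pos hν (fun j => pow_card_eq_one) hprod h₀ (fun k => ?_)
      (fun j => hF _ ?_) d
    · rcases List.mem_cons.1 (hk k) with rfl | h
      · exact ⟨u, h₀⟩
      · exact hF _ (List.mem_append_left _ (List.mem_map_of_mem h))
    · exact List.mem_append_right _ (List.mem_map_of_mem (by simp))

end Covering

section Wreath

variable {Q : Type} [CommGroup Q] {g₀ m : ℕ} {H : Type} [Group H]

/-- The assignment in the wreath product `H ≀ᵣ Q` with monodromy `ν` and labels `h`. -/
def wreathGen (ν : Fin (m + 1) → Q) (h : Gen g₀ m × Q → H) : Gen g₀ (m + 1) → H ≀ᵣ Q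
  | .a i => ⟨fun k => h (.a i, k), 1⟩
  | .b i => ⟨fun k => h (.b i, k), 1⟩
  | .x j => ⟨fun k => Fin.cases 1 (fun i => h (.x i, k)) j, ν j⟩

theorem map_prod_wreathGen_x (ν : Fin (m + 1) → Q) (h : Gen g₀ m × Q → H) (l : List (Fin m)) :
    (l.map fun j => wreathGen ν h (.x j.succ)).prod =
      ⟨fun k => wordVal h (pathWord g₀ (fun j => ν j.succ) l k),
        (l.map fun j => ν j.succ).prod⟩ := by
  induction l with
  | nil => rfl
  | cons j l ih =>
    rw [List.map_cons, List.prod_cons, ih]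
    rfl

theorem map_prod_wreathGen_comm (ν : Fin (m + 1) → Q) (h : Gen g₀ m × Q → H)
    (l : List (Fin g₀)) :
    (l.map fun i => wreathGen ν h (.a i) * wreathGen ν h (.b i) * (wreathGen ν h (.a i))⁻¹ *
      (wreathGen ν h (.b i))⁻¹).prod = ⟨fun k => wordVal h (commWord m l k), 1⟩ := by
  induction l with
  | nil => rfl
  | cons i l ih =>
    rw [List.map_cons, List.prod_cons, ih]
    ext k
    · simp [wreathGen, commWord, letterVal, mul_assoc]
    · simp [wreathGen]

theorem lift_wreathGen_longRel {ν : Fin (m + 1) → Q}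
    (hprod : ((List.finRange (m + 1)).map ν).prod = 1) (h : Gen g₀ m × Q → H) :
    FreeGroup.lift (wreathGen ν h) (longRel g₀ (m + 1)) =
      ⟨fun k => wordVal h (longFace g₀ ν ((ν 0)⁻¹ * k)), 1⟩ := by
  have h1 : FreeGroup.lift (wreathGen ν h) (longRel g₀ (m + 1)) =
      wreathGen ν h (.x 0) * ((List.finRange m).map fun j => wreathGen ν h (.x j.succ)).prod *
      ((List.finRange g₀).map fun i => wreathGen ν h (.a i) * wreathGen ν h (.b i) *
        (wreathGen ν h (.a i))⁻¹ * (wreathGen ν h (.b i))⁻¹).prod := by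
    simp [longRel, map_list_prod, List.finRange_succ, Function.comp_def]
  rw [h1, map_prod_wreathGen_x, map_prod_wreathGen_comm]
  rw [List.finRange_succ, List.map_cons, List.prod_cons, List.map_map] at hprod
  ext k
  · have h2 : (ν 0 * (List.map (fun j => ν j.succ) (List.finRange m)).prod)⁻¹ * k = k := by
      rw [show ν 0 * (List.map (fun j => ν j.succ) (List.finRange m)).prod = 1 from hprod]
      simp
    simp only [RegularWreathProduct.mul_left, RegularWreathProduct.mul_right, Pi.mul_apply]
    simp only [wreathGen, h2, longFace, wordVal_append, mul_inv_cancel_left, Fin.cases_zero,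
      one_mul]
  · simpa [wreathGen, Function.comp_def] using hprod

theorem wordVal_coneFace_mul (ν : Fin (m + 1) → Q) (h : Gen g₀ m × Q → H) (j : Fin m) (n : ℕ) :
    wordVal h (coneFace g₀ n ν j) *
      (wreathGen ν h (.x j.succ) ^ n).left ((ν j.succ)⁻¹ * ν j.succ ^ n) = 1 := by
  induction n with
  | zero => simp [coneFace]
  | succ n ih =>
    rw [coneFace, List.range_succ, List.map_append, wordVal_append, pow_succ' (wreathGen _ _ _),
      pow_succ' (ν _), inv_mul_cancel_left, RegularWreathProduct.mul_left]
    simpa [wreathGen, coneFace, letterVal, mul_assoc] using ih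

theorem left_pow_eq_one {y : H ≀ᵣ Q} {p : ℕ} (hp : y.right ^ p = 1)
    (hy : ∀ q, ∃ i < p, y.right ^ i = q) {k₀ : Q} (h : (y ^ p).left k₀ = 1) (k : Q) :
    (y ^ p).left k = 1 := by
  have hr : (y ^ p).right = 1 := by
    rw [← hp]
    exact map_pow RegularWreathProduct.rightHom y p
  have h1 : ∀ k, (y ^ p).left k = 1 → (y ^ p).left (y.right * k) = 1 := fun k hk => by
    have h2 := congrFun (congrArg RegularWreathProduct.left
      ((pow_succ y p).symm.trans (pow_succ' y p))) (y.right * k)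
    simpa [hr, hk] using h2
  obtain ⟨i, -, hi⟩ := hy (k * k₀⁻¹)
  rw [← inv_mul_cancel_right k k₀, ← hi]
  clear hi
  induction i with
  | zero => simpa using h
  | succ i ih =>
    rw [pow_succ', mul_assoc]
    exact h1 _ ih

theorem lift_wreathGen_fuchsRels [Fintype Q] {ν : Fin (m + 1) → Q}
    (hν : ∀ j q, ∃ i < Fintype.card Q, ν j ^ i = q)
    (hprod : ((List.finRange (m + 1)).map ν).prod = 1) (h : Gen g₀ m × Q → H) :
    (∀ r ∈ fuchsRels (Fintype.card Q) g₀ (m + 1), FreeGroup.lift (wreathGen ν h) r = 1) ↔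
      (∀ k, wordVal h (longFace g₀ ν k) = 1) ∧
        ∀ j, wordVal h (coneFace g₀ (Fintype.card Q) ν j) = 1 := by
  have hcone : ∀ j : Fin m, wordVal h (coneFace g₀ (Fintype.card Q) ν j) = 1 ↔
      (wreathGen ν h (.x j.succ) ^ Fintype.card Q).left (ν j.succ)⁻¹ = 1 := fun j => by
    have := wordVal_coneFace_mul ν h j (Fintype.card Q)
    rw [pow_card_eq_one, mul_one] at this
    rw [mul_eq_one_iff_eq_inv.1 this, inv_eq_one]
  constructor
  · intro hr
    constructor
    · intro k
      have h1 := hr _ (Or.inl rfl)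
      rw [lift_wreathGen_longRel hprod] at h1
      have h2 := congrFun (congrArg RegularWreathProduct.left h1) (ν 0 * k)
      simpa using h2
    · intro j
      have h1 := hr _ (Or.inr ⟨j.succ, rfl⟩)
      rw [map_pow, FreeGroup.lift_apply_of] at h1
      rw [hcone, h1]
      rfl
  · rintro ⟨hl, hc⟩ r (rfl | ⟨j, rfl⟩)
    · rw [lift_wreathGen_longRel hprod]
      simp only [hl]
      rfl
    · rw [map_pow, FreeGroup.lift_apply_of]
      refine Fin.cases ?_ (fun j => ?_) j
      · have : wreathGen ν h (.x 0) = RegularWreathProduct.inl (ν 0) := rfl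
        rw [this, ← map_pow, pow_card_eq_one, map_one]
      · ext k
        · exact left_pow_eq_one (y := wreathGen ν h (.x j.succ)) pow_card_eq_one (hν j.succ)
            ((hcone j).1 (hc j)) k
        · exact (map_pow RegularWreathProduct.rightHom _ _).trans pow_card_eq_one

section Kernel

variable {F₀ : Type} [Group F₀]

/-- The embedding of `F₀` in the wreath product of `ker φ` and `Q` given by a section of `φ`. -/
def kerWreath (φ : F₀ →* Q) (σ : Q →* F₀) (hσ : ∀ q, φ (σ q) = q) : F₀ →* φ.ker ≀ᵣ Q where
  toFun ω := ⟨fun k => ⟨(σ k)⁻¹ * ω * σ ((φ ω)⁻¹ * k), by simp [MonoidHom.mem_ker, hσ]⟩, φ ω⟩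
  map_one' := by ext <;> simp
  map_mul' ω ω' := by ext <;> simp [mul_assoc]

theorem kerWreath_left_one (φ : F₀ →* Q) (σ : Q →* F₀) (hσ : ∀ q, φ (σ q) = q) (ω : φ.ker) :
    (kerWreath φ σ hσ ω).left 1 = ω := by
  have := MonoidHom.mem_ker.1 ω.2
  ext
  simp [kerWreath, this]

theorem left_mem_of_mem_closure {S : Set (H ≀ᵣ Q)} {K : Subgroup H}
    (hS : ∀ y ∈ S, ∀ k, y.left k ∈ K) {y : H ≀ᵣ Q} (hy : y ∈ Subgroup.closure S) (k : Q) :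
    y.left k ∈ K := by
  induction hy using Subgroup.closure_induction generalizing k with
  | mem y hy => exact hS y hy k
  | one => exact K.one_mem
  | mul y z _ _ hy hz => exact K.mul_mem (hy _) (hz _)
  | inv y _ hy => exact K.inv_mem (hy _)

/-- The coordinate at `1` of a homomorphism over `Q` to a wreath product, restricted to the
kernel of the projection to `Q`. -/
def kerProj {φ : F₀ →* Q} (ρ : F₀ →* H ≀ᵣ Q) (hρ : ∀ ω, (ρ ω).right = φ ω) : φ.ker →* H where
  toFun ω := (ρ ω).left 1
  map_one' := by simp
  map_mul' ω ω' := by simp [hρ, MonoidHom.mem_ker.1 ω.2]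

end Kernel

theorem exists_hom_apply_eq [Fintype Q] {ν : Q} (hν : ∀ q, ∃ i < Fintype.card Q, ν ^ i = q)
    {F₀ : Type} [Group F₀] {x : F₀} (hx : x ^ Fintype.card Q = 1) :
    ∃ σ : Q →* F₀, σ ν = x := by
  have h1 : ∀ q, q ∈ Subgroup.zpowers ν := fun q => by
    obtain ⟨i, -, rfl⟩ := hν q
    exact Subgroup.npow_mem_zpowers ν i
  have h2 : orderOf x ∣ orderOf ν := by
    rw [orderOf_eq_card_of_forall_mem_zpowers h1, Nat.card_eq_fintype_card]
    exact orderOf_dvd_of_pow_eq_one hx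
  exact ⟨monoidHomOfForallMemZpowers h1 h2, monoidHomOfForallMemZpowers_apply_gen h1 h2⟩

theorem exists_presents_ker [Fintype Q] {ν : Fin (m + 1) → Q}
    (hν : ∀ j q, ∃ i < Fintype.card Q, ν j ^ i = q)
    (hprod : ((List.finRange (m + 1)).map ν).prod = 1)
    (φ : Fzero (Fintype.card Q) g₀ (m + 1) →* Q)
    (hφa : ∀ i, φ (.of (.a i)) = 1) (hφb : ∀ i, φ (.of (.b i)) = 1)
    (hφx : ∀ j, φ (.of (.x j)) = ν j) {k₀ : Q} {ks : List Q} (hk : ∀ k, k ∈ k₀ :: ks) :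
    ∃ f : Gen g₀ m × Q → φ.ker, Presents f (FaceSat (longFace g₀ ν k₀)
      (ks.map (longFace g₀ ν) ++ (List.finRange m).map (coneFace g₀ (Fintype.card Q) ν))) := by
  have hx0 : (PresentedGroup.of (.x 0) : Fzero (Fintype.card Q) g₀ (m + 1)) ^ Fintype.card Q = 1 :=
    PresentedGroup.one_of_mem (Or.inr ⟨0, rfl⟩)
  obtain ⟨σ, hσ0⟩ := exists_hom_apply_eq (hν 0) hx0
  have hσ : ∀ q, φ (σ q) = q := fun q => by
    obtain ⟨i, -, rfl⟩ := hν 0 q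
    rw [map_pow, map_pow, hσ0, hφx]
  have hface : ∀ (K : Type) [Group K] (h : Gen g₀ m × Q → K), FaceSat (longFace g₀ ν k₀)
      (ks.map (longFace g₀ ν) ++ (List.finRange m).map (coneFace g₀ (Fintype.card Q) ν)) K h ↔
      ∀ r ∈ fuchsRels (Fintype.card Q) g₀ (m + 1), FreeGroup.lift (wreathGen ν h) r = 1 := by
    intro K _ h
    rw [lift_wreathGen_fuchsRels hν hprod]
    constructor
    · rintro ⟨h1, h2, -⟩
      refine ⟨fun k => ?_, fun j => h2 _ (List.mem_append_right _ (List.mem_map_of_mem (by simp)))⟩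
      rcases List.mem_cons.1 (hk k) with rfl | hk
      · exact h1
      · exact h2 _ (List.mem_append_left _ (List.mem_map_of_mem hk))
    · rintro ⟨h1, h2⟩
      refine ⟨h1 k₀, fun F hF => ?_, fun x hx => absurd (mem_faces hν hk _) hx⟩
      rcases List.mem_append.1 hF with hF | hF
      · obtain ⟨k, -, rfl⟩ := List.mem_map.1 hF
        exact h1 k
      · obtain ⟨j, -, rfl⟩ := List.mem_map.1 hF
        exact h2 j
  let R := kerWreath φ σ hσ
  let f : Gen g₀ m × Q → φ.ker := fun d => match d with
    | (.a i, k) => (R (.of (.a i))).left k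
    | (.b i, k) => (R (.of (.b i))).left k
    | (.x j, k) => (R (.of (.x j.succ))).left k
  have hR : ∀ d, R (.of d) = wreathGen ν f d := by
    rintro (i | i | j)
    · exact RegularWreathProduct.ext rfl (hφa i)
    · exact RegularWreathProduct.ext rfl (hφb i)
    · refine RegularWreathProduct.ext (funext fun k => ?_) (hφx j)
      refine Fin.cases ?_ (fun j => rfl) j
      ext
      simp [R, kerWreath, wreathGen, hφx, hσ0]
  have hf : ∀ r, FreeGroup.lift (wreathGen ν f) r = R (PresentedGroup.mk _ r) := fun r => by
    have : FreeGroup.lift (wreathGen ν f) = R.comp (PresentedGroup.mk _) := by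
      ext d : 1
      exact FreeGroup.lift_apply_of.trans (hR d).symm
    rw [this]
    rfl
  refine ⟨f, (hface _ f).2 fun r hr => by rw [hf, PresentedGroup.one_of_mem hr, map_one],
    ?_, fun K _ h hh => ?_⟩
  · rw [eq_top_iff]
    intro ω _
    rw [← kerWreath_left_one φ σ hσ ω]
    refine left_mem_of_mem_closure (S := Set.range (wreathGen ν f)) ?_ ?_ 1
    · rintro _ ⟨i | i | j, rfl⟩ k
      · exact Subgroup.subset_closure ⟨(.a i, k), rfl⟩
      · exact Subgroup.subset_closure ⟨(.b i, k), rfl⟩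
      · refine Fin.cases (Subgroup.one_mem _) (fun j => ?_) j
        exact Subgroup.subset_closure ⟨(.x j, k), rfl⟩
    · obtain ⟨r, hr⟩ := PresentedGroup.mk_surjective _ (ω : Fzero (Fintype.card Q) g₀ (m + 1))
      rw [← hr]
      change R _ ∈ _
      rw [← hf, ← FreeGroup.range_lift_eq_closure]
      exact ⟨r, rfl⟩
  · let ρ := PresentedGroup.toGroup ((hface K h).1 hh)
    have hρ : ∀ d, ρ (.of d) = wreathGen ν h d := fun d => PresentedGroup.toGroup.of _
    have hρφ : ∀ ω, (ρ ω).right = φ ω := fun ω => by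
      have : RegularWreathProduct.rightHom.comp ρ = φ := by
        refine PresentedGroup.ext ?_
        rintro (i | i | j)
        · simp [hρ, wreathGen, hφa]
        · simp [hρ, wreathGen, hφb]
        · simp [hρ, wreathGen, hφx]
      rw [← this]
      rfl
    have hρσ : ∀ q, ρ (σ q) = RegularWreathProduct.inl q := fun q => by
      obtain ⟨i, -, rfl⟩ := hν 0 q
      rw [map_pow, map_pow, map_pow, hσ0, hρ]
      rfl
    have hρR : ∀ ω k, (ρ ((R ω).left k)).left 1 = (ρ ω).left k := fun ω k => by
      simp [R, kerWreath, hρσ, hρφ]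
    refine ⟨kerProj ρ hρφ, ?_⟩
    rintro ⟨i | i | j, k⟩
    · exact (hρR _ k).trans (by rw [hρ]; rfl)
    · exact (hρR _ k).trans (by rw [hρ]; rfl)
    · exact (hρR _ k).trans (by rw [hρ]; rfl)

end Wreath

theorem ker_nonempty_equiv_surfaceGroup {Q : Type} [CommGroup Q] [Fintype Q] {p g₀ m : ℕ}
    (hQ : Fintype.card Q = p) (hm : 0 < m) {ν : Fin (m + 1) → Q}
    (hν : ∀ j q, ∃ i < p, ν j ^ i = q) (φ : Fzero p g₀ (m + 1) →* Q)
    (hφa : ∀ i, φ (.of (.a i)) = 1) (hφb : ∀ i, φ (.of (.b i)) = 1)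
    (hφx : ∀ j, φ (.of (.x j)) = ν j) (g : ℕ)
    (hg : 2 * g = 2 * p * g₀ + (p - 1) * (m - 1)) :
    Nonempty (φ.ker ≃* SurfaceGroup g) := by
  subst hQ
  have hprod : ((List.finRange (m + 1)).map ν).prod = 1 := by
    have h1 : φ (PresentedGroup.mk _ (longRel g₀ (m + 1))) = 1 := by
      rw [PresentedGroup.one_of_mem (Or.inl rfl), map_one]
    have hof : ∀ d, φ (PresentedGroup.mk _ (FreeGroup.of d)) = φ (.of d) := fun d => rfl
    simpa [longRel, map_list_prod, Function.comp_def, hof, hφa, hφb, hφx] using h1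
  obtain ⟨k₀, ks, hks⟩ : ∃ k₀ ks, (Finset.univ : Finset Q).toList = k₀ :: ks :=
    List.exists_cons_of_ne_nil (by simp [Finset.univ_nonempty.ne_empty])
  have hk : ∀ k, k ∈ k₀ :: ks := fun k => by simp [← hks]
  have hcard : ks.length + 1 = Fintype.card Q := by
    rw [← List.length_cons (a := k₀), ← hks, Finset.length_toList, Finset.card_univ]
  obtain ⟨f, hf⟩ := exists_presents_ker hν hprod φ hφa hφb hφx hk
  refine hf.nonempty_equiv_surfaceGroup (isSurface_faces hm hν hprod hk hcard) g ?_
  rw [length_faces]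
  obtain ⟨m, rfl⟩ := Nat.exists_eq_succ_of_ne_zero hm.ne'
  rw [← hcard] at hg ⊢
  simp only [List.length_append, List.length_map, List.length_finRange, Nat.succ_eq_add_one,
    Nat.add_sub_cancel] at hg ⊢
  linarith

theorem exists_pow_eq_of_prime_card {Q : Type} [Group Q] [Fintype Q] {p : ℕ} [Fact p.Prime]
    (hQ : Fintype.card Q = p) {ν : Q} (hν : ν ≠ 1) (q : Q) : ∃ i < p, ν ^ i = q := by
  obtain ⟨i, rfl⟩ := mem_powers_of_prime_card (p := p) (g' := q)
    (Nat.card_eq_fintype_card.trans hQ) hν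
  subst hQ
  exact ⟨i % Fintype.card Q, Nat.mod_lt _ Fintype.card_pos, pow_mod_card ν i⟩

/-- `F = ker φ` is isomorphic to the surface group of genus `g`,
where `2g = 2pg₀ + (p−1)(t−2)`. -/
theorem kernel_is_surface_group (p g₀ t : ℕ) (hp : p.Prime) (ht : 2 ≤ t)
    (n : Fin t → ℕ) (hn : ∀ j, 0 < n j ∧ n j < p)
    (hsum : (∑ j, (n j : ZMod p)) = 0)
    (φ : Fzero p g₀ t →* Multiplicative (ZMod p))
    (hφa : ∀ i : Fin g₀, φ (PresentedGroup.of (Gen.a i)) = 1)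
    (hφb : ∀ i : Fin g₀, φ (PresentedGroup.of (Gen.b i)) = 1)
    (hφx : ∀ j : Fin t,
      φ (PresentedGroup.of (Gen.x j)) = Multiplicative.ofAdd ((n j : ZMod p)))
    (g : ℕ) (hg : 2 * g = 2 * p * g₀ + (p - 1) * (t - 2)) :
    Nonempty (φ.ker ≃* SurfaceGroup g) := by
  obtain ⟨m, rfl⟩ := Nat.exists_eq_add_of_le' (one_le_two.trans ht)
  have : Fact p.Prime := ⟨hp⟩
  have hν : ∀ j, Multiplicative.ofAdd (n j : ZMod p) ≠ 1 := fun j h => by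
    have h1 := (ZMod.natCast_eq_zero_iff (n j) p).1 (ofAdd_eq_one.1 h)
    exact absurd (Nat.le_of_dvd (hn j).1 h1) (hn j).2.not_ge
  have hQ : Fintype.card (Multiplicative (ZMod p)) = p := by simp [ZMod.card]
  exact ker_nonempty_equiv_surfaceGroup hQ (by omega)
    (fun j => exists_pow_eq_of_prime_card hQ (hν j)) φ hφa hφb hφx g hg
end

section
/- Let p be a prime and g₀ ≥ 2 an integer. Let F₀ be the surface group of genus g₀ with presentation ⟨a₁,…,a_{g₀}, b₁,…,b_{g₀} ∣ [a₁,b₁]⋯[a_{g₀},b_{g₀}] = 1⟩ and let φ : F₀ → ℤ/pℤ be the homomorphism with φ(a₁) = 1 and φ(a_i) = 0 for i ≥ 2, φ(b_i) = 0 for all i. Let F = ker φ, with the ℤ[ℤ/pℤ]-module structure on F^{ab} induced by conjugation by a₁. Then F^{ab} is isomorphic as a ℤ[ℤ/pℤ]-module to (ℤ[ℤ/pℤ])^{2(g₀−1)} ⊕ ℤ², where ℤ/pℤ acts trivially on the ℤ² summand; in particular there exist elements α, β of F whose classes in F^{ab} are fixed by the induced action of conjugation by a₁. -/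
section ConjugationOnAbelianization

theorem end_mul_apply {A : Type*} [AddZeroClass A] (f g : AddMonoid.End A) (x : A) :
    (f * g) x = f (g x) := rfl

theorem end_add_apply {A : Type*} [AddCommMonoid A] (f g : AddMonoid.End A) (x : A) :
    (f + g) x = f x + g x := rfl

theorem end_zsmul_apply {A : Type*} [AddCommGroup A] (k : ℤ) (f : AddMonoid.End A) (x : A) :
    (k • f) x = k • f x := rfl

variable {G Q : Type*} [Group G] [Group Q]

/-- The class of an element of a subgroup in the additively written abelianization. -/
def abClass (N : Subgroup G) (x : N) : Additive (Abelianization N) :=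
  Additive.ofMul (Abelianization.of x)

theorem abClass_mul (N : Subgroup G) (x y : N) :
    abClass N (x * y) = abClass N x + abClass N y := by
  simp [abClass]

theorem abClass_one (N : Subgroup G) : abClass N 1 = 0 := by
  simp [abClass]

theorem abClass_inv (N : Subgroup G) (x : N) : abClass N x⁻¹ = -abClass N x := by
  simp [abClass]

theorem abClass_zpow (N : Subgroup G) (x : N) (k : ℤ) :
    abClass N (x ^ k) = k • abClass N x := by
  simp [abClass]

theorem abClass_surjective (N : Subgroup G) : Function.Surjective (abClass N) := fun y => by
  obtain ⟨x, hx⟩ := QuotientGroup.mk_surjective y.toMul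
  exact ⟨x, congrArg Additive.ofMul hx⟩

/-- The action of `G` on the abelianization of a normal subgroup induced by conjugation. -/
def conjAb (N : Subgroup G) [N.Normal] : G →* AddMonoid.End (Additive (Abelianization N)) where
  toFun g := MonoidHom.toAdditive
    (Abelianization.map ((MulAut.conjNormal g : MulAut N)).toMonoidHom)
  map_one' := by
    ext y
    obtain ⟨x, rfl⟩ := abClass_surjective N y
    rw [map_one]
    rfl
  map_mul' g h := by
    ext y
    obtain ⟨x, rfl⟩ := abClass_surjective N y
    rw [map_mul]
    rfl

theorem conjAb_abClass (N : Subgroup G) [N.Normal] (g : G) (x : N) :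
    conjAb N g (abClass N x) = abClass N (MulAut.conjNormal g x) := rfl

theorem conjAb_of_mem (N : Subgroup G) [N.Normal] (g : N) : conjAb N (g : G) = 1 := by
  ext y
  obtain ⟨x, rfl⟩ := abClass_surjective N y
  rw [conjAb_abClass, MulAut.conjNormal_val, MulAut.conj_apply, abClass_mul, abClass_mul,
    abClass_inv]
  simp

/-- For a surjection `φ : G → Q`, the conjugation action of `Q` on `(ker φ)^{ab}`. -/
noncomputable def quotientConjAb (φ : G →* Q) (hφ : Function.Surjective φ) :
    Q →* AddMonoid.End (Additive (Abelianization φ.ker)) :=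
  (Units.coeHom _).comp (φ.liftOfSurjective hφ ⟨(conjAb φ.ker).toHomUnits, fun g hg => by
    rw [MonoidHom.ker_toHomUnits]
    exact conjAb_of_mem φ.ker ⟨g, hg⟩⟩)

theorem quotientConjAb_apply (φ : G →* Q) (hφ : Function.Surjective φ) (g : G) :
    quotientConjAb φ hφ (φ g) = conjAb φ.ker g := by
  simp [quotientConjAb, MonoidHom.liftOfRightInverse_comp_apply]

end ConjugationOnAbelianization

namespace SurfaceGroup

open scoped commutatorElement

variable {n p : ℕ}

/-- The module `ℤ[ℤ/p]^{2n} ⊕ ℤ²`, the free part being indexed by the generators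
`c i`, `d i` with `i ≠ 0`. -/
abbrev Model (n p : ℕ) : Type := (Fin n ⊕ Fin n → GrpRing p) × (ℤ × ℤ)

/-- The action of `ℤ/p` on `Model n p`. -/
noncomputable def shift : Multiplicative (ZMod p) →* AddMonoid.End (Model n p) where
  toFun k :=
    { toFun := fun v => (fun i => AddMonoidAlgebra.single k.toAdd (1 : ℤ) * v.1 i, v.2)
      map_zero' := by ext <;> simp
      map_add' := fun v w => by ext <;> simp [mul_add] }
  map_one' := by
    ext v : 1
    change (_, _) = v
    simp [← AddMonoidAlgebra.one_def]
  map_mul' k l := by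
    ext v : 1
    change (_, _) = (_, _)
    simp [← mul_assoc, AddMonoidAlgebra.single_mul_single]

theorem shift_apply (k : Multiplicative (ZMod p)) (v : Model n p) :
    shift k v = (fun i => AddMonoidAlgebra.single k.toAdd (1 : ℤ) * v.1 i, v.2) := rfl

/-- The permutation of `Model n p` by which the generator `c 0` acts: the shift followed by a
translation along the first copy of `ℤ`. -/
noncomputable def screw (n p : ℕ) : Equiv.Perm (Model n p) where
  toFun v := shift (Multiplicative.ofAdd 1) v + (0, (1, 0))
  invFun v := shift (Multiplicative.ofAdd 1)⁻¹ (v - (0, (1, 0)))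
  left_inv v := by
    beta_reduce
    rw [add_sub_cancel_right, ← end_mul_apply, ← map_mul]
    simp
  right_inv v := by
    beta_reduce
    rw [← end_mul_apply, ← map_mul]
    simp

theorem screw_apply (v : Model n p) :
    screw n p v = shift (Multiplicative.ofAdd 1) v + (0, (1, 0)) := rfl

/-- The affine action of the generators on `Model n p`. -/
noncomputable def affineGen (n p : ℕ) : SGen (n + 1) → Equiv.Perm (Model n p)
  | .c i => Fin.cases (screw n p) (fun j => Equiv.addRight (Pi.single (.inl j) 1, 0)) i
  | .d i => Fin.cases (Equiv.addRight (0, (0, 1)))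
      (fun j => Equiv.addRight (Pi.single (.inr j) 1, 0)) i

theorem commute_affineGen (i : Fin (n + 1)) :
    Commute (affineGen n p (.c i)) (affineGen n p (.d i)) := by
  refine Fin.cases ?_ (fun j => ?_) i <;> ext1 v
  · simp [affineGen, screw_apply, add_right_comm, shift_apply]
  · simp [affineGen, add_right_comm]

theorem lift_surfaceRel_of_commute {g : ℕ} {H : Type*} [Group H] (f : SGen g → H)
    (hf : ∀ i, Commute (f (.c i)) (f (.d i))) : FreeGroup.lift f (surfaceRel g) = 1 := by
  rw [surfaceRel, map_list_prod, List.map_map]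
  refine List.prod_eq_one fun x hx => ?_
  obtain ⟨i, -, rfl⟩ := List.mem_map.1 hx
  simp [(hf i).eq]

/-- The affine action of the surface group on `Model n p`. -/
noncomputable def affine (n p : ℕ) : SurfaceGroup (n + 1) →* Equiv.Perm (Model n p) :=
  PresentedGroup.toGroup (f := affineGen n p) fun r hr => by
    rw [Set.mem_singleton_iff.1 hr]
    exact lift_surfaceRel_of_commute _ commute_affineGen

/-- The generator `c i`. -/
abbrev cGen (i : Fin (n + 1)) : SurfaceGroup (n + 1) := PresentedGroup.of (.c i)

/-- The generator `d i`. -/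
abbrev dGen (i : Fin (n + 1)) : SurfaceGroup (n + 1) := PresentedGroup.of (.d i)

theorem affine_of (x : SGen (n + 1)) : affine n p (PresentedGroup.of x) = affineGen n p x :=
  PresentedGroup.toGroup.of _

/-- The homomorphism to `ℤ/p` sends `c 0` to `1` and all other generators to `0`. -/
structure IsStandard (φ : SurfaceGroup (n + 1) →* Multiplicative (ZMod p)) : Prop where
  c_zero : φ (cGen 0) = Multiplicative.ofAdd 1
  c_succ : ∀ i : Fin n, φ (cGen i.succ) = 1
  d : ∀ i, φ (dGen i) = 1

namespace IsStandard

variable {φ : SurfaceGroup (n + 1) →* Multiplicative (ZMod p)}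

theorem map_zpow (h : IsStandard φ) (k : ℤ) :
    φ (cGen 0 ^ k) = Multiplicative.ofAdd (k : ZMod p) := by
  rw [_root_.map_zpow, h.c_zero, ← ofAdd_zsmul, zsmul_one]

theorem surjective (h : IsStandard φ) : Function.Surjective φ := fun k => by
  obtain ⟨m, hm⟩ := ZMod.intCast_surjective k.toAdd
  exact ⟨_, (h.map_zpow m).trans (congrArg Multiplicative.ofAdd hm)⟩

theorem affine_add (h : IsStandard φ) (g : SurfaceGroup (n + 1)) (v w : Model n p) :
    affine n p g (v + w) = affine n p g v + shift (φ g) w := by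
  have hg : g ∈ Subgroup.closure (Set.range (PresentedGroup.of (rels := {surfaceRel (n + 1)}))) :=
    PresentedGroup.closure_range_of _ ▸ Subgroup.mem_top g
  induction hg using Subgroup.closure_induction generalizing v w with
  | mem x hx =>
    obtain ⟨x, rfl⟩ := hx
    rw [affine_of]
    match x with
    | .c i =>
      refine Fin.cases ?_ (fun j => ?_) i
      · rw [h.c_zero]
        simp [affineGen, screw_apply, add_right_comm]
      · rw [h.c_succ]
        simp [affineGen, add_right_comm]
    | .d i =>
      rw [h.d]
      refine Fin.cases ?_ (fun j => ?_) i <;> simp [affineGen, add_right_comm]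
  | one => simp
  | mul x y _ _ hx hy => simp [hx, hy]
  | inv x _ hx =>
    rw [map_inv, Equiv.Perm.inv_eq_iff_eq, hx, ← end_mul_apply, ← map_mul, ← map_mul]
    simp

theorem affine_of_mem (h : IsStandard φ) (g : φ.ker) (v : Model n p) :
    affine n p g v = affine n p g 0 + v := by
  have := h.affine_add g 0 v
  rwa [MonoidHom.mem_ker.1 g.2, map_one, zero_add] at this

/-- The homomorphism sending the class of an element of the kernel to the vector by which it
translates `Model n p`. -/
noncomputable def translation (h : IsStandard φ) :
    Additive (Abelianization φ.ker) →+ Model n p :=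
  MonoidHom.toAdditiveLeft (Abelianization.lift
    { toFun := fun g => Multiplicative.ofAdd (affine n p g 0)
      map_one' := by simp
      map_mul' := fun g g' => by
        rw [← ofAdd_add, Subgroup.coe_mul, map_mul, Equiv.Perm.mul_apply, h.affine_of_mem] })

theorem translation_abClass (h : IsStandard φ) (g : φ.ker) :
    h.translation (abClass φ.ker g) = affine n p g 0 := rfl

theorem translation_conjAb (h : IsStandard φ) (g : SurfaceGroup (n + 1))
    (y : Additive (Abelianization φ.ker)) :
    h.translation (conjAb φ.ker g y) = shift (φ g) (h.translation y) := by
  obtain ⟨x, rfl⟩ := abClass_surjective _ y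
  rw [conjAb_abClass, translation_abClass, translation_abClass, MulAut.conjNormal_apply, map_mul,
    map_mul, Equiv.Perm.mul_apply, Equiv.Perm.mul_apply, h.affine_of_mem,
    add_comm (affine n p _ 0), h.affine_add,
    ← Equiv.Perm.mul_apply, ← map_mul]
  simp

/-- The action of `ℤ[ℤ/p]` on the abelianization of the kernel. -/
noncomputable def ringAction (h : IsStandard φ) :
    GrpRing p →ₐ[ℤ] AddMonoid.End (Additive (Abelianization φ.ker)) :=
  AddMonoidAlgebra.lift ℤ _ _ (quotientConjAb φ h.surjective)

theorem ringAction_single (h : IsStandard φ) (g : SurfaceGroup (n + 1)) :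
    h.ringAction (AddMonoidAlgebra.single (φ g).toAdd 1) = conjAb φ.ker g := by
  rw [ringAction, AddMonoidAlgebra.lift_single, one_smul, ofAdd_toAdd, quotientConjAb_apply]

theorem translation_ringAction (h : IsStandard φ) (r : GrpRing p)
    (y : Additive (Abelianization φ.ker)) (hy : (h.translation y).2 = 0) :
    h.translation (h.ringAction r y) = (fun i => r * (h.translation y).1 i, 0) := by
  induction r using AddMonoidAlgebra.induction_on with
  | of k =>
    obtain ⟨g, rfl⟩ := h.surjective k
    change h.translation (h.ringAction (AddMonoidAlgebra.single (φ g).toAdd 1) y) = _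
    rw [ringAction_single, translation_conjAb, shift_apply, hy]
    rfl
  | add r s hr hs =>
    rw [map_add, end_add_apply, map_add, hr, hs]
    simp [add_mul, Pi.add_def]
  | smul m r hr =>
    rw [map_zsmul, end_zsmul_apply, map_zsmul, hr]
    simp [Pi.smul_def, mul_assoc]

/-- The generators `c i`, `d i` with `i ≠ 0`, as elements of the kernel. -/
def freeGen (h : IsStandard φ) : Fin n ⊕ Fin n → φ.ker
  | .inl i => ⟨cGen i.succ, h.c_succ i⟩
  | .inr i => ⟨dGen i.succ, h.d i.succ⟩

/-- The element `c 0 ^ p` of the kernel. -/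
def alpha (h : IsStandard φ) : φ.ker :=
  ⟨cGen 0 ^ (p : ℤ), by simpa using h.map_zpow p⟩

/-- The generator `d 0`, as an element of the kernel. -/
def beta (h : IsStandard φ) : φ.ker := ⟨dGen 0, h.d 0⟩

theorem conjAb_alpha (h : IsStandard φ) :
    conjAb φ.ker (cGen 0) (abClass φ.ker h.alpha) = abClass φ.ker h.alpha := by
  rw [conjAb_abClass]
  congr 1
  ext1
  rw [MulAut.conjNormal_apply, mul_inv_eq_iff_eq_mul]
  exact ((Commute.refl (cGen 0)).zpow_right _).eq

theorem cGen_dGen_relation (n : ℕ) :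
    cGen 0 * dGen 0 * (cGen 0)⁻¹ * (dGen 0)⁻¹ *
      ((List.finRange n).map fun i : Fin n => ⁅cGen i.succ, dGen i.succ⁆).prod = 1 := by
  have hrel : surfaceRel (n + 1) =
      FreeGroup.of (.c 0) * FreeGroup.of (.d 0) * (FreeGroup.of (.c 0))⁻¹ *
        (FreeGroup.of (.d 0))⁻¹ *
      ((List.finRange n).map fun i : Fin n =>
        ⁅FreeGroup.of (SGen.c i.succ), FreeGroup.of (SGen.d i.succ)⁆).prod := by
    rw [surfaceRel, List.finRange_succ, List.map_cons, List.prod_cons, List.map_map]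
    rfl
  have := (congrArg (PresentedGroup.mk {surfaceRel (n + 1)}) hrel).symm.trans
    (PresentedGroup.one_of_mem (Set.mem_singleton _))
  rw [map_mul, map_list_prod, List.map_map] at this
  exact this

theorem conjAb_beta (h : IsStandard φ) :
    conjAb φ.ker (cGen 0) (abClass φ.ker h.beta) = abClass φ.ker h.beta := by
  set q : φ.ker :=
    ((List.finRange n).map fun i : Fin n => ⁅h.freeGen (.inl i), h.freeGen (.inr i)⁆).prod with hq
  have hq_one : Abelianization.of q = 1 := by
    rw [hq, map_list_prod, List.map_map]
    refine List.prod_eq_one fun x hx => ?_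
    obtain ⟨i, -, rfl⟩ := List.mem_map.1 hx
    rw [Function.comp_apply, map_commutatorElement, commutatorElement_eq_one_iff_mul_comm, mul_comm]
  have hq_coe : (q : SurfaceGroup (n + 1)) =
      ((List.finRange n).map fun i : Fin n => ⁅cGen i.succ, dGen i.succ⁆).prod := by
    rw [hq, ← Subgroup.coe_subtype, map_list_prod, List.map_map]
    rfl
  have hconj : MulAut.conjNormal (cGen 0) h.beta = q⁻¹ * h.beta := by
    ext1
    rw [MulAut.conjNormal_apply, Subgroup.coe_mul, Subgroup.coe_inv, hq_coe,
      ← mul_inv_eq_iff_eq_mul]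
    exact eq_inv_of_mul_eq_one_left (cGen_dGen_relation n)
  rw [conjAb_abClass, hconj, abClass_mul, abClass_inv]
  simp [abClass, hq_one]

/-- The comparison map from `ℤ[ℤ/p]^{2n} ⊕ ℤ²` to the abelianization of the kernel. -/
noncomputable def ofModel (h : IsStandard φ) :
    Model n p →+ Additive (Abelianization φ.ker) where
  toFun v := ∑ i, h.ringAction (v.1 i) (abClass φ.ker (h.freeGen i)) +
    (v.2.1 • abClass φ.ker h.alpha + v.2.2 • abClass φ.ker h.beta)
  map_zero' := by simp
  map_add' v w := by
    simp only [Prod.fst_add, Prod.snd_add, Pi.add_apply, map_add, end_add_apply,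
      Finset.sum_add_distrib, add_smul]
    abel

theorem ofModel_apply (h : IsStandard φ) (v : Model n p) :
    h.ofModel v = ∑ i, h.ringAction (v.1 i) (abClass φ.ker (h.freeGen i)) +
      (v.2.1 • abClass φ.ker h.alpha + v.2.2 • abClass φ.ker h.beta) := rfl

theorem translation_freeGen (h : IsStandard φ) (i : Fin n ⊕ Fin n) :
    h.translation (abClass φ.ker (h.freeGen i)) = (Pi.single i 1, 0) := by
  rw [translation_abClass]
  rcases i with i | i <;> simp only [freeGen, affine_of] <;> simp [affineGen]

theorem translation_beta (h : IsStandard φ) :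
    h.translation (abClass φ.ker h.beta) = (0, (0, 1)) := by
  rw [translation_abClass]
  simp only [beta, affine_of]
  simp [affineGen]

theorem screw_pow_zero (n p m : ℕ) : (screw n p ^ m) 0 = (0, ((m : ℤ), 0)) := by
  induction m with
  | zero => rfl
  | succ m ih =>
    rw [pow_succ', Equiv.Perm.mul_apply, ih, screw_apply, shift_apply]
    ext <;> simp

theorem translation_alpha (h : IsStandard φ) :
    h.translation (abClass φ.ker h.alpha) = (0, ((p : ℤ), 0)) := by
  rw [translation_abClass]
  have : affine n p (cGen 0 ^ (p : ℤ)) = screw n p ^ p := by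
    rw [zpow_natCast, map_pow, affine_of]
    rfl
  rw [alpha, this, screw_pow_zero]

theorem translation_ofModel (h : IsStandard φ) (v : Model n p) :
    h.translation (h.ofModel v) = (v.1, (p * v.2.1, v.2.2)) := by
  have hfree (i : Fin n ⊕ Fin n) :
      h.translation (h.ringAction (v.1 i) (abClass φ.ker (h.freeGen i))) =
        (Pi.single i (v.1 i), 0) := by
    rw [translation_ringAction _ _ _ (by rw [translation_freeGen]), translation_freeGen]
    ext j : 2
    · obtain rfl | hij := eq_or_ne j i <;> simp [*]
    · rfl
    · rfl
  rw [ofModel_apply, map_add, map_add, map_zsmul, map_zsmul, map_sum, translation_alpha,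
    translation_beta]
  simp_rw [hfree]
  refine Prod.ext ?_ (Prod.ext ?_ ?_)
  · simpa [Prod.fst_sum, -Fintype.sum_sum_type] using Finset.univ_sum_single v.1
  · simp [Prod.snd_sum, mul_comm]
  · simp [Prod.snd_sum]

theorem ofModel_injective [NeZero p] (h : IsStandard φ) : Function.Injective h.ofModel :=
  fun v w hvw => by
    have := congrArg h.translation hvw
    rw [translation_ofModel, translation_ofModel] at this
    simp only [Prod.mk.injEq, mul_eq_mul_left_iff, Nat.cast_eq_zero, NeZero.ne p, or_false] at this
    exact Prod.ext this.1 (Prod.ext this.2.1 this.2.2)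

theorem conjAb_zpow_of_fixed {y : Additive (Abelianization φ.ker)}
    (hy : conjAb φ.ker (cGen 0) y = y) (k : ℤ) : conjAb φ.ker (cGen 0 ^ k) y = y := by
  induction k with
  | zero => simp
  | succ k ih => rw [zpow_add_one, map_mul, end_mul_apply, hy, ih]
  | pred k ih =>
    nth_rw 1 [← hy]
    rwa [← end_mul_apply, ← map_mul, ← zpow_add_one, sub_add_cancel]

theorem conjAb_zpow_ofModel (h : IsStandard φ) (k : ℤ) (v : Model n p) :
    conjAb φ.ker (cGen 0 ^ k) (h.ofModel v) = h.ofModel (shift (φ (cGen 0 ^ k)) v) := by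
  rw [ofModel_apply, ofModel_apply, map_add, map_add, map_zsmul, map_zsmul, map_sum,
    conjAb_zpow_of_fixed h.conjAb_alpha, conjAb_zpow_of_fixed h.conjAb_beta]
  simp_rw [shift_apply, map_mul, end_mul_apply, ringAction_single]

theorem exists_ker_mul_zpow (h : IsStandard φ) (g : SurfaceGroup (n + 1)) :
    ∃ (x : φ.ker) (k : ℤ), abClass φ.ker x ∈ h.ofModel.range ∧
      g = (x : SurfaceGroup (n + 1)) * cGen 0 ^ k := by
  have hconj (x : φ.ker) (hx : abClass φ.ker x ∈ h.ofModel.range) (k : ℤ) :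
      abClass φ.ker (MulAut.conjNormal (cGen 0 ^ k) x) ∈ h.ofModel.range := by
    obtain ⟨v, hv⟩ := hx
    rw [← conjAb_abClass, ← hv, h.conjAb_zpow_ofModel]
    exact ⟨_, rfl⟩
  have hfree (i : Fin n ⊕ Fin n) : abClass φ.ker (h.freeGen i) ∈ h.ofModel.range := by
    refine ⟨(Pi.single i 1, 0), ?_⟩
    rw [ofModel_apply, Finset.sum_eq_single i]
    · simp
    · intro j _ hj
      simp [hj]
    · simp
  have hone : abClass φ.ker 1 ∈ h.ofModel.range := by
    rw [abClass_one]
    exact zero_mem _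
  have hg : g ∈ Subgroup.closure (Set.range (PresentedGroup.of (rels := {surfaceRel (n + 1)}))) :=
    PresentedGroup.closure_range_of _ ▸ Subgroup.mem_top g
  induction hg using Subgroup.closure_induction with
  | mem x hx =>
    obtain ⟨x, rfl⟩ := hx
    match x with
    | .c i =>
      refine Fin.cases ⟨1, 1, hone, by simp⟩ (fun j => ⟨h.freeGen (.inl j), 0, hfree _, ?_⟩) i
      simp [freeGen]
    | .d i =>
      refine Fin.cases ⟨h.beta, 0, ⟨(0, (0, 1)), ?_⟩, ?_⟩
        (fun j => ⟨h.freeGen (.inr j), 0, hfree _, ?_⟩) i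
      · simp [ofModel_apply]
      · simp [beta]
      · simp [freeGen]
  | one => exact ⟨1, 0, hone, by simp⟩
  | mul x y _ _ hx hy =>
    obtain ⟨x, k, hx, rfl⟩ := hx
    obtain ⟨y, l, hy, rfl⟩ := hy
    refine ⟨x * MulAut.conjNormal (cGen 0 ^ k) y, k + l, ?_, ?_⟩
    · rw [abClass_mul]
      exact add_mem hx (hconj y hy k)
    · rw [Subgroup.coe_mul, MulAut.conjNormal_apply, zpow_add]
      group
  | inv x _ hx =>
    obtain ⟨x, k, hx, rfl⟩ := hx
    refine ⟨MulAut.conjNormal (cGen 0 ^ (-k)) x⁻¹, -k, hconj _ ?_ _, ?_⟩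
    · rw [abClass_inv]
      exact neg_mem hx
    · rw [MulAut.conjNormal_apply, Subgroup.coe_inv]
      group

theorem ofModel_surjective (h : IsStandard φ) : Function.Surjective h.ofModel := fun y => by
  obtain ⟨g, rfl⟩ := abClass_surjective _ y
  obtain ⟨x, k, hx, hg⟩ := h.exists_ker_mul_zpow g
  have hk : φ (cGen 0 ^ k) = 1 := by
    have := congrArg φ hg
    rwa [map_mul, MonoidHom.mem_ker.1 g.2, MonoidHom.mem_ker.1 x.2, one_mul, eq_comm] at this
  rw [h.map_zpow, ofAdd_eq_one, ZMod.intCast_zmod_eq_zero_iff_dvd] at hk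
  obtain ⟨l, rfl⟩ := hk
  have hgx : g = x * h.alpha ^ l := by
    ext1
    rw [hg, Subgroup.coe_mul, Subgroup.coe_zpow, alpha, zpow_mul]
  rw [hgx, abClass_mul, abClass_zpow]
  refine add_mem (S := AddSubgroup _) (s := h.ofModel.range) hx ⟨(0, (l, 0)), ?_⟩
  simp [ofModel_apply]

/-- The abelianization of the kernel is `ℤ[ℤ/p]^{2n} ⊕ ℤ²`. -/
noncomputable def kerAbEquiv [NeZero p] (h : IsStandard φ) :
    Additive (Abelianization φ.ker) ≃+ Model n p :=
  (AddEquiv.ofBijective h.ofModel ⟨h.ofModel_injective, h.ofModel_surjective⟩).symm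

theorem kerAbEquiv_conjAb [NeZero p] (h : IsStandard φ) (y : Additive (Abelianization φ.ker)) :
    h.kerAbEquiv (conjAb φ.ker (cGen 0) y) =
      (fun i => sElt p * (h.kerAbEquiv y).1 i, (h.kerAbEquiv y).2) := by
  obtain ⟨v, rfl⟩ := h.kerAbEquiv.symm.surjective y
  rw [AddEquiv.apply_symm_apply, ← AddEquiv.eq_symm_apply]
  have := h.conjAb_zpow_ofModel 1 v
  rw [zpow_one, h.c_zero] at this
  exact this

end IsStandard

end SurfaceGroup

/-- for the fixed-point-free case, with `F₀` the surface group of genus `g₀ ≥ 2`,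
`φ(a₁) = 1` and all other generators mapped to `0`, and `F = ker φ` with the `ℤ/pℤ`-action on
`F^{ab}` induced by conjugation by `a₁`, the module `F^{ab}` is isomorphic as a
`ℤ[ℤ/pℤ]`-module to `(ℤ[ℤ/pℤ])^{2(g₀−1)} ⊕ ℤ²` with trivial action on `ℤ²`; in particular
there are elements `α`, `β` of `F` whose classes in `F^{ab}` are fixed by the action. -/
theorem fixed_point_free_module_iso (p g₀ : ℕ) (hp : p.Prime) (hg₀ : 2 ≤ g₀)
    (φ : SurfaceGroup g₀ →* Multiplicative (ZMod p))
    (hφa₁ : φ (PresentedGroup.of (SGen.c ⟨0, by omega⟩)) =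
      Multiplicative.ofAdd ((1 : ZMod p)))
    (hφa : ∀ i : Fin g₀, (i : ℕ) ≠ 0 → φ (PresentedGroup.of (SGen.c i)) = 1)
    (hφb : ∀ i : Fin g₀, φ (PresentedGroup.of (SGen.d i)) = 1) :
    (∃ e : Additive (Abelianization φ.ker) ≃+
        ((Fin (2 * (g₀ - 1)) → GrpRing p) × (ℤ × ℤ)),
      ∀ y : Abelianization φ.ker,
        e (Additive.ofMul
            (Abelianization.map
              ((MulAut.conjNormal
                  (PresentedGroup.of (SGen.c ⟨0, by omega⟩) : SurfaceGroup g₀) :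
                MulAut φ.ker)).toMonoidHom y)) =
          (fun i => sElt p * (e (Additive.ofMul y)).1 i,
            (e (Additive.ofMul y)).2)) ∧
    ∃ α β : φ.ker,
      Abelianization.map
          ((MulAut.conjNormal
              (PresentedGroup.of (SGen.c ⟨0, by omega⟩) : SurfaceGroup g₀) :
            MulAut φ.ker)).toMonoidHom (Abelianization.of α) = Abelianization.of α ∧
      Abelianization.map
          ((MulAut.conjNormal
              (PresentedGroup.of (SGen.c ⟨0, by omega⟩) : SurfaceGroup g₀) :
            MulAut φ.ker)).toMonoidHom (Abelianization.of β) = Abelianization.of β := by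
  obtain ⟨n, rfl⟩ : ∃ n, g₀ = n + 1 := ⟨g₀ - 1, by omega⟩
  have : NeZero p := ⟨hp.ne_zero⟩
  have h : SurfaceGroup.IsStandard φ := ⟨hφa₁, fun i => hφa i.succ (by simp), hφb⟩
  refine ⟨?_, h.alpha, h.beta, h.conjAb_alpha, h.conjAb_beta⟩
  let σ : Fin (2 * (n + 1 - 1)) ≃ Fin n ⊕ Fin n :=
    (finCongr (by omega)).trans finSumFinEquiv.symm
  refine ⟨h.kerAbEquiv.trans
    (AddEquiv.prodCongr (LinearEquiv.funCongrLeft ℤ (GrpRing p) σ).toAddEquiv (.refl _)),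
    fun y => ?_⟩
  have := h.kerAbEquiv_conjAb (Additive.ofMul y)
  exact congrArg (fun v : SurfaceGroup.Model n p => ((fun i => v.1 (σ i)), v.2)) this
end
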